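/- Let G be a graph that possesses an (ℓ, Δ)-earring. Then G has an edge e such that cr(G − e) > (2/3)·cr(G) − (2/3)(Δℓ + ℓ²). -/

import Mathlib

/-- A loopless-or-not multigraph on vertex type `V` with edge type `E`:
each edge has a pair of endpoints. -/
structure Multigraph (V E : Type) where
  ends : E → Sym2 V

namespace Multigraph

variable {V E : Type}

/-- A multigraph is loopless if no edge has equal endpoints. -/
def Loopless (G : Multigraph V E) : Prop := ∀ e, ¬ (G.ends e).IsDiag

/-- The degree of a vertex: the number of edges incident with it. -/
noncomputable def degree (G : Multigraph V E) (v : V) : ℕ :=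
  Set.ncard {e : E | v ∈ G.ends e}

/-- Two (distinct) vertices are adjacent if some edge joins them. -/
def Adj (G : Multigraph V E) (u v : V) : Prop := u ≠ v ∧ ∃ e, G.ends e = s(u, v)

/-- One adjacency step avoiding a vertex set `A` and an edge set `S`. -/
def AdjAvoid (G : Multigraph V E) (A : Set V) (S : Set E) (u v : V) : Prop :=
  u ∉ A ∧ v ∉ A ∧ ∃ e, e ∉ S ∧ G.ends e = s(u, v)

/-- Reachability in the graph obtained by deleting the vertices `A` and edges `S`. -/
def Reach (G : Multigraph V E) (A : Set V) (S : Set E) : V → V → Prop :=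
  Relation.ReflTransGen (G.AdjAvoid A S)

/-- The graph minus the vertex set `A` is connected. -/
def ConnectedAvoiding (G : Multigraph V E) (A : Set V) : Prop :=
  ∀ u v : V, u ∉ A → v ∉ A → G.Reach A ∅ u v

def Connected (G : Multigraph V E) : Prop := G.ConnectedAvoiding ∅

def TwoConnected (G : Multigraph V E) : Prop :=
  3 ≤ Nat.card V ∧ ∀ x : V, G.ConnectedAvoiding {x}

/-- `{f, g}` is a 2-edge-cut: removing both destroys some reachability. -/
def IsTwoEdgeCut (G : Multigraph V E) (f g : E) : Prop :=
  f ≠ g ∧ ∃ u v : V, G.Reach ∅ ∅ u v ∧ ¬ G.Reach ∅ {f, g} u v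

/-- `{u, v}` is a 2-vertex-cut. -/
def IsVertexCut2 (G : Multigraph V E) (u v : V) : Prop :=
  u ≠ v ∧ ∃ x y : V, x ∉ ({u, v} : Set V) ∧ y ∉ ({u, v} : Set V) ∧ ¬ G.Reach {u, v} ∅ x y

/-- `K` is (the vertex set of) a connected component of `G − A`. -/
def IsCompAvoiding (G : Multigraph V E) (A : Set V) (K : Set V) : Prop :=
  ∃ x, x ∉ A ∧ K = {y | y ∉ A ∧ G.Reach A ∅ x y}

/-- `Z` is an anchor: no vertex of `Z` lies in a 2-vertex-cut, and every
nontrivial bridge (i.e. component of `G − {u,v}`) of every 2-vertex-cut `{u,v}`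
contains a vertex of `Z`. -/
def IsAnchor (G : Multigraph V E) (Z : Set V) : Prop :=
  (∀ z ∈ Z, ∀ u v : V, G.IsVertexCut2 u v → z ≠ u ∧ z ≠ v) ∧
  (∀ u v : V, G.IsVertexCut2 u v → ∀ K : Set V, G.IsCompAvoiding {u, v} K → ∃ z ∈ Z, z ∈ K)

/-- A (simple) path from `u` to `v` in a multigraph: a list of pairwise distinct
vertices together with the list of edges joining the consecutive vertices. -/
structure MPath (G : Multigraph V E) (u v : V) where
  verts : List V
  edges : List E
  len_eq : verts.length = edges.length + 1
  head_eq : verts.head? = some u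
  last_eq : verts.getLast? = some v
  ends_eq : ∀ i : ℕ, (hi : i < edges.length) →
    G.ends (edges.get ⟨i, hi⟩) =
      s(verts.get ⟨i, by omega⟩, verts.get ⟨i + 1, by omega⟩)
  vnodup : verts.Nodup
  enodup : edges.Nodup

/-- The internal vertices of a path: all vertices but the two endpoints. -/
def MPath.internal {G : Multigraph V E} {u v : V} (p : G.MPath u v) : List V :=
  (p.verts.drop 1).dropLast

/-- A branch: a nontrivial path whose endpoints have degree at least 3 and
whose internal vertices have degree 2. -/
def IsBranchPath (G : Multigraph V E) {u v : V} (p : G.MPath u v) : Prop :=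
  p.edges ≠ [] ∧ 3 ≤ G.degree u ∧ 3 ≤ G.degree v ∧ ∀ w ∈ p.internal, G.degree w = 2

/-- The edge sets of branches with both endpoints in `B` (a branch is determined,
up to reversal, by its edge set). -/
def branchSets (G : Multigraph V E) (B : Set V) : Set (Set E) :=
  {S | ∃ u v, u ∈ B ∧ v ∈ B ∧ ∃ p : G.MPath u v, G.IsBranchPath p ∧ {e | e ∈ p.edges} = S}

/-- An `(ℓ, Δ)`-earring: a base edge `uv` plus two distinct `uv`-paths avoiding the
base edge, of length at most `ℓ`, with internal vertices of degree `< Δ`, and such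
that every common edge `f` of the two paths makes `{base, f}` a 2-edge-cut. -/
structure Earring (G : Multigraph V E) (ℓ Δ : ℕ) where
  base : E
  u : V
  v : V
  une : u ≠ v
  ends_base : G.ends base = s(u, v)
  P : G.MPath u v
  Q : G.MPath u v
  PQ_distinct : P.verts ≠ Q.verts ∨ P.edges ≠ Q.edges
  base_not_P : base ∉ P.edges
  base_not_Q : base ∉ Q.edges
  lenP : P.edges.length ≤ ℓ
  lenQ : Q.edges.length ≤ ℓ
  degP : ∀ w ∈ P.internal, G.degree w < Δ
  degQ : ∀ w ∈ Q.internal, G.degree w < Δ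
  common_cut : ∀ f, f ∈ P.edges → f ∈ Q.edges → G.IsTwoEdgeCut base f

def Earring.edgeSet {G : Multigraph V E} {ℓ Δ : ℕ} (X : G.Earring ℓ Δ) : Set E :=
  {X.base} ∪ {e | e ∈ X.P.edges} ∪ {e | e ∈ X.Q.edges}

def Earring.vertexSet {G : Multigraph V E} {ℓ Δ : ℕ} (X : G.Earring ℓ Δ) : Set V :=
  {w | w ∈ X.P.verts ∨ w ∈ X.Q.verts}

/-- A drawing of a multigraph in the plane: an injective placement of the vertices
together with, for each edge, a simple arc joining the placements of its endpoints,
whose interior avoids all vertices. -/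
structure Drawing (G : Multigraph V E) where
  vpos : V → ℝ × ℝ
  arc : E → ℝ → ℝ × ℝ
  vpos_inj : Function.Injective vpos
  arc_cont : ∀ e, ContinuousOn (arc e) (Set.Icc 0 1)
  arc_inj : ∀ e, Set.InjOn (arc e) (Set.Icc 0 1)
  arc_ends : ∀ e, ∃ x y : V, G.ends e = s(x, y) ∧ arc e 0 = vpos x ∧ arc e 1 = vpos y
  arc_avoid : ∀ e, ∀ t ∈ Set.Ioo (0:ℝ) 1, ∀ x : V, arc e t ≠ vpos x

/-- The (doubly counted) set of crossings of a drawing: interior points where two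
distinct edges meet. -/
def Drawing.CrossSet {G : Multigraph V E} (D : G.Drawing) : Set ((E × E) × ℝ × ℝ) :=
  {q | q.1.1 ≠ q.1.2 ∧ q.2.1 ∈ Set.Ioo (0:ℝ) 1 ∧ q.2.2 ∈ Set.Ioo (0:ℝ) 1 ∧
    D.arc q.1.1 q.2.1 = D.arc q.1.2 q.2.2}

/-- A good drawing: one with finitely many crossings. -/
structure GoodDrawing (G : Multigraph V E) extends G.Drawing where
  finCross : toDrawing.CrossSet.Finite

/-- The number of crossings of a good drawing (each crossing is recorded twice
in `CrossSet`). -/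
noncomputable def GoodDrawing.crossings {G : Multigraph V E} (D : G.GoodDrawing) : ℕ :=
  D.toDrawing.CrossSet.ncard / 2

/-- The crossing number: the least number of crossings of a drawing. -/
noncomputable def crNum (G : Multigraph V E) : ℕ :=
  sInf {n : ℕ | ∃ D : G.GoodDrawing, D.crossings = n}

/-- A multigraph is planar if it has a crossing-free drawing. -/
def IsPlanar (G : Multigraph V E) : Prop := ∃ D : G.Drawing, D.CrossSet = ∅

/-- Deleting a set of edges. -/
def delete (G : Multigraph V E) (S : Set E) : Multigraph V {e : E // e ∉ S} :=
  ⟨fun e => G.ends e.1⟩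

/-- The image (point set) of a drawing in the plane. -/
def Drawing.image {G : Multigraph V E} (D : G.Drawing) : Set (ℝ × ℝ) :=
  Set.range D.vpos ∪ ⋃ e : E, D.arc e '' Set.Icc 0 1

/-- The faces of a drawing: the connected components of the complement of its image. -/
def Drawing.Faces {G : Multigraph V E} (D : G.Drawing) : Set (Set (ℝ × ℝ)) :=
  {C | ∃ p ∉ D.image, C = connectedComponentIn D.imageᶜ p}

/-- A vertex is incident with a face if its placement lies on the face's closure. -/
def Drawing.FaceIncident {G : Multigraph V E} (D : G.Drawing) (x : V) (C : Set (ℝ × ℝ)) :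
    Prop := D.vpos x ∈ closure C

/-- The weighted number of crossings of a good drawing. -/
noncomputable def GoodDrawing.wcross {G : Multigraph V E} (D : G.GoodDrawing)
    (w : E → ℝ) : ℝ :=
  (∑ q ∈ D.finCross.toFinset, w q.1.1 * w q.1.2) / 2

/-- The weighted crossing number of `(G, w)`. -/
noncomputable def wcr (G : Multigraph V E) (w : E → ℝ) : ℝ :=
  sInf {x : ℝ | ∃ D : G.GoodDrawing, D.wcross w = x}

end Multigraph

/-- The uniform probability measure on `[0,1]^E`, modelling i.i.d. uniform `[0,1]`
weights on the edges. -/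
noncomputable def cubeMeasure (E : Type) [Fintype E] : MeasureTheory.Measure (E → ℝ) :=
  (MeasureTheory.volume : MeasureTheory.Measure (E → ℝ)).restrict
    {w | ∀ e, w e ∈ Set.Icc (0:ℝ) 1}

open Set

/-- The Euclidean plane, as a product of two lines. -/
abbrev Plane := ℝ × ℝ

namespace Polyline

/-- The closed segment spanned by an unordered pair of points. -/
def segSet (s : Sym2 Plane) : Set Plane :=
  Sym2.lift ⟨fun a b => segment ℝ a b, segment_symm ℝ⟩ s

@[simp] lemma segSet_mk (a b : Plane) : segSet s(a, b) = segment ℝ a b := rfl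

/-- The support of a polygonal line given by its list of corners. -/
def supp : List Plane → Set Plane
  | [] => ∅
  | [a] => {a}
  | a :: b :: l => segment ℝ a b ∪ supp (b :: l)

/-- The list of sides of a polygonal line. -/
def segs : List Plane → List (Sym2 Plane)
  | [] => []
  | [_] => []
  | a :: b :: l => s(a, b) :: segs (b :: l)

/-- A polygonal line without self-intersections. -/
def Simple : List Plane → Prop
  | [] => True
  | [_] => True
  | a :: b :: l => a ≠ b ∧ segment ℝ a b ∩ supp (b :: l) ⊆ {b} ∧ Simple (b :: l)

lemma isCompact_segment (a b : Plane) : IsCompact (segment ℝ a b) := by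
  rw [← convexHull_pair]
  exact (Set.toFinite _).isCompact_convexHull ℝ

lemma isCompact_segSet (s : Sym2 Plane) : IsCompact (segSet s) := by
  induction s with
  | _ a b => exact isCompact_segment a b

lemma mem_segSet {s : Sym2 Plane} {x : Plane} (h : x ∈ s) : x ∈ segSet s := by
  induction s with
  | _ a b =>
    rcases Sym2.mem_iff.1 h with rfl | rfl
    · exact left_mem_segment ℝ _ _
    · exact right_mem_segment ℝ _ _

lemma isCompact_supp : ∀ l : List Plane, IsCompact (supp l)
  | [] => isCompact_empty
  | [_] => isCompact_singleton
  | a :: b :: l => (isCompact_segment a b).union (isCompact_supp (b :: l))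

lemma mem_supp_of_mem : ∀ {l : List Plane} {a : Plane}, a ∈ l → a ∈ supp l
  | [b], a, h => by simpa [supp] using h
  | b :: c :: l, a, h => by
    rcases List.mem_cons.1 h with rfl | h
    · exact Or.inl (left_mem_segment ℝ _ _)
    · exact Or.inr (mem_supp_of_mem h)

lemma segSet_subset_supp : ∀ {l : List Plane} {s : Sym2 Plane}, s ∈ segs l → segSet s ⊆ supp l
  | a :: b :: l, s, h => by
    rcases List.mem_cons.1 h with rfl | h
    · exact subset_union_left
    · exact (segSet_subset_supp h).trans subset_union_right

lemma mem_of_mem_segs : ∀ {l : List Plane} {s : Sym2 Plane} {a : Plane},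
    s ∈ segs l → a ∈ s → a ∈ l
  | b :: c :: l, s, a, h, ha => by
    rcases List.mem_cons.1 h with rfl | h
    · rcases Sym2.mem_iff.1 ha with rfl | rfl <;> simp
    · exact List.mem_cons_of_mem _ (mem_of_mem_segs h ha)

lemma exists_segs_of_mem_supp : ∀ {l : List Plane} {x : Plane}, 2 ≤ l.length → x ∈ supp l →
    ∃ s ∈ segs l, x ∈ segSet s
  | [a, b], x, _, h => by
    rcases h with h | h
    · exact ⟨s(a, b), by simp [segs], h⟩
    · refine ⟨s(a, b), by simp [segs], ?_⟩
      rw [show x = b from h]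
      exact right_mem_segment ℝ _ _
  | a :: b :: c :: l, x, _, h => by
    rcases h with h | h
    · exact ⟨s(a, b), by simp [segs], h⟩
    · obtain ⟨s, hs, hx⟩ := exists_segs_of_mem_supp (l := b :: c :: l) (by simp) h
      exact ⟨s, List.mem_cons_of_mem _ hs, hx⟩

lemma supp_append : ∀ (l₁ l₂ : List Plane) (a : Plane),
    supp (l₁ ++ a :: l₂) = supp (l₁ ++ [a]) ∪ supp (a :: l₂)
  | [], l₂, a => by
    have : a ∈ supp (a :: l₂) := mem_supp_of_mem (by simp)
    simp only [List.nil_append, supp, singleton_union]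
    exact (insert_eq_of_mem this).symm
  | [b], l₂, a => by
    have : a ∈ supp (a :: l₂) := mem_supp_of_mem (by simp)
    simp only [List.cons_append, List.nil_append, supp]
    rw [union_assoc, singleton_union, insert_eq_of_mem this]
  | b :: c :: l, l₂, a => by
    have := supp_append (c :: l) l₂ a
    simp only [List.cons_append, supp] at this ⊢
    rw [this, union_assoc]

lemma segs_append : ∀ (l₁ l₂ : List Plane) (a : Plane),
    segs (l₁ ++ a :: l₂) = segs (l₁ ++ [a]) ++ segs (a :: l₂)
  | [], l₂, a => by simp [segs]
  | [b], l₂, a => by simp [segs]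
  | b :: c :: l, l₂, a => by
    have := segs_append (c :: l) l₂ a
    simp only [List.cons_append, segs] at this ⊢
    rw [this]

lemma supp_reverse : ∀ l : List Plane, supp l.reverse = supp l
  | [] => rfl
  | [_] => rfl
  | a :: b :: l => by
    have := supp_reverse (b :: l)
    simp only [List.reverse_cons, List.append_assoc, List.cons_append, List.nil_append] at this ⊢
    rw [supp_append, this]
    have ha : a ∈ segment ℝ a b := left_mem_segment ℝ _ _
    simp only [supp, segment_symm ℝ b a]
    rw [union_comm, union_eq_self_of_subset_right (singleton_subset_iff.2 ha)]

lemma segs_reverse : ∀ l : List Plane, segs l.reverse = (segs l).reverse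
  | [] => rfl
  | [_] => rfl
  | a :: b :: l => by
    have := segs_reverse (b :: l)
    simp only [List.reverse_cons, List.append_assoc, List.cons_append, List.nil_append] at this ⊢
    rw [segs_append, this]
    simp [segs, Sym2.eq_swap]

lemma simple_append : ∀ {l₁ l₂ : List Plane} {a : Plane}, Simple (l₁ ++ a :: l₂) ↔
    Simple (l₁ ++ [a]) ∧ Simple (a :: l₂) ∧ supp (l₁ ++ [a]) ∩ supp (a :: l₂) ⊆ {a}
  | [], l₂, a => by
    simp [Simple, supp]
  | [b], l₂, a => by
    have : a ∈ supp (a :: l₂) := mem_supp_of_mem (by simp)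
    simp only [List.cons_append, List.nil_append, Simple, supp, union_inter_distrib_right,
      union_subset_iff]
    have h1 : segment ℝ b a ∩ {a} ⊆ {a} := inter_subset_right
    have h2 : ({a} : Set Plane) ∩ supp (a :: l₂) ⊆ {a} := inter_subset_left
    tauto
  | b :: c :: l, l₂, a => by
    have IH := simple_append (l₁ := c :: l) (l₂ := l₂) (a := a)
    have hs := supp_append (c :: l) l₂ a
    have hc : c ∈ supp (c :: l ++ [a]) := mem_supp_of_mem (by simp)
    have ha : a ∈ supp (c :: l ++ [a]) := mem_supp_of_mem (by simp)
    have ha' : a ∈ supp (a :: l₂) := mem_supp_of_mem (by simp)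
    have hcb : c ∈ segment ℝ b c := right_mem_segment ℝ _ _
    simp only [List.cons_append, Simple, supp] at IH hs hc ha ⊢
    rw [IH, hs, inter_union_distrib_left, union_subset_iff, union_inter_distrib_right,
      union_subset_iff]
    constructor
    · rintro ⟨h1, ⟨h2, h3⟩, h4, h5, h6⟩
      refine ⟨⟨h1, h2, h4⟩, h5, fun x hx => ?_, h6⟩
      have : x = c := h3 hx
      subst this
      exact h6 ⟨hc, hx.2⟩
    · rintro ⟨⟨h1, h2, h4⟩, h5, h7, h6⟩
      refine ⟨h1, ⟨h2, fun x hx => ?_⟩, h4, h5, h6⟩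
      have : x = a := h7 hx
      subst this
      exact h2 ⟨hx.1, ha⟩

lemma Simple.tail {a : Plane} {l : List Plane} (h : Simple (a :: l)) : Simple l := by
  cases l with
  | nil => trivial
  | cons b l => exact h.2.2

lemma Simple.notMem {a b : Plane} {l : List Plane} (h : Simple (a :: b :: l)) :
    a ∉ supp (b :: l) := fun ha => h.1 (h.2.1 ⟨left_mem_segment ℝ _ _, ha⟩)

lemma Simple.nodup : ∀ {l : List Plane}, Simple l → l.Nodup
  | [], _ => by simp
  | [_], _ => by simp
  | a :: b :: l, h => List.nodup_cons.2 ⟨fun ha => h.notMem (mem_supp_of_mem ha),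
      Simple.nodup h.2.2⟩

lemma Simple.reverse : ∀ {l : List Plane}, Simple l → Simple l.reverse
  | [], _ => trivial
  | [_], _ => trivial
  | a :: b :: l, h => by
    have IH := Simple.reverse h.2.2
    have hs := supp_reverse (b :: l)
    simp only [List.reverse_cons, List.append_assoc, List.cons_append, List.nil_append] at IH hs ⊢
    refine simple_append.2 ⟨IH, ⟨h.1.symm, ?_, trivial⟩, ?_⟩
    · exact inter_subset_right
    · rw [hs]
      rintro x ⟨hx, hx'⟩
      refine h.2.1 ⟨?_, hx⟩
      rcases hx' with hx' | hx'
      · rwa [segment_symm]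
      · rw [show x = a from hx']
        exact left_mem_segment ℝ _ _

lemma Simple.mem_seg : ∀ {l : List Plane}, Simple l → ∀ {x : Plane} {s : Sym2 Plane}, x ∈ l →
    s ∈ segs l → x ∈ segSet s → x ∈ s
  | a :: b :: l, h, x, s, hx, hs, hxs => by
    rcases List.mem_cons.1 hx with rfl | hx <;> rcases List.mem_cons.1 hs with rfl | hs
    · simp
    · exact absurd (segSet_subset_supp hs hxs) h.notMem
    · have : x = b := h.2.1 ⟨hxs, mem_supp_of_mem hx⟩
      simp [this]
    · exact Simple.mem_seg h.2.2 hx hs hxs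

lemma Simple.seg_inter : ∀ {l : List Plane}, Simple l → ∀ {x : Plane} {s t : Sym2 Plane},
    s ∈ segs l → t ∈ segs l → s ≠ t → x ∈ segSet s → x ∈ segSet t → x ∈ l
  | a :: b :: l, h, x, s, t, hs, ht, hst, hxs, hxt => by
    rcases List.mem_cons.1 hs with rfl | hs <;> rcases List.mem_cons.1 ht with rfl | ht
    · exact absurd rfl hst
    · have : x = b := h.2.1 ⟨hxs, segSet_subset_supp ht hxt⟩
      simp [this]
    · have : x = b := h.2.1 ⟨hxt, segSet_subset_supp hs hxs⟩
      simp [this]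
    · exact List.mem_cons_of_mem _ (Simple.seg_inter h.2.2 hs ht hst hxs hxt)

lemma Simple.nodup_segs : ∀ {l : List Plane}, Simple l → (segs l).Nodup
  | [], _ => by simp [segs]
  | [_], _ => by simp [segs]
  | a :: b :: l, h => List.nodup_cons.2
      ⟨fun ha => h.notMem (mem_supp_of_mem (mem_of_mem_segs ha (by simp))),
        Simple.nodup_segs h.2.2⟩

lemma Simple.ne_of_mem_segs : ∀ {l : List Plane}, Simple l → ∀ {a b : Plane},
    s(a, b) ∈ segs l → a ≠ b
  | c :: d :: l, h, a, b, hab => by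
    rcases List.mem_cons.1 hab with hab | hab
    · have := h.1
      rcases Sym2.eq_iff.1 hab with ⟨rfl, rfl⟩ | ⟨rfl, rfl⟩
      · exact this
      · exact this.symm
    · exact Simple.ne_of_mem_segs h.2.2 hab

open Classical in
/-- The sides of a polygonal line that have `a` as an endpoint. -/
noncomputable def spokes (l : List Plane) (a : Plane) : Finset (Sym2 Plane) :=
  {s ∈ (segs l).toFinset | a ∈ s}

lemma mem_spokes {l : List Plane} {a : Plane} {s : Sym2 Plane} :
    s ∈ spokes l a ↔ s ∈ segs l ∧ a ∈ s := by simp [spokes]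

lemma spokes_eq_empty {l : List Plane} {a : Plane} (h : a ∉ l) : spokes l a = ∅ := by
  ext s
  simp only [mem_spokes, Finset.notMem_empty, iff_false, not_and]
  exact fun hs ha => h (mem_of_mem_segs hs ha)

lemma eq_or_eq_of_mem_spokes {l₁ l₂ : List Plane} {x a y : Plane}
    (h : Simple (l₁ ++ x :: a :: y :: l₂)) {s : Sym2 Plane}
    (hs : s ∈ segs (l₁ ++ x :: a :: y :: l₂)) (ha : a ∈ s) : s = s(x, a) ∨ s = s(a, y) := by
  rw [segs_append] at hs
  have hn := h.nodup
  simp only [segs, List.mem_append, List.mem_cons] at hs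
  rcases hs with hs | rfl | rfl | hs
  · have := mem_of_mem_segs hs ha
    simp only [List.mem_append, List.mem_cons, List.not_mem_nil, or_false] at this
    rw [List.nodup_append] at hn
    rcases this with h' | rfl
    · exact absurd rfl (hn.2.2 a h' a (by simp))
    · simp at hn
  · exact Or.inl rfl
  · exact Or.inr rfl
  · have := mem_of_mem_segs hs ha
    rw [List.nodup_append] at hn
    have h2 := hn.2.1
    simp only [List.nodup_cons] at h2
    exact absurd this h2.2.1

lemma card_spokes_head {a : Plane} {l : List Plane} (h : Simple (a :: l)) :
    (spokes (a :: l) a).card ≤ 1 := by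
  rw [Finset.card_le_one]
  have key : ∀ s ∈ spokes (a :: l) a, ∀ b l', l = b :: l' → s = s(a, b) := by
    intro s hs b l' hl
    subst hl
    obtain ⟨hs, ha⟩ := mem_spokes.1 hs
    rcases List.mem_cons.1 hs with rfl | hs
    · rfl
    · exact absurd (mem_supp_of_mem (mem_of_mem_segs hs ha)) h.notMem
  intro s hs t ht
  cases l with
  | nil => simp [mem_spokes, segs] at hs
  | cons b l => rw [key s hs b l rfl, key t ht b l rfl]

lemma spokes_reverse (l : List Plane) (a : Plane) : spokes l.reverse a = spokes l a := by
  ext s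
  simp [mem_spokes, segs_reverse]

lemma card_spokes_le {l : List Plane} (h : Simple l) (a : Plane) : (spokes l a).card ≤ 2 := by
  induction l with
  | nil => simp [spokes, segs]
  | cons x l IH =>
    cases l with
    | nil => simp [spokes, segs]
    | cons y l =>
      classical
      have hsub : spokes (x :: y :: l) a ⊆ (if a ∈ s(x, y) then {s(x, y)} else ∅) ∪
          spokes (y :: l) a := by
        intro s hs
        obtain ⟨hs, ha⟩ := mem_spokes.1 hs
        rcases List.mem_cons.1 hs with rfl | hs
        · simp only [if_pos ha]; simp
        · exact Finset.mem_union_right _ (mem_spokes.2 ⟨hs, ha⟩)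
      have hle := (Finset.card_le_card hsub).trans (Finset.card_union_le _ _)
      by_cases hx : a = x
      · subst hx
        exact (card_spokes_head h).trans (by norm_num)
      by_cases hy : a = y
      · subst hy
        have := card_spokes_head h.2.2
        rw [if_pos (by simp)] at hle
        simp only [Finset.card_singleton] at hle
        omega
      · rw [if_neg (by simp [hx, hy])] at hle
        have := IH h.2.2
        simp only [Finset.card_empty] at hle
        omega

/-- Cutting a simple polygonal line at its last visit to a closed set. -/
lemma exists_last_exit {K : Set Plane} (hK : IsClosed K) :
    ∀ {l : List Plane} {y : Plane}, Simple l → l.getLast? = some y → (supp l ∩ K).Nonempty →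
    ∃ r l', Simple (r :: l') ∧ (r :: l').getLast? = some y ∧ supp (r :: l') ⊆ supp l ∧ r ∈ K ∧
      supp (r :: l') ∩ K ⊆ {r}
  | [a], y, _, hy, hK' => by
    obtain ⟨x, hx, hxK⟩ := hK'
    have : x = a := hx
    subst this
    exact ⟨x, [], trivial, hy, Subset.rfl, hxK, inter_subset_left⟩
  | a :: b :: l, y, h, hy, hK' => by
    by_cases hb : (supp (b :: l) ∩ K).Nonempty
    · obtain ⟨r, l', h1, h2, h3, h4⟩ := exists_last_exit hK h.2.2 (by simpa using hy) hb
      exact ⟨r, l', h1, h2, h3.trans subset_union_right, h4⟩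
    · have hab : (segment ℝ a b ∩ K).Nonempty := by
        obtain ⟨x, hx | hx, hxK⟩ := hK'
        · exact ⟨x, hx, hxK⟩
        · exact absurd ⟨x, hx, hxK⟩ hb
      have hcomp : IsCompact (segment ℝ a b ∩ K) := (isCompact_segment a b).inter_right hK
      obtain ⟨r, ⟨hr, hrK⟩, hmin⟩ := hcomp.exists_isMinOn hab
        (f := fun x => dist x b) (by fun_prop)
      have hsub : segment ℝ r b ⊆ segment ℝ a b :=
        (convex_segment a b).segment_subset hr (right_mem_segment ℝ _ _)
      have hrb : r ≠ b := by
        rintro rfl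
        exact hb ⟨r, mem_supp_of_mem (by simp), hrK⟩
      refine ⟨r, b :: l, ⟨hrb, ?_, h.2.2⟩, by simpa using hy,
        union_subset_union_left _ hsub, hrK, ?_⟩
      · exact (inter_subset_inter_left _ hsub).trans h.2.1
      · rintro x ⟨hx | hx, hxK⟩
        · have h1 : dist r b ≤ dist x b := hmin ⟨hsub hx, hxK⟩
          obtain ⟨t, ⟨ht0, ht1⟩, rfl⟩ := (segment_eq_image' ℝ r b ▸ hx)
          have h2 : dist (r + t • (b - r)) b = (1 - t) * dist r b := by
            rw [dist_eq_norm, dist_eq_norm]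
            have : r + t • (b - r) - b = (1 - t) • (r - b) := by module
            rw [this, norm_smul, Real.norm_of_nonneg (by linarith)]
          have hpos : 0 < dist r b := dist_pos.2 hrb
          have : t = 0 := by nlinarith
          simp [this]
        · exact absurd ⟨x, hx, hxK⟩ hb

lemma exists_simple : ∀ {l : List Plane} {x y : Plane}, l.head? = some x → l.getLast? = some y →
    ∃ l', Simple l' ∧ l'.head? = some x ∧ l'.getLast? = some y ∧ supp l' ⊆ supp l
  | [a], x, y, hx, hy => ⟨[a], trivial, hx, hy, Subset.rfl⟩
  | a :: b :: l, x, y, hx, hy => by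
    obtain rfl : a = x := by simpa using hx
    obtain ⟨l', h1, h2, h3, h4⟩ := exists_simple (l := b :: l) (x := b) (y := y) rfl
      (by simpa using hy)
    have hb : b ∈ supp l' := mem_supp_of_mem (List.mem_of_mem_head? h2)
    obtain ⟨r, m, g1, g2, g3, g4, g5⟩ := exists_last_exit (isCompact_segment a b).isClosed h1 h3
      ⟨b, hb, right_mem_segment ℝ _ _⟩
    by_cases har : a = r
    · subst har
      exact ⟨a :: m, g1, rfl, g2, (g3.trans h4).trans subset_union_right⟩
    · have hsub : segment ℝ a r ⊆ segment ℝ a b :=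
        (convex_segment a b).segment_subset (left_mem_segment ℝ _ _) g4
      refine ⟨a :: r :: m, ⟨har, ?_, g1⟩, rfl, by simpa using g2,
        union_subset_union hsub (g3.trans h4)⟩
      rintro z ⟨hz, hz'⟩
      exact g5 ⟨hz', hsub hz⟩

/-- A set that is a simple arc from `x` to `y`. -/
def IsArc (A : Set Plane) (x y : Plane) : Prop :=
  ∃ γ : Path x y, Function.Injective γ ∧ range γ = A

lemma isArc_segment {a b : Plane} (h : a ≠ b) : IsArc (segment ℝ a b) a b := by
  refine ⟨⟨⟨fun t => a + (t : ℝ) • (b - a), by fun_prop⟩, by simp, by simp⟩, ?_, ?_⟩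
  · intro s t hst
    have h1 : (s : ℝ) • (b - a) = (t : ℝ) • (b - a) := by simpa using hst
    exact Subtype.ext (smul_left_injective ℝ (sub_ne_zero.2 h.symm) h1)
  · rw [segment_eq_image']
    ext x
    constructor
    · rintro ⟨t, rfl⟩
      exact ⟨t, t.2, rfl⟩
    · rintro ⟨t, ht, rfl⟩
      exact ⟨⟨t, ht⟩, rfl⟩

lemma IsArc.trans {A B : Set Plane} {x y z : Plane} (hA : IsArc A x y) (hB : IsArc B y z)
    (h : A ∩ B ⊆ {y}) : IsArc (A ∪ B) x z := by
  obtain ⟨γ, hγ, rfl⟩ := hA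
  obtain ⟨η, hη, rfl⟩ := hB
  have key : ∀ s t : unitInterval, γ s = η t → s = 1 ∧ t = 0 := by
    intro s t hst
    have h1 : γ s = y := h ⟨⟨s, rfl⟩, ⟨t, hst.symm⟩⟩
    exact ⟨hγ (h1.trans γ.target.symm), hη ((hst.symm.trans h1).trans η.source.symm)⟩
  refine ⟨γ.trans η, ?_, Path.trans_range γ η⟩
  intro s t hst
  rw [Path.trans_apply, Path.trans_apply] at hst
  split_ifs at hst with h1 h2 h2
  · have := congrArg Subtype.val (hγ hst)
    exact Subtype.ext (by simpa using this)
  · have := congrArg Subtype.val (key _ _ hst).2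
    simp at this
    exact absurd (by linarith) h2
  · have := congrArg Subtype.val (key _ _ hst.symm).2
    simp at this
    exact absurd (by linarith) h1
  · have := congrArg Subtype.val (hη hst)
    exact Subtype.ext (by simpa using this)

lemma Simple.isArc : ∀ {l : List Plane} {x y : Plane}, Simple l → l.head? = some x →
    l.getLast? = some y → x ≠ y → IsArc (supp l) x y
  | [a], x, y, _, hx, hy, hxy => by simp_all
  | [a, b], x, y, h, hx, hy, hxy => by
    obtain rfl : a = x := by simpa using hx
    obtain rfl : b = y := by simpa using hy
    have : supp [a, b] = segment ℝ a b :=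
      union_eq_self_of_subset_right (singleton_subset_iff.2 (right_mem_segment ℝ _ _))
    rw [this]
    exact isArc_segment hxy
  | a :: b :: c :: l, x, y, h, hx, hy, hxy => by
    obtain rfl : a = x := by simpa using hx
    have hy' : (c :: l).getLast? = some y := by simpa using hy
    have hby : b ≠ y := by
      rintro rfl
      exact h.2.2.notMem (mem_supp_of_mem (List.mem_of_mem_getLast? hy'))
    exact (isArc_segment h.1).trans (Simple.isArc h.2.2 rfl (by simpa using hy) hby) h.2.1

lemma IsArc.isCompact {A : Set Plane} {x y : Plane} (h : IsArc A x y) : IsCompact A := by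
  obtain ⟨γ, -, rfl⟩ := h
  exact isCompact_range γ.continuous

end Polyline

namespace Polyline
open Filter Topology

/-- The determinant of two plane vectors. -/
def det2 (u v : Plane) : ℝ := u.1 * v.2 - u.2 * v.1

lemma eventually_quadratic_ne {A B C : ℝ} (h : A ≠ 0 ∨ B ≠ 0 ∨ C ≠ 0) :
    ∀ᶠ ε in 𝓝[>] (0 : ℝ), A + B * ε + C * ε ^ 2 ≠ 0 := by
  have cont : ∀ P Q R : ℝ, P ≠ 0 → ∀ᶠ ε in 𝓝[>] (0 : ℝ), P + Q * ε + R * ε ^ 2 ≠ 0 := by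
    intro P Q R hP
    have hc : Continuous fun ε : ℝ => P + Q * ε + R * ε ^ 2 := by fun_prop
    exact (hc.continuousAt.eventually_ne (x := 0) (by simpa using hP)).filter_mono
      nhdsWithin_le_nhds
  by_cases hA : A = 0
  · by_cases hB : B = 0
    · have hC : C ≠ 0 := by tauto
      filter_upwards [self_mem_nhdsWithin] with ε hε
      have : ε ≠ 0 := ne_of_gt hε
      simp [hA, hB, hC, this]
    · filter_upwards [self_mem_nhdsWithin, cont B C 0 hB] with ε hε h1
      have h2 : ε ≠ 0 := ne_of_gt hε
      have : A + B * ε + C * ε ^ 2 = ε * (B + C * ε + 0 * ε ^ 2) := by rw [hA]; ring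
      rw [this]
      exact mul_ne_zero h2 h1
  · exact cont A B C hA

lemma exists_separating {d₁ d₂ : Plane} (h₁ : d₁ ≠ 0) (h₂ : d₂ ≠ 0)
    (h : ¬ ∃ k : ℝ, 0 < k ∧ d₂ = k • d₁) (B : Finset Plane) (hB : ∀ b ∈ B, b ≠ 0) :
    ∃ w, 0 < det2 d₁ w ∧ det2 d₂ w < 0 ∧ ∀ b ∈ B, det2 w b ≠ 0 := by
  have hq : 0 < d₁.1 ^ 2 + d₁.2 ^ 2 := by
    by_contra hq
    have e1 : d₁.1 = 0 := by nlinarith [sq_nonneg d₁.1, sq_nonneg d₁.2]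
    have e2 : d₁.2 = 0 := by nlinarith [sq_nonneg d₁.1, sq_nonneg d₁.2]
    exact h₁ (Prod.ext e1 e2)
  obtain ⟨w, hw1, hw2⟩ : ∃ w, 0 < det2 d₁ w ∧ det2 d₂ w < 0 := by
    by_cases hD : det2 d₁ d₂ = 0
    · set k := (d₁.1 * d₂.1 + d₁.2 * d₂.2) / (d₁.1 ^ 2 + d₁.2 ^ 2) with hk
      have hdk : d₂ = k • d₁ := by
        unfold det2 at hD
        ext
        · simp only [hk, Prod.smul_fst, smul_eq_mul]
          field_simp
          linear_combination -d₁.2 * hD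
        · simp only [hk, Prod.smul_snd, smul_eq_mul]
          field_simp
          linear_combination d₁.1 * hD
      have hk0 : k ≠ 0 := by
        intro h0
        rw [h0, zero_smul] at hdk
        exact h₂ hdk
      have hkneg : k < 0 := by
        rcases lt_trichotomy k 0 with h' | h' | h'
        · exact h'
        · exact absurd h' hk0
        · exact absurd ⟨k, h', hdk⟩ h
      refine ⟨(-d₁.2, d₁.1), ?_, ?_⟩
      · simp only [det2]; nlinarith
      · rw [hdk]; simp only [det2, Prod.smul_fst, Prod.smul_snd, smul_eq_mul]; nlinarith
    · refine ⟨(det2 d₁ d₂)⁻¹ • (d₁ + d₂), ?_, ?_⟩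
      · have : det2 d₁ ((det2 d₁ d₂)⁻¹ • (d₁ + d₂)) = (det2 d₁ d₂)⁻¹ * det2 d₁ d₂ := by
          simp only [det2, Prod.smul_fst, Prod.smul_snd, smul_eq_mul, Prod.fst_add, Prod.snd_add]
          ring
        rw [this, inv_mul_cancel₀ hD]
        norm_num
      · have : det2 d₂ ((det2 d₁ d₂)⁻¹ • (d₁ + d₂)) = -((det2 d₁ d₂)⁻¹ * det2 d₁ d₂) := by
          simp only [det2, Prod.smul_fst, Prod.smul_snd, smul_eq_mul, Prod.fst_add, Prod.snd_add]
          ring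
        rw [this, inv_mul_cancel₀ hD]
        norm_num
  have key : ∀ᶠ ε in 𝓝[>] (0 : ℝ), 0 < det2 d₁ (w + (ε, ε ^ 2)) ∧ det2 d₂ (w + (ε, ε ^ 2)) < 0 ∧
      ∀ b ∈ B, det2 (w + (ε, ε ^ 2)) b ≠ 0 := by
    have c1 : Continuous fun ε : ℝ => det2 d₁ (w + (ε, ε ^ 2)) := by unfold det2; fun_prop
    have c2 : Continuous fun ε : ℝ => det2 d₂ (w + (ε, ε ^ 2)) := by unfold det2; fun_prop
    have e1 := (c1.continuousAt (x := 0)).eventually_const_lt (u := 0) (by simpa [det2] using hw1)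
    have e2 := (c2.continuousAt (x := 0)).eventually_lt_const (u := 0) (by simpa [det2] using hw2)
    refine (e1.filter_mono nhdsWithin_le_nhds).and ((e2.filter_mono nhdsWithin_le_nhds).and ?_)
    rw [Filter.eventually_all_finset]
    intro b hb
    have hb0 := hB b hb
    have : det2 w b ≠ 0 ∨ b.2 ≠ 0 ∨ -b.1 ≠ 0 := by
      by_contra hcon
      push Not at hcon
      exact hb0 (Prod.ext (by simpa using hcon.2.2) hcon.2.1)
    filter_upwards [eventually_quadratic_ne this] with ε hε
    convert hε using 1
    simp only [det2, Prod.fst_add, Prod.snd_add]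
    ring
  obtain ⟨ε, hε⟩ := key.exists
  exact ⟨_, hε⟩

lemma eventually_disjoint_segment {K : Set Plane} (hK : IsClosed K) {a b : Plane} (v v' : Plane)
    (h : Disjoint (segment ℝ a b) K) :
    ∀ᶠ δ in 𝓝[>] (0 : ℝ), Disjoint (segment ℝ (a + δ • v) (b + δ • v')) K := by
  have key : ∀ᶠ δ in 𝓝 (0 : ℝ), ∀ t ∈ Icc (0 : ℝ) 1,
      (a + δ • v) + t • ((b + δ • v') - (a + δ • v)) ∈ Kᶜ := by
    refine isCompact_Icc.eventually_forall_of_forall_eventually ?_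
    intro t ht
    have hc : Continuous fun z : ℝ × ℝ =>
      (a + z.1 • v) + z.2 • ((b + z.1 • v') - (a + z.1 • v)) := by fun_prop
    refine hc.continuousAt.eventually_mem (hK.isOpen_compl.mem_nhds ?_)
    intro hmem
    refine disjoint_left.1 h ?_ hmem
    rw [segment_eq_image']
    exact ⟨t, ht, by simp⟩
  filter_upwards [key.filter_mono nhdsWithin_le_nhds] with δ hδ
  rw [disjoint_left]
  intro x hx
  rw [segment_eq_image'] at hx
  obtain ⟨t, ht, rfl⟩ := hx
  exact hδ t ht

lemma eventually_spoke_of_ne {a d v v' c : Plane} {σ : ℝ} (hv : 0 < σ * det2 d v)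
    (hv' : v' = 0 ∨ 0 < σ * det2 d v') (hc : det2 v c ≠ 0) (hb : a + d ∉ segment ℝ a (a + c)) :
    ∀ᶠ δ in 𝓝[>] (0 : ℝ),
      (segment ℝ (a + δ • v) (a + d + δ • v') ∩ segment ℝ a (a + c)).Subsingleton ∧
      ((segment ℝ (a + δ • v) (a + d + δ • v') ∩ segment ℝ a (a + c)).Nonempty →
        0 < σ * det2 d c ∧ 0 < σ * det2 c v) := by
  have hv'0 : 0 ≤ σ * det2 d v' := by
    rcases hv' with rfl | h
    · simp [det2]
    · exact h.le
  have c1 : Continuous fun δ : ℝ => σ * det2 (d + δ • v') v := by unfold det2; fun_prop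
  have e1 := (c1.continuousAt (x := 0)).eventually_const_lt (u := 0) (by simpa using hv)
  filter_upwards [e1.filter_mono nhdsWithin_le_nhds, self_mem_nhdsWithin] with δ hδ hδ0
  have hδ0 : 0 < δ := hδ0
  have param : ∀ x ∈ segment ℝ (a + δ • v) (a + d + δ • v') ∩ segment ℝ a (a + c),
      ∃ t ∈ Icc (0 : ℝ) 1, ∃ r ∈ Icc (0 : ℝ) 1, x = a + r • c ∧
        r • c = ((1 - t) * δ) • v + t • (d + δ • v') := by
    rintro x ⟨hx, hx'⟩
    rw [segment_eq_image'] at hx hx'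
    obtain ⟨t, ht, rfl⟩ := hx
    obtain ⟨r, hr, hx⟩ := hx'
    simp only [add_sub_cancel_left] at hx
    refine ⟨t, ht, r, hr, hx.symm, ?_⟩
    have : r • c = a + r • c - a := by module
    rw [this, hx]
    module
  constructor
  · intro x hx y hy
    obtain ⟨t, ht, r, hr, rfl, e⟩ := param x hx
    obtain ⟨t', ht', r', hr', rfl, e'⟩ := param y hy
    have e1 := congrArg Prod.fst e
    have e2 := congrArg Prod.snd e
    have e1' := congrArg Prod.fst e'
    have e2' := congrArg Prod.snd e'
    simp only [Prod.smul_fst, Prod.smul_snd, Prod.fst_add, Prod.snd_add, smul_eq_mul] at e1 e2 e1' e2'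
    have z1 : (1 - t) * δ * det2 v c + t * det2 (d + δ • v') c = 0 := by
      simp only [det2, Prod.smul_fst, Prod.smul_snd, Prod.fst_add, Prod.snd_add, smul_eq_mul]
      linear_combination (-c.2) * e1 + c.1 * e2
    have z2 : (1 - t') * δ * det2 v c + t' * det2 (d + δ • v') c = 0 := by
      simp only [det2, Prod.smul_fst, Prod.smul_snd, Prod.fst_add, Prod.snd_add, smul_eq_mul]
      linear_combination (-c.2) * e1' + c.1 * e2'
    have z3 : (t' - t) * (δ * det2 v c) = 0 := by linear_combination t' * z1 - t * z2
    have htt : t' = t := by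
      rcases mul_eq_zero.1 z3 with h | h
      · linarith
      · exact absurd h (mul_ne_zero hδ0.ne' hc)
    rw [e, e', htt]
  · rintro ⟨x, hx⟩
    obtain ⟨t, ht, r, hr, rfl, e⟩ := param x hx
    have e1 := congrArg Prod.fst e
    have e2 := congrArg Prod.snd e
    simp only [Prod.smul_fst, Prod.smul_snd, Prod.fst_add, Prod.snd_add, smul_eq_mul] at e1 e2
    have f1 : r * (σ * det2 d c) = (1 - t) * δ * (σ * det2 d v) + t * δ * (σ * det2 d v') := by
      simp only [det2]
      linear_combination (-σ * d.2) * e1 + σ * d.1 * e2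
    have f2 : r * (σ * det2 c v) = t * (σ * det2 (d + δ • v') v) := by
      simp only [det2, Prod.smul_fst, Prod.smul_snd, Prod.fst_add, Prod.snd_add, smul_eq_mul]
      linear_combination (σ * v.2) * e1 - σ * v.1 * e2
    have hr0 : 0 ≤ r := hr.1
    have pos : 0 < r * (σ * det2 d c) := by
      rw [f1]
      rcases lt_or_eq_of_le ht.2 with h1 | h1
      · have : 0 < (1 - t) * δ * (σ * det2 d v) :=
          mul_pos (mul_pos (by linarith) hδ0) hv
        have : 0 ≤ t * δ * (σ * det2 d v') := mul_nonneg (mul_nonneg ht.1 hδ0.le) hv'0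
        linarith
      · rcases lt_or_eq_of_le hv'0 with h2 | h2
        · have : 0 < t * δ * (σ * det2 d v') := by rw [h1]; positivity
          have : 0 ≤ (1 - t) * δ * (σ * det2 d v) := by rw [h1]; simp
          linarith
        · exfalso
          subst h1
          have hv0 : v' = 0 := hv'.resolve_right (by rw [← h2]; exact lt_irrefl _)
          refine hb ?_
          rw [segment_eq_image']
          refine ⟨r, hr, ?_⟩
          have : r • c = d := by rw [e, hv0]; simp
          simp [this]
    have hrpos : 0 < r := by
      rcases lt_or_eq_of_le hr0 with h | h
      · exact h
      · rw [← h] at pos; simp at pos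
    have hd : 0 < σ * det2 d c := (mul_pos_iff_of_pos_left hrpos).1 pos
    refine ⟨hd, ?_⟩
    have hn : 0 ≤ r * (σ * det2 c v) := by rw [f2]; exact mul_nonneg ht.1 hδ.le
    have hn' : 0 ≤ σ * det2 c v := nonneg_of_mul_nonneg_right hn hrpos
    refine lt_of_le_of_ne hn' ?_
    have hσ : σ ≠ 0 := by rintro rfl; simp at hv
    have hcv : det2 c v = - det2 v c := by unfold det2; ring
    rw [hcv]
    exact (mul_ne_zero hσ (neg_ne_zero.2 hc)).symm

lemma eventually_spoke_of_end {a d v' c : Plane} (hv' : det2 d v' ≠ 0) :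
    ∀ᶠ δ in 𝓝[>] (0 : ℝ),
      segment ℝ a (a + d + δ • v') ∩ segment ℝ a (a + c) ⊆ {a} := by
  have param : ∀ δ : ℝ, ∀ x ∈ segment ℝ a (a + d + δ • v') ∩ segment ℝ a (a + c),
      ∃ t r : ℝ, x = a + r • c ∧ r • c = t • (d + δ • v') := by
    rintro δ x ⟨hx, hx'⟩
    rw [segment_eq_image'] at hx hx'
    obtain ⟨t, ht, rfl⟩ := hx
    obtain ⟨r, hr, hx⟩ := hx'
    simp only [add_sub_cancel_left] at hx
    refine ⟨t, r, hx.symm, ?_⟩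
    have : r • c = a + r • c - a := by module
    rw [this, hx]
    module
  have concl : ∀ δ : ℝ, (∀ t r : ℝ, r • c = t • (d + δ • v') → t = 0) →
      segment ℝ a (a + d + δ • v') ∩ segment ℝ a (a + c) ⊆ {a} := by
    intro δ h x hx
    obtain ⟨t, r, rfl, e⟩ := param δ x hx
    rw [e, h t r e]
    simp
  by_cases hdc : det2 d c = 0
  · filter_upwards [self_mem_nhdsWithin] with δ hδ0
    have hδ0 : 0 < δ := hδ0
    refine concl δ fun t r e => ?_
    have e1 := congrArg Prod.fst e
    have e2 := congrArg Prod.snd e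
    simp only [Prod.smul_fst, Prod.smul_snd, Prod.fst_add, Prod.snd_add, smul_eq_mul] at e1 e2
    have : t * (δ * det2 d v') = 0 := by
      unfold det2 at hdc ⊢
      linear_combination r * hdc + d.2 * e1 - d.1 * e2
    rcases mul_eq_zero.1 this with h | h
    · exact h
    · exact absurd h (mul_ne_zero hδ0.ne' hv')
  · have c1 : Continuous fun δ : ℝ => det2 (d + δ • v') c := by unfold det2; fun_prop
    have e1 := c1.continuousAt.eventually_ne (x := 0) (y := 0) (by simpa using hdc)
    filter_upwards [e1.filter_mono nhdsWithin_le_nhds] with δ hδ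
    refine concl δ fun t r e => ?_
    have e1 := congrArg Prod.fst e
    have e2 := congrArg Prod.snd e
    simp only [Prod.smul_fst, Prod.smul_snd, Prod.fst_add, Prod.snd_add, smul_eq_mul] at e1 e2
    have : t * det2 (d + δ • v') c = 0 := by
      simp only [det2, Prod.smul_fst, Prod.smul_snd, Prod.fst_add, Prod.snd_add, smul_eq_mul]
      linear_combination (-c.2) * e1 + c.1 * e2
    exact (mul_eq_zero.1 this).resolve_right hδ

end Polyline

namespace Polyline
open Filter Topology

lemma det2_smul_left (r : ℝ) (u v : Plane) : det2 (r • u) v = r * det2 u v := by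
  simp only [det2, Prod.smul_fst, Prod.smul_snd, smul_eq_mul]; ring

lemma det2_smul_right (r : ℝ) (u v : Plane) : det2 u (r • v) = r * det2 u v := by
  simp only [det2, Prod.smul_fst, Prod.smul_snd, smul_eq_mul]; ring

lemma det2_neg_left (u v : Plane) : det2 (-u) v = -det2 u v := by
  simp only [det2, Prod.fst_neg, Prod.snd_neg]; ring

lemma det2_neg_right (u v : Plane) : det2 u (-v) = -det2 u v := by
  simp only [det2, Prod.fst_neg, Prod.snd_neg]; ring

lemma det2_swap (u v : Plane) : det2 u v = -det2 v u := by
  simp only [det2]; ring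

@[simp] lemma det2_zero_right (u : Plane) : det2 u 0 = 0 := by simp [det2]

lemma eventually_meet_spoke {a b w w' c : Plane} {σ : ℝ} {E : Set Plane} (hσ : σ = 1 ∨ σ = -1)
    (hw : (w = 0 ∧ a ∈ E) ∨ 0 < det2 (b - a) w) (hw' : w' = 0 ∨ 0 < det2 (b - a) w')
    (hww : w ≠ 0 ∨ w' ≠ 0) (hc : w ≠ 0 → det2 w (c - a) ≠ 0) (hb : b ∉ segment ℝ a c) :
    ∀ᶠ δ in 𝓝[>] (0 : ℝ),
      ((segment ℝ (a + δ • σ • w) (b + δ • σ • w') \ E) ∩ segment ℝ a c).Subsingleton ∧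
      (((segment ℝ (a + δ • σ • w) (b + δ • σ • w') \ E) ∩ segment ℝ a c).Nonempty →
        w ≠ 0 ∧ 0 < σ * det2 (b - a) (c - a) ∧ 0 < det2 (c - a) w) := by
  have hσ0 : σ ≠ 0 := by rcases hσ with rfl | rfl <;> norm_num
  have hσσ : σ * σ = 1 := by rcases hσ with rfl | rfl <;> norm_num
  have eb : a + (b - a) = b := by abel
  have ec : a + (c - a) = c := by abel
  by_cases h0 : w = 0
  · have hw'0 : 0 < det2 (b - a) w' := by
      rcases hw' with h | h
      · exact absurd h (hww.resolve_left (not_not.2 h0))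
      · exact h
    have haE : a ∈ E := by
      rcases hw with h | h
      · exact h.2
      · rw [h0] at h; simp at h
    have hne : det2 (b - a) (σ • w') ≠ 0 := by
      rw [det2_smul_right]; exact mul_ne_zero hσ0 hw'0.ne'
    filter_upwards [eventually_spoke_of_end (a := a) (c := c - a) hne] with δ hδ
    rw [eb, ec] at hδ
    have hemp : ((segment ℝ (a + δ • σ • w) (b + δ • σ • w') \ E) ∩ segment ℝ a c) = ∅ := by
      rw [eq_empty_iff_forall_notMem]
      rintro x ⟨⟨hx, hxE⟩, hx'⟩
      rw [h0, smul_zero, smul_zero, add_zero] at hx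
      have : x = a := hδ ⟨hx, hx'⟩
      exact hxE (this ▸ haE)
    rw [hemp]
    exact ⟨subsingleton_empty, fun h => absurd h not_nonempty_empty⟩
  · have hwp : 0 < det2 (b - a) w := by
      rcases hw with h | h
      · exact absurd h.1 h0
      · exact h
    have e1 : 0 < σ * det2 (b - a) (σ • w) := by
      rw [det2_smul_right, ← mul_assoc, hσσ, one_mul]; exact hwp
    have e2 : σ • w' = 0 ∨ 0 < σ * det2 (b - a) (σ • w') := by
      rcases hw' with rfl | h
      · exact Or.inl (smul_zero _)
      · right; rw [det2_smul_right, ← mul_assoc, hσσ, one_mul]; exact h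
    have e3 : det2 (σ • w) (c - a) ≠ 0 := by
      rw [det2_smul_left]; exact mul_ne_zero hσ0 (hc h0)
    filter_upwards [eventually_spoke_of_ne (a := a) e1 e2 e3 (by rwa [eb, ec])] with δ hδ
    rw [eb, ec] at hδ
    have hsub : ((segment ℝ (a + δ • σ • w) (b + δ • σ • w') \ E) ∩ segment ℝ a c) ⊆
        segment ℝ (a + δ • σ • w) (b + δ • σ • w') ∩ segment ℝ a c :=
      inter_subset_inter_left _ sdiff_subset
    refine ⟨hδ.1.anti hsub, fun h => ?_⟩
    obtain ⟨g1, g2⟩ := hδ.2 (h.mono hsub)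
    refine ⟨h0, g1, ?_⟩
    rwa [det2_smul_right, ← mul_assoc, hσσ, one_mul] at g2

lemma eventually_meet {a b w w' : Plane} {σ : ℝ} {E : Set Plane} {s : Sym2 Plane}
    (hσ : σ = 1 ∨ σ = -1) (hw : (w = 0 ∧ a ∈ E) ∨ 0 < det2 (b - a) w)
    (hw' : (w' = 0 ∧ b ∈ E) ∨ 0 < det2 (b - a) w') (hww : w ≠ 0 ∨ w' ≠ 0)
    (hga : ∀ c, s = s(a, c) → w ≠ 0 → det2 w (c - a) ≠ 0)
    (hgb : ∀ c, s = s(b, c) → w' ≠ 0 → det2 w' (c - b) ≠ 0) (hs : s ≠ s(a, b))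
    (hplane : ∀ x ∈ segment ℝ a b, x ∈ segSet s → x ∈ s ∧ (x = a ∨ x = b)) :
    ∀ᶠ δ in 𝓝[>] (0 : ℝ),
      ((segment ℝ (a + δ • σ • w) (b + δ • σ • w') \ E) ∩ segSet s).Subsingleton ∧
      (((segment ℝ (a + δ • σ • w) (b + δ • σ • w') \ E) ∩ segSet s).Nonempty →
        (w ≠ 0 ∧ ∃ c, s = s(a, c) ∧ 0 < σ * det2 (b - a) (c - a) ∧ 0 < det2 (c - a) w) ∨
        (w' ≠ 0 ∧ ∃ c, s = s(b, c) ∧ 0 < σ * det2 (b - a) (c - b) ∧ 0 < det2 w' (c - b))) := by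
  by_cases ha : a ∈ s
  · obtain ⟨c, rfl⟩ := ha
    have hb : b ∉ segment ℝ a c := by
      intro hb
      have := (hplane b (right_mem_segment ℝ _ _) hb).1
      rcases Sym2.mem_iff.1 this with rfl | rfl
      · exact hs (by
          rcases hw with h | h
          · rcases hw' with h' | h'
            · exact absurd h.1 (hww.resolve_right (not_not.2 h'.1))
            · simp [det2] at h'
          · simp [det2] at h)
      · exact hs rfl
    filter_upwards [eventually_meet_spoke hσ hw (hw'.imp_left And.left) hww (hga c rfl) hb]
      with δ hδ
    exact ⟨hδ.1, fun h => Or.inl ⟨(hδ.2 h).1, c, rfl, (hδ.2 h).2⟩⟩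
  by_cases hb : b ∈ s
  · obtain ⟨c, rfl⟩ := hb
    have ha' : a ∉ segment ℝ b c := fun h =>
      ha (hplane a (left_mem_segment ℝ _ _) h).1
    have hσ' : -σ = 1 ∨ -σ = -1 := by rcases hσ with rfl | rfl <;> norm_num
    have key : ∀ x : Plane, det2 (a - b) (-x) = det2 (b - a) x := by
      intro x
      rw [det2_neg_right, ← det2_neg_left, neg_sub]
    have := eventually_meet_spoke (a := b) (b := a) (w := -w') (w' := -w) (c := c) (E := E) hσ'
      (by rw [key, neg_eq_zero]; exact hw') (by rw [key, neg_eq_zero]; exact hw.imp_left And.left)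
      (by rw [neg_ne_zero, neg_ne_zero]; exact hww.symm)
      (by rw [neg_ne_zero, det2_neg_left, neg_ne_zero]; exact hgb c rfl) ha'
    filter_upwards [this] with δ hδ
    rw [neg_smul_neg, neg_smul_neg, segment_symm] at hδ
    refine ⟨hδ.1, fun h => Or.inr ?_⟩
    obtain ⟨g1, g2, g3⟩ := hδ.2 h
    refine ⟨neg_ne_zero.1 g1, c, rfl, ?_, ?_⟩
    · rwa [← neg_sub b a, det2_neg_left, neg_mul_neg] at g2
    · rwa [det2_neg_right, ← det2_swap] at g3
  · have hd : Disjoint (segment ℝ a b) (segSet s) := by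
      rw [disjoint_left]
      intro x hx hx'
      obtain ⟨h1, rfl | rfl⟩ := hplane x hx hx'
      · exact ha h1
      · exact hb h1
    filter_upwards [eventually_disjoint_segment (isCompact_segSet s).isClosed (σ • w) (σ • w') hd]
      with δ hδ
    have hemp : ((segment ℝ (a + δ • σ • w) (b + δ • σ • w') \ E) ∩ segSet s) = ∅ := by
      rw [eq_empty_iff_forall_notMem]
      rintro x ⟨⟨hx, -⟩, hx'⟩
      exact disjoint_left.1 hδ hx hx'
    rw [hemp]
    exact ⟨subsingleton_empty, fun h => absurd h not_nonempty_empty⟩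

lemma offset_disjoint_base {a b w w' : Plane} {σ δ : ℝ} {E : Set Plane} (hσ : σ = 1 ∨ σ = -1)
    (hδ : 0 < δ) (hw : (w = 0 ∧ a ∈ E) ∨ 0 < det2 (b - a) w)
    (hw' : (w' = 0 ∧ b ∈ E) ∨ 0 < det2 (b - a) w') (hww : w ≠ 0 ∨ w' ≠ 0) :
    (segment ℝ (a + δ • σ • w) (b + δ • σ • w') \ E) ∩ segment ℝ a b = ∅ := by
  have hσσ : σ * σ = 1 := by rcases hσ with rfl | rfl <;> norm_num
  rw [eq_empty_iff_forall_notMem]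
  rintro x ⟨⟨hx, hxE⟩, hx'⟩
  rw [segment_eq_image'] at hx hx'
  obtain ⟨t, ht, rfl⟩ := hx
  obtain ⟨r, hr, hx⟩ := hx'
  have e1 := congrArg Prod.fst hx
  have e2 := congrArg Prod.snd hx
  simp only [Prod.smul_fst, Prod.smul_snd, Prod.fst_add, Prod.snd_add, Prod.fst_sub,
    Prod.snd_sub, smul_eq_mul] at e1 e2
  have key : δ * ((1 - t) * det2 (b - a) w + t * det2 (b - a) w') = 0 := by
    simp only [det2, Prod.fst_sub, Prod.snd_sub]
    linear_combination (-σ) * (b.1 - a.1) * e2 + σ * (b.2 - a.2) * e1 -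
      δ * ((1 - t) * ((b.1 - a.1) * w.2 - (b.2 - a.2) * w.1) +
        t * ((b.1 - a.1) * w'.2 - (b.2 - a.2) * w'.1)) * hσσ
  have key' := (mul_eq_zero.1 key).resolve_left hδ.ne'
  have n1 : 0 ≤ det2 (b - a) w := by
    rcases hw with ⟨rfl, -⟩ | h
    · simp
    · exact h.le
  have n2 : 0 ≤ det2 (b - a) w' := by
    rcases hw' with ⟨rfl, -⟩ | h
    · simp
    · exact h.le
  have m1 : 0 ≤ (1 - t) * det2 (b - a) w := mul_nonneg (by linarith [ht.2]) n1
  have m2 : 0 ≤ t * det2 (b - a) w' := mul_nonneg ht.1 n2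
  have z1 : (1 - t) * det2 (b - a) w = 0 := by linarith
  have z2 : t * det2 (b - a) w' = 0 := by linarith
  rcases hw with ⟨hw0, ha⟩ | hwp
  · rcases hw' with ⟨hw0', hb⟩ | hwp'
    · tauto
    · have : t = 0 := (mul_eq_zero.1 z2).resolve_right hwp'.ne'
      apply hxE
      simpa [this, hw0] using ha
  · have ht1 : t = 1 := by
      have := (mul_eq_zero.1 z1).resolve_right hwp.ne'
      linarith
    rcases hw' with ⟨hw0', hb⟩ | hwp'
    · apply hxE
      simpa [ht1, hw0'] using hb
    · rw [ht1, one_mul] at z2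
      exact hwp'.ne' z2

end Polyline

namespace Polyline
open Filter Topology
open scoped Classical in
/-- The number of segments of `F` issuing from `b`, other than `ab` and `bc`. -/
noncomputable def wt (F : Finset (Sym2 Plane)) (a b c : Plane) : ℕ :=
  (F.filter fun s => b ∈ s ∧ s ≠ s(a, b) ∧ s ≠ s(b, c)).card

lemma not_pos_parallel {S : Finset (Sym2 Plane)} {a b c : Plane}
    (hplane : ∀ s ∈ S, ∀ t ∈ S, s ≠ t → ∀ x, x ∈ segSet s → x ∈ segSet t → x ∈ s ∧ x ∈ t)
    (hab : s(a, b) ∈ S) (hbc : s(b, c) ∈ S) (ha : a ≠ b) (hc : b ≠ c) (hne : s(a, b) ≠ s(b, c)) :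
    ¬ ∃ k : ℝ, 0 < k ∧ a - b = k • (c - b) := by
  rintro ⟨k, hk, h⟩
  have hac : a ≠ c := fun e => hne (by rw [e, Sym2.eq_swap])
  rcases le_total k 1 with h1 | h1
  · have hm : a ∈ segSet s(b, c) := by
      rw [segSet_mk, segment_eq_image']
      exact ⟨k, ⟨hk.le, h1⟩, by simp only [← h]; abel⟩
    have := (hplane _ hab _ hbc hne a (mem_segSet (Sym2.mem_mk_left _ _)) hm).2
    rcases Sym2.mem_iff.1 this with e | e
    · exact ha e
    · exact hac e
  · have hm : c ∈ segSet s(a, b) := by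
      rw [Sym2.eq_swap, segSet_mk, segment_eq_image']
      refine ⟨k⁻¹, ⟨inv_nonneg.2 hk.le, inv_le_one_of_one_le₀ h1⟩, ?_⟩
      simp only [h, smul_smul, inv_mul_cancel₀ hk.ne', one_smul]; abel
    have := (hplane _ hab _ hbc hne c hm (mem_segSet (Sym2.mem_mk_right _ _))).1
    rcases Sym2.mem_iff.1 this with e | e
    · exact hac e.symm
    · exact hc e.symm

open scoped Classical in
lemma ite_add_le_one {p p' q q' : Prop} (h₁ : p → p' → False) (h₂ : q → q' → False)
    (h₃ : p → q → False) (h₄ : p → q' → False) (h₅ : p' → q → False) (h₆ : p' → q' → False) :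
    ((if p then 1 else 0) + (if q then 1 else 0)) +
      ((if p' then 1 else 0) + (if q' then 1 else 0)) ≤ 1 := by
  split_ifs <;> first | omega | (exfalso; tauto)

open scoped Classical in
set_option maxHeartbeats 1000000 in
lemma route_fun {a : ℕ → Plane} {m : ℕ} (hm : 1 ≤ m) {S F : Finset (Sym2 Plane)} (hF : F ⊆ S)
    (V : Finset Plane) (hnd : ∀ x y, s(x, y) ∈ S → x ≠ y)
    (hplane : ∀ s ∈ S, ∀ t ∈ S, s ≠ t → ∀ x, x ∈ segSet s → x ∈ segSet t → x ∈ s ∧ x ∈ t)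
    (hS : ∀ i < m + 1, s(a i, a (i + 1)) ∈ S)
    (hc : ∀ i < m, s(a i, a (i + 1)) ≠ s(a (i + 1), a (i + 2))) :
    ∃ c : ℕ → Plane, c 0 = a 0 ∧ c (m + 1) = a (m + 1) ∧
      (∀ i < m + 1, ∀ p ∈ V, p ∈ segment ℝ (c i) (c (i + 1)) → p = a 0 ∨ p = a (m + 1)) ∧
      (∀ i < m + 1, ∀ s ∈ S,
        ((segment ℝ (c i) (c (i + 1)) \ {a 0, a (m + 1)}) ∩ segSet s).Subsingleton) ∧
      2 * ∑ i ∈ Finset.range (m + 1), ∑ s ∈ F,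
        ((segment ℝ (c i) (c (i + 1)) \ {a 0, a (m + 1)}) ∩ segSet s).ncard ≤
      ∑ k ∈ Finset.range m, wt F (a k) (a (k + 1)) (a (k + 2)) := by
  have hw : ∀ i, ∃ w : Plane, (i = 0 ∨ i = m + 1 → w = 0) ∧ (0 < i → i < m + 1 →
      0 < det2 (a (i + 1) - a i) w ∧ 0 < det2 (a i - a (i - 1)) w ∧
      ∀ c, s(a i, c) ∈ S → det2 w (c - a i) ≠ 0) := by
    intro i
    by_cases h : i = 0 ∨ i = m + 1
    · exact ⟨0, fun _ => rfl, fun h1 h2 => by omega⟩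
    · by_cases h2 : i < m + 1
      · obtain ⟨k, rfl⟩ : ∃ k, i = k + 1 := ⟨i - 1, by omega⟩
        have s1 := hS k (by omega)
        have s2 := hS (k + 1) h2
        have n1 := hnd _ _ s1
        have n2 := hnd _ _ s2
        obtain ⟨w, w1, w2, w3⟩ := exists_separating (d₁ := a (k + 1 + 1) - a (k + 1))
          (d₂ := a k - a (k + 1)) (sub_ne_zero.2 n2.symm) (sub_ne_zero.2 n1)
          (not_pos_parallel hplane s1 s2 n1 n2 (hc k (by omega)))
          ((S.biUnion fun s => s.toFinset.image fun c => c - a (k + 1)).erase 0)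
          (fun b hb => Finset.ne_of_mem_erase hb)
        refine ⟨w, fun h' => absurd h' h, fun _ _ => ⟨w1, ?_, fun c hcS => w3 _ ?_⟩⟩
        · rw [Nat.add_sub_cancel, ← neg_sub, det2_neg_left]; linarith
        · refine Finset.mem_erase.2 ⟨sub_ne_zero.2 (hnd _ _ hcS).symm, ?_⟩
          exact Finset.mem_biUnion.2 ⟨_, hcS, Finset.mem_image.2 ⟨c, by simp, rfl⟩⟩
      · exact ⟨0, fun _ => rfl, fun _ h3 => absurd h3 h2⟩
  choose w hw0 hw1 using hw
  set E : Set Plane := {a 0, a (m + 1)} with hE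
  have ha0 : a 0 ∈ E := by simp [hE]
  have ha1 : a (m + 1) ∈ E := by simp [hE]
  have hwl : ∀ i < m + 1, (w i = 0 ∧ a i ∈ E) ∨ 0 < det2 (a (i + 1) - a i) (w i) := by
    intro i hi
    rcases Nat.eq_zero_or_pos i with rfl | h
    · exact Or.inl ⟨hw0 0 (Or.inl rfl), ha0⟩
    · exact Or.inr (hw1 i h hi).1
  have hwr : ∀ i < m + 1, (w (i + 1) = 0 ∧ a (i + 1) ∈ E) ∨
      0 < det2 (a (i + 1) - a i) (w (i + 1)) := by
    intro i hi
    rcases Nat.lt_or_ge i m with h | h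
    · exact Or.inr (by simpa using (hw1 (i + 1) (by omega) (by omega)).2.1)
    · obtain rfl : i = m := by omega
      exact Or.inl ⟨hw0 _ (Or.inr rfl), ha1⟩
  have hwn : ∀ i, 0 < i → i < m + 1 → w i ≠ 0 := by
    intro i h1 h2 h
    have := (hw1 i h1 h2).1
    rw [h] at this; simp at this
  have hww : ∀ i < m + 1, w i ≠ 0 ∨ w (i + 1) ≠ 0 := by
    intro i hi
    rcases Nat.eq_zero_or_pos i with rfl | h
    · exact Or.inr (hwn _ (by omega) (by omega))
    · exact Or.inl (hwn i h hi)
  have hi0 : ∀ i ≤ m + 1, w i ≠ 0 → 0 < i ∧ i < m + 1 := by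
    intro i hi h
    have h1 : ¬ (i = 0 ∨ i = m + 1) := fun h' => h (hw0 i h')
    omega
  have ev1 : ∀ᶠ δ in 𝓝[>] (0 : ℝ), ∀ σ ∈ ({1, -1} : Finset ℝ), ∀ i ∈ Finset.range (m + 1),
      ∀ s ∈ S, s ≠ s(a i, a (i + 1)) →
      ((segment ℝ (a i + δ • σ • w i) (a (i + 1) + δ • σ • w (i + 1)) \ E) ∩
        segSet s).Subsingleton ∧
      (((segment ℝ (a i + δ • σ • w i) (a (i + 1) + δ • σ • w (i + 1)) \ E) ∩
        segSet s).Nonempty →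
        (w i ≠ 0 ∧ ∃ c, s = s(a i, c) ∧ 0 < σ * det2 (a (i + 1) - a i) (c - a i) ∧
          0 < det2 (c - a i) (w i)) ∨
        (w (i + 1) ≠ 0 ∧ ∃ c, s = s(a (i + 1), c) ∧
          0 < σ * det2 (a (i + 1) - a i) (c - a (i + 1)) ∧
          0 < det2 (w (i + 1)) (c - a (i + 1)))) := by
    refine (Filter.eventually_all_finset _).2 fun σ hσ =>
      (Filter.eventually_all_finset _).2 fun i hi => (Filter.eventually_all_finset _).2 fun s hs =>
      Filter.eventually_all.2 fun hne => ?_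
    rw [Finset.mem_range] at hi
    refine eventually_meet (by simpa using hσ) (hwl i hi) (hwr i hi) (hww i hi) ?_ ?_ hne ?_
    · intro c hsc hwi
      obtain ⟨p1, p2⟩ := hi0 i (by omega) hwi
      exact (hw1 i p1 p2).2.2 c (hsc ▸ hs)
    · intro c hsc hwi
      obtain ⟨p1, p2⟩ := hi0 (i + 1) (by omega) hwi
      exact (hw1 _ p1 p2).2.2 c (hsc ▸ hs)
    · intro x hx hxs
      have := hplane _ (hS i hi) s hs hne.symm x hx hxs
      exact ⟨this.2, Sym2.mem_iff.1 this.1⟩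
  have ev2 : ∀ᶠ δ in 𝓝[>] (0 : ℝ), ∀ σ ∈ ({1, -1} : Finset ℝ), ∀ i ∈ Finset.range (m + 1),
      ∀ p ∈ V, p ∉ segment ℝ (a i) (a (i + 1)) →
        p ∉ segment ℝ (a i + δ • σ • w i) (a (i + 1) + δ • σ • w (i + 1)) := by
    refine (Filter.eventually_all_finset _).2 fun σ hσ =>
      (Filter.eventually_all_finset _).2 fun i hi => (Filter.eventually_all_finset _).2 fun p hp =>
      Filter.eventually_all.2 fun hne => ?_
    filter_upwards [eventually_disjoint_segment (K := {p}) isClosed_singleton (σ • w i)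
      (σ • w (i + 1)) (disjoint_singleton_right.2 hne)] with δ hδ
    exact disjoint_singleton_right.1 hδ
  obtain ⟨δ, ⟨hδ1, hδ2⟩, hδ0⟩ := ((ev1.and ev2).and
    (self_mem_nhdsWithin : Ioi (0 : ℝ) ∈ 𝓝[>] (0 : ℝ))).exists
  have hδ0 : 0 < δ := hδ0
  let c : ℝ → ℕ → Plane := fun σ i => a i + δ • σ • w i
  have hbase : ∀ σ ∈ ({1, -1} : Finset ℝ), ∀ i < m + 1,
      (segment ℝ (c σ i) (c σ (i + 1)) \ E) ∩ segment ℝ (a i) (a (i + 1)) = ∅ := fun σ hσ i hi =>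
    offset_disjoint_base (by simpa using hσ) hδ0 (hwl i hi) (hwr i hi) (hww i hi)
  let X : ℝ → ℕ → Sym2 Plane → Set Plane := fun σ i s =>
    (segment ℝ (c σ i) (c σ (i + 1)) \ E) ∩ segSet s
  have hsub : ∀ σ ∈ ({1, -1} : Finset ℝ), ∀ i < m + 1, ∀ s ∈ S, (X σ i s).Subsingleton := by
    intro σ hσ i hi s hs
    by_cases h : s = s(a i, a (i + 1))
    · simp only [X, h, segSet_mk, hbase σ hσ i hi]; exact subsingleton_empty
    · exact (hδ1 σ hσ i (Finset.mem_range.2 hi) s hs h).1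
  let Hm : ℝ → ℕ → Sym2 Plane → Prop := fun σ k s => ∃ d, s = s(a (k + 1), d) ∧
    0 < σ * det2 (a (k + 2) - a (k + 1)) (d - a (k + 1)) ∧ 0 < det2 (d - a (k + 1)) (w (k + 1))
  let Hp : ℝ → ℕ → Sym2 Plane → Prop := fun σ k s => ∃ d, s = s(a (k + 1), d) ∧
    0 < σ * det2 (a (k + 1) - a k) (d - a (k + 1)) ∧ 0 < det2 (w (k + 1)) (d - a (k + 1))
  have hcard : ∀ σ ∈ ({1, -1} : Finset ℝ), ∀ i < m + 1, ∀ s ∈ S, (X σ i s).ncard ≤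
      (if 0 < i ∧ Hm σ (i - 1) s then 1 else 0) + (if i < m ∧ Hp σ i s then 1 else 0) := by
    intro σ hσ i hi s hs
    rcases (X σ i s).eq_empty_or_nonempty with he | hne
    · rw [he]; simp
    · have h1 : (X σ i s).ncard ≤ 1 := by
        have := hsub σ hσ i hi s hs
        rw [Set.ncard_le_one (this.finite)]
        exact this
      have hs' : s ≠ s(a i, a (i + 1)) := by
        rintro rfl
        rw [show X σ i s(a i, a (i + 1)) = ∅ from hbase σ hσ i hi] at hne
        exact not_nonempty_empty hne
      rcases (hδ1 σ hσ i (Finset.mem_range.2 hi) s hs hs').2 hne with ⟨g1, g2⟩ | ⟨g1, g2⟩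
      · obtain ⟨k, rfl⟩ : ∃ k, i = k + 1 := ⟨i - 1, by have := hi0 i (by omega) g1; omega⟩
        have g3 : 0 < k + 1 ∧ Hm σ (k + 1 - 1) s := ⟨by omega, g2⟩
        rw [if_pos g3]; omega
      · have : i < m := by have := hi0 (i + 1) (by omega) g1; omega
        have g3 : i < m ∧ Hp σ i s := ⟨this, g2⟩
        rw [if_pos g3]; omega
  let Y : ℝ → ℕ := fun σ => ∑ i ∈ Finset.range (m + 1), ∑ s ∈ F, (X σ i s).ncard
  have hY : ∀ σ ∈ ({1, -1} : Finset ℝ), Y σ ≤ ∑ k ∈ Finset.range m, ∑ s ∈ F,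
      ((if Hm σ k s then 1 else 0) + (if Hp σ k s then 1 else 0)) := by
    intro σ hσ
    calc Y σ ≤ ∑ i ∈ Finset.range (m + 1), ((∑ s ∈ F, if 0 < i ∧ Hm σ (i - 1) s then 1 else 0) +
          (∑ s ∈ F, if i < m ∧ Hp σ i s then 1 else 0)) := by
          refine Finset.sum_le_sum fun i hi => ?_
          rw [← Finset.sum_add_distrib]
          exact Finset.sum_le_sum fun s hs => hcard σ hσ i (Finset.mem_range.1 hi) s (hF hs)
      _ = _ := by
          rw [Finset.sum_add_distrib, Finset.sum_range_succ', Finset.sum_range_succ]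
          simp only [lt_irrefl, false_and, if_false, Finset.sum_const_zero, add_zero,
            Nat.succ_pos, true_and, Nat.add_sub_cancel]
          rw [← Finset.sum_add_distrib]
          refine Finset.sum_congr rfl fun k hk => ?_
          rw [Finset.sum_add_distrib]
          simp [Finset.mem_range.1 hk]
  have htot : Y 1 + Y (-1) ≤ ∑ k ∈ Finset.range m, wt F (a k) (a (k + 1)) (a (k + 2)) := by
    refine (add_le_add (hY 1 (by simp)) (hY (-1) (by simp))).trans ?_
    rw [← Finset.sum_add_distrib]
    refine Finset.sum_le_sum fun k hk => ?_
    have hk := Finset.mem_range.1 hk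
    obtain ⟨w1, w2, -⟩ := hw1 (k + 1) (by omega) (by omega)
    simp only [Nat.add_sub_cancel] at w2
    rw [wt, Finset.card_filter, ← Finset.sum_add_distrib]
    refine Finset.sum_le_sum fun s hs => ?_
    have ex : ∀ σ σ' : ℝ, σ ∈ ({1, -1} : Finset ℝ) → Hm σ k s → Hp σ' k s → False := by
      rintro σ σ' - ⟨d, rfl, -, h2⟩ ⟨d', hd', -, h2'⟩
      rw [Sym2.congr_right] at hd'
      subst hd'
      rw [det2_swap] at h2
      linarith
    have em : Hm 1 k s → Hm (-1) k s → False := by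
      rintro ⟨d, rfl, h2, -⟩ ⟨d', hd', h2', -⟩
      rw [Sym2.congr_right] at hd'
      subst hd'
      linarith
    have ep : Hp 1 k s → Hp (-1) k s → False := by
      rintro ⟨d, rfl, h2, -⟩ ⟨d', hd', h2', -⟩
      rw [Sym2.congr_right] at hd'
      subst hd'
      linarith
    have self0 : ∀ v : Plane, det2 v v = 0 := fun v => by simp only [det2]; ring
    have gm : ∀ σ : ℝ, Hm σ k s →
        a (k + 1) ∈ s ∧ s ≠ s(a k, a (k + 1)) ∧ s ≠ s(a (k + 1), a (k + 2)) := by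
      rintro σ ⟨d, rfl, h2, h3⟩
      refine ⟨Sym2.mem_mk_left _ _, ?_, ?_⟩
      · rw [Sym2.eq_swap (a := a k)]
        intro h
        rw [Sym2.congr_right] at h
        subst h
        rw [← neg_sub, det2_neg_left] at h3
        linarith
      · intro h
        rw [Sym2.congr_right] at h
        subst h
        rw [self0] at h2
        linarith
    have gp : ∀ σ : ℝ, Hp σ k s →
        a (k + 1) ∈ s ∧ s ≠ s(a k, a (k + 1)) ∧ s ≠ s(a (k + 1), a (k + 2)) := by
      rintro σ ⟨d, rfl, h2, h3⟩
      refine ⟨Sym2.mem_mk_left _ _, ?_, ?_⟩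
      · rw [Sym2.eq_swap (a := a k)]
        intro h
        rw [Sym2.congr_right] at h
        subst h
        rw [← neg_sub (a (k + 1)), det2_neg_right, self0] at h2
        linarith
      · intro h
        rw [Sym2.congr_right] at h
        subst h
        rw [det2_swap] at h3
        have : 0 < det2 (a (k + 2) - a (k + 1)) (w (k + 1)) := w1
        linarith
    by_cases q : a (k + 1) ∈ s ∧ s ≠ s(a k, a (k + 1)) ∧ s ≠ s(a (k + 1), a (k + 2))
    · rw [if_pos q]
      exact ite_add_le_one em ep (ex 1 1 (by simp)) (ex 1 (-1) (by simp)) (ex (-1) 1 (by simp))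
        (ex (-1) (-1) (by simp))
    · have y1 := fun h => q (gm 1 h)
      have y2 := fun h => q (gm (-1) h)
      have y3 := fun h => q (gp 1 h)
      have y4 := fun h => q (gp (-1) h)
      rw [if_neg y1, if_neg y2, if_neg y3, if_neg y4]; omega
  obtain ⟨σ, hσ, hσY⟩ : ∃ σ ∈ ({1, -1} : Finset ℝ),
      2 * Y σ ≤ ∑ k ∈ Finset.range m, wt F (a k) (a (k + 1)) (a (k + 2)) := by
    rcases le_total (Y 1) (Y (-1)) with h | h
    · exact ⟨1, by simp, by omega⟩
    · exact ⟨-1, by simp, by omega⟩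
  refine ⟨c σ, ?_, ?_, ?_, ?_, hσY⟩
  · simp [c, hw0 0 (Or.inl rfl)]
  · simp [c, hw0 (m + 1) (Or.inr rfl)]
  · intro i hi p hp hps
    by_cases h : p ∈ segment ℝ (a i) (a (i + 1))
    · by_contra hpE
      have : p ∈ (segment ℝ (c σ i) (c σ (i + 1)) \ E) ∩ segment ℝ (a i) (a (i + 1)) :=
        ⟨⟨hps, by simpa [hE] using hpE⟩, h⟩
      rw [hbase σ hσ i hi] at this
      exact this
    · exact absurd hps (hδ2 σ hσ i (Finset.mem_range.2 hi) p hp h)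
  · exact fun i hi s hs => hsub σ hσ i hi s hs

end Polyline

namespace Polyline

/-- The total weight of the turns of a walk. -/
noncomputable def cost (F : Finset (Sym2 Plane)) : List Plane → ℕ
  | a :: b :: c :: l => wt F a b c + cost F (b :: c :: l)
  | _ => 0

lemma range_succ_map {α : Type*} (f : ℕ → α) (m : ℕ) :
    (List.range (m + 1)).map f = f 0 :: (List.range m).map fun i => f (i + 1) := by
  rw [List.range_succ_eq_map, List.map_cons, List.map_map]; rfl

lemma segs_map (f : ℕ → Plane) (m : ℕ) : segs ((List.range (m + 1)).map f) =
    (List.range m).map fun i => s(f i, f (i + 1)) := by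
  induction m generalizing f with
  | zero => simp [segs]
  | succ m ih =>
    have := ih fun i => f (i + 1)
    rw [range_succ_map, range_succ_map, segs, range_succ_map fun i => s(f i, f (i + 1)), ← this,
      range_succ_map]

lemma supp_map (f : ℕ → Plane) (m : ℕ) (h : 1 ≤ m) : supp ((List.range (m + 1)).map f) =
    ⋃ i ∈ Finset.range m, segment ℝ (f i) (f (i + 1)) := by
  ext x
  simp only [mem_iUnion, Finset.mem_range, exists_prop]
  constructor
  · intro hx
    obtain ⟨s, hs, hxs⟩ := exists_segs_of_mem_supp (by simpa using h) hx
    rw [segs_map, List.mem_map] at hs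
    obtain ⟨i, hi, rfl⟩ := hs
    exact ⟨i, List.mem_range.1 hi, hxs⟩
  · rintro ⟨i, hi, hx⟩
    refine segSet_subset_supp (s := s(f i, f (i + 1))) ?_ hx
    rw [segs_map, List.mem_map]
    exact ⟨i, List.mem_range.2 hi, rfl⟩

lemma cost_map (F : Finset (Sym2 Plane)) (f : ℕ → Plane) (m : ℕ) :
    cost F ((List.range (m + 2)).map f) =
      ∑ k ∈ Finset.range m, wt F (f k) (f (k + 1)) (f (k + 2)) := by
  induction m generalizing f with
  | zero => simp [range_succ_map, cost]
  | succ m ih =>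
    have := ih fun i => f (i + 1)
    rw [range_succ_map, range_succ_map, range_succ_map, cost, Finset.sum_range_succ', ← this,
      range_succ_map, range_succ_map, add_comm]

lemma exists_map_range {α : Type*} [Inhabited α] (l : List α) :
    l = (List.range l.length).map fun i => l.getD i default := by
  apply List.ext_getElem
  · simp
  · intro i h1 h2
    simp [List.getD, h1]

lemma wt_symm (F : Finset (Sym2 Plane)) (a b c : Plane) : wt F a b c = wt F c b a := by
  classical
  unfold wt
  congr 1
  ext s
  simp only [Finset.mem_filter, Sym2.eq_swap (a := a) (b := b), Sym2.eq_swap (a := b) (b := c)]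
  tauto

lemma cost_append (F : Finset (Sym2 Plane)) (x a y : Plane) (l₂ : List Plane) :
    ∀ l₁ : List Plane, cost F (l₁ ++ x :: a :: y :: l₂) =
      cost F (l₁ ++ [x, a]) + wt F x a y + cost F (a :: y :: l₂)
  | [] => by simp [cost]
  | [c] => by simp [cost]; ring
  | c :: d :: [] => by simp [cost]; ring
  | c :: d :: e :: l => by
    have := cost_append F x a y l₂ (d :: e :: l)
    simp only [List.cons_append, cost] at this ⊢
    rw [this]; ring

lemma cost_reverse (F : Finset (Sym2 Plane)) : ∀ l : List Plane, cost F l.reverse = cost F l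
  | [] => rfl
  | [_] => rfl
  | [_, _] => rfl
  | a :: b :: c :: l => by
    have ih := cost_reverse F (b :: c :: l)
    have h := cost_append F c b a [] l.reverse
    simp only [List.reverse_cons, List.append_assoc, List.cons_append, List.nil_append] at ih h ⊢
    rw [h, ih, wt_symm]
    simp [cost]; ring

lemma exists_route {W : List Plane} (hW : 3 ≤ W.length) {u v : Plane} (hu : W.head? = some u)
    (hv : W.getLast? = some v) {S F : Finset (Sym2 Plane)} (hF : F ⊆ S)
    (V : Finset Plane) (hnd : ∀ x y, s(x, y) ∈ S → x ≠ y)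
    (hplane : ∀ s ∈ S, ∀ t ∈ S, s ≠ t → ∀ x, x ∈ segSet s → x ∈ segSet t → x ∈ s ∧ x ∈ t)
    (hS : ∀ s ∈ segs W, s ∈ S) (hc : (segs W).Nodup) :
    ∃ l : List Plane, l.head? = some u ∧ l.getLast? = some v ∧ (∀ p ∈ V, p ∈ supp l → p = u ∨ p = v) ∧
      (∀ s ∈ S, ((supp l \ {u, v}) ∩ segSet s).Finite) ∧
      2 * ∑ s ∈ F, ((supp l \ {u, v}) ∩ segSet s).ncard ≤ cost F W := by
  obtain ⟨m, hm⟩ : ∃ m, W.length = m + 2 := ⟨W.length - 2, by omega⟩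
  obtain ⟨a, rfl⟩ : ∃ a : ℕ → Plane, W = (List.range (m + 2)).map a :=
    ⟨_, hm ▸ exists_map_range W⟩
  have hu' : a 0 = u := by
    rw [range_succ_map] at hu; simpa using hu
  have hv' : a (m + 1) = v := by
    rw [List.range_succ] at hv; simpa using hv
  rw [segs_map] at hS hc
  have hinj := List.inj_on_of_nodup_map hc
  obtain ⟨c, c0, c1, cV, csub, ccost⟩ := route_fun (a := a) (m := m) (by simp at hW; omega) hF V hnd
    hplane (fun i hi => hS _ (List.mem_map.2 ⟨i, List.mem_range.2 hi, rfl⟩))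
    (fun i hi h => by
      have := hinj (List.mem_range.2 (by omega : i < m + 1))
        (List.mem_range.2 (by omega : i + 1 < m + 1)) h
      omega)
  rw [hu', hv'] at *
  have hX : ∀ s, (supp ((List.range (m + 2)).map c) \ {u, v}) ∩ segSet s =
      ⋃ i ∈ Finset.range (m + 1), ((segment ℝ (c i) (c (i + 1)) \ {u, v}) ∩ segSet s) := by
    intro s
    rw [supp_map _ _ (by omega)]
    ext x
    simp only [mem_inter_iff, mem_sdiff, mem_iUnion, exists_prop]
    tauto
  refine ⟨(List.range (m + 2)).map c, ?_, ?_, ?_, ?_, ?_⟩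
  · rw [range_succ_map, c0]; rfl
  · rw [List.range_succ]; simp [c1]
  · intro p hp hps
    rw [supp_map _ _ (by omega)] at hps
    simp only [mem_iUnion, Finset.mem_range, exists_prop] at hps
    obtain ⟨i, hi, hpi⟩ := hps
    exact cV i hi p hp hpi
  · intro s hs
    rw [hX]
    exact Set.Finite.biUnion (Finset.finite_toSet _) fun i hi =>
      (csub i (Finset.mem_range.1 hi) s hs).finite
  · rw [cost_map]
    refine le_trans (Nat.mul_le_mul_left 2 ?_) ccost
    rw [Finset.sum_comm]
    refine Finset.sum_le_sum fun s _ => ?_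
    rw [hX]
    exact Finset.set_ncard_biUnion_le _ _

end Polyline

namespace Polyline
open Filter Topology Metric

lemma head?_append_cons {α : Type*} {l₁ : List α} {a : α} (l₂ l₃ : List α) :
    (l₁ ++ a :: l₂).head? = (l₁ ++ a :: l₃).head? := by
  cases l₁ <;> rfl

lemma getLast?_append_cons {α : Type*} (l₁ l₂ : List α) (a : α) :
    (l₁ ++ a :: l₂).getLast? = (a :: l₂).getLast? := by
  rw [List.getLast?_append]
  cases h : (a :: l₂).getLast? <;> simp_all

lemma exists_eq_concat {α : Type*} {l : List α} {y : α} (h : l.getLast? = some y) :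
    ∃ l', l = l' ++ [y] := by
  obtain ⟨l', hl⟩ := List.getLast?_eq_some_iff.1 h
  exact ⟨l', hl⟩

lemma exists_eq_cons {α : Type*} {l : List α} {y : α} (h : l.head? = some y) :
    ∃ l', l = y :: l' := by
  obtain ⟨l', hl⟩ := List.head?_eq_some_iff.1 h
  exact ⟨l', hl⟩

/-- Concatenation of two polygonal lines at a common endpoint. -/
lemma exists_concat {l₁ l₂ : List Plane} {x y z : Plane} (h₁ : l₁.head? = some x)
    (h₁' : l₁.getLast? = some y) (h₂ : l₂.head? = some y) (h₂' : l₂.getLast? = some z) :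
    ∃ l, l.head? = some x ∧ l.getLast? = some z ∧ supp l = supp l₁ ∪ supp l₂ := by
  obtain ⟨m₁, rfl⟩ := exists_eq_concat h₁'
  obtain ⟨m₂, rfl⟩ := exists_eq_cons h₂
  refine ⟨m₁ ++ y :: m₂, ?_, ?_, supp_append _ _ _⟩
  · rw [← h₁]; exact head?_append_cons _ _
  · rw [getLast?_append_cons]; exact h₂'

lemma exists_polyline {U M : Set Plane} (hU : IsOpen U) (hM : IsPreconnected M) (hMU : M ⊆ U)
    {x y : Plane} (hx : x ∈ M) (hy : y ∈ M) :
    ∃ l : List Plane, l.head? = some x ∧ l.getLast? = some y ∧ supp l ⊆ U := by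
  refine hM.induction₂' (fun x y => ∃ l : List Plane, l.head? = some x ∧ l.getLast? = some y ∧
    supp l ⊆ U) ?_ ?_ hx hy
  · intro z hz
    obtain ⟨ε, hε, hb⟩ := Metric.isOpen_iff.1 hU z (hMU hz)
    filter_upwards [mem_nhdsWithin_of_mem_nhds (ball_mem_nhds z hε)] with w hw
    have hs : segment ℝ z w ⊆ U :=
      ((convex_ball z ε).segment_subset (mem_ball_self hε) hw).trans hb
    have hwU : ({w} : Set Plane) ⊆ U := singleton_subset_iff.2 (hb hw)
    have hzU : ({z} : Set Plane) ⊆ U := singleton_subset_iff.2 (hMU hz)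
    refine ⟨⟨[z, w], rfl, rfl, ?_⟩, ⟨[w, z], rfl, rfl, ?_⟩⟩
    · exact union_subset hs hwU
    · exact union_subset (by rwa [segment_symm]) hzU
  · rintro a b c - - - ⟨l₁, h1, h2, h3⟩ ⟨l₂, g1, g2, g3⟩
    obtain ⟨l, k1, k2, k3⟩ := exists_concat h1 h2 g1 g2
    exact ⟨l, k1, k2, k3 ▸ union_subset h3 g3⟩

/-- The last exit point from a ball lies on the bounding sphere. -/
lemma dist_eq_of_exit {x p q : Plane} {r : ℝ} {l : List Plane}
    (hq : q ∈ supp (p :: l)) (hqr : q ∉ closedBall x r) (hp : p ∈ closedBall x r)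
    (hs : Simple (p :: l)) (h : supp (p :: l) ∩ closedBall x r ⊆ {p}) : dist p x = r := by
  by_contra hne
  have hlt : dist p x < r := lt_of_le_of_ne hp hne
  cases l with
  | nil =>
    have : q = p := hq
    exact hqr (this ▸ hp)
  | cons b l =>
    have hc : Continuous fun t : ℝ => p + t • (b - p) := by fun_prop
    have hev : ∀ᶠ t in 𝓝[>] (0 : ℝ), p + t • (b - p) ∈ ball x r := by
      refine (hc.continuousAt.eventually_mem ?_).filter_mono nhdsWithin_le_nhds
      exact isOpen_ball.mem_nhds (by simpa using hlt)
    have hev' : ∀ᶠ t in 𝓝[>] (0 : ℝ), t ∈ Ioo (0 : ℝ) 1 := Ioo_mem_nhdsGT one_pos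
    obtain ⟨t, ht, ht'⟩ := (hev.and hev').exists
    have hm : p + t • (b - p) ∈ supp (p :: b :: l) := by
      left
      rw [segment_eq_image']
      exact ⟨t, ⟨ht'.1.le, ht'.2.le⟩, rfl⟩
    have : p + t • (b - p) = p := h ⟨hm, ball_subset_closedBall ht⟩
    have h0 : t • (b - p) = 0 := by simpa using this
    rcases smul_eq_zero.1 h0 with h0 | h0
    · exact ht'.1.ne' h0
    · exact hs.1 (sub_eq_zero.1 h0).symm

lemma exists_core {U M : Set Plane} (hU : IsOpen U) (hM : IsPreconnected M) (hMU : M ⊆ U)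
    {x y : Plane} {r : ℝ} (hxy : Disjoint (closedBall x r) (closedBall y r))
    (hx : (M ∩ closedBall x r).Nonempty) (hy : (M ∩ closedBall y r).Nonempty) :
    ∃ l p q, Simple l ∧ l.head? = some p ∧ l.getLast? = some q ∧ supp l ⊆ U ∧ dist p x = r ∧
      dist q y = r ∧ supp l ∩ closedBall x r ⊆ {p} ∧ supp l ∩ closedBall y r ⊆ {q} := by
  obtain ⟨a, haM, ha⟩ := hx
  obtain ⟨b, hbM, hb⟩ := hy
  obtain ⟨l₀, h1, h2, h3⟩ := exists_polyline hU hM hMU haM hbM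
  obtain ⟨l₁, g0, g1, g2, g3⟩ := exists_simple h1 h2
  obtain ⟨p, m, k1, k2, k3, k4, k5⟩ := exists_last_exit (K := closedBall x r) isClosed_closedBall
    g0 g2 ⟨a, mem_supp_of_mem (List.mem_of_mem_head? g1), ha⟩
  have hbm : b ∈ p :: m := List.mem_of_mem_getLast? k2
  have hpd := dist_eq_of_exit (mem_supp_of_mem hbm) (fun h => disjoint_left.1 hxy h hb) k4 k1 k5
  have hpl : (p :: m).reverse.getLast? = some p := by simp
  obtain ⟨q, n, j1, j2, j3, j4, j5⟩ := exists_last_exit (K := closedBall y r) isClosed_closedBall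
    k1.reverse hpl ⟨b, mem_supp_of_mem (List.mem_reverse.2 hbm), hb⟩
  have hpn : p ∈ q :: n := List.mem_of_mem_getLast? j2
  have hqd := dist_eq_of_exit (mem_supp_of_mem hpn) (fun h => disjoint_left.1 hxy k4 h) j4 j1 j5
  rw [supp_reverse] at j3
  refine ⟨(q :: n).reverse, p, q, j1.reverse, by rw [List.head?_reverse]; exact j2,
    by simp, ?_, hpd, hqd, ?_, ?_⟩
  · rw [supp_reverse]; exact ((j3.trans k3).trans g3).trans h3
  · rw [supp_reverse]; exact fun z hz => k5 ⟨j3 hz.1, hz.2⟩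
  · rw [supp_reverse]; exact j5

lemma segment_inter_sphere {x p z : Plane} {r : ℝ} (hr : 0 < r) (hp : dist p x = r)
    (hz : z ∈ segment ℝ x p) (hzr : r ≤ dist z x) : z = p := by
  rw [segment_eq_image'] at hz
  obtain ⟨t, ht, rfl⟩ := hz
  have : dist (x + t • (p - x)) x = t * r := by
    rw [dist_eq_norm, add_sub_cancel_left, norm_smul, Real.norm_of_nonneg ht.1, ← dist_eq_norm, hp]
  rw [this] at hzr
  have : t = 1 := le_antisymm ht.2 (by nlinarith)
  simp [this]

lemma segment_inter_segment {x p q z : Plane} {r : ℝ} (hr : 0 < r) (hp : dist p x = r)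
    (hq : dist q x = r) (hpq : p ≠ q) (hz : z ∈ segment ℝ x p) (hz' : z ∈ segment ℝ x q) :
    z = x := by
  rw [segment_eq_image'] at hz hz'
  obtain ⟨t, ht, rfl⟩ := hz
  obtain ⟨s, hs, h⟩ := hz'
  have h' : s • (q - x) = t • (p - x) := by simpa using h
  have : s * r = t * r := by
    have := congrArg norm h'
    rwa [norm_smul, norm_smul, Real.norm_of_nonneg ht.1, Real.norm_of_nonneg hs.1,
      ← dist_eq_norm, ← dist_eq_norm, hp, hq] at this
  have hst : s = t := mul_right_cancel₀ hr.ne' this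
  rw [hst] at h'
  by_cases ht0 : t = 0
  · simp [ht0]
  · have := smul_right_injective Plane ht0 h'
    exact absurd (sub_left_injective this).symm hpq

lemma segment_subset_closedBall {x p : Plane} {r : ℝ} (hr : 0 < r) (hp : dist p x = r) :
    segment ℝ x p ⊆ closedBall x r :=
  (convex_closedBall x r).segment_subset (mem_closedBall_self hr.le) (mem_closedBall.2 hp.le)

end Polyline

namespace Polyline
open Filter Topology Metric

lemma eventually_disjoint_closedBall {p : Plane} {B : Set Plane} (hB : IsClosed B) (h : p ∉ B) :
    ∀ᶠ r in 𝓝[>] (0 : ℝ), Disjoint (closedBall p r) B := by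
  obtain ⟨ε, hε, hb⟩ := Metric.isOpen_iff.1 hB.isOpen_compl p h
  filter_upwards [Ioo_mem_nhdsGT hε] with r hr
  rw [← subset_compl_iff_disjoint_right]
  exact (closedBall_subset_ball hr.2).trans hb

lemma eventually_disjoint_closedBalls {p q : Plane} (h : p ≠ q) :
    ∀ᶠ r in 𝓝[>] (0 : ℝ), Disjoint (closedBall p r) (closedBall q r) := by
  have : 0 < dist p q := dist_pos.2 h
  filter_upwards [Ioo_mem_nhdsGT (half_pos this)] with r hr
  exact closedBall_disjoint_closedBall (by linarith [hr.2])

lemma eventually_disjoint_thickening {A B : Set Plane} (hA : IsCompact A) (hB : IsClosed B)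
    (h : Disjoint A B) :
    ∀ᶠ ε in 𝓝[>] (0 : ℝ), Disjoint (thickening ε A) (thickening ε B) := by
  obtain ⟨δ, hδ, hd⟩ := h.exists_thickenings hA hB
  filter_upwards [Ioo_mem_nhdsGT hδ] with ε hε
  exact hd.mono (thickening_mono hε.2.le A) (thickening_mono hε.2.le B)

/-- A finite family of arcs meeting only in a finite set `X` of common endpoints can be replaced
by simple polygonal lines with the same endpoints, again meeting only in `X`. -/
theorem exists_polygonal_family {ι : Type*} [Finite ι] {X : Set Plane} (hX : X.Finite)
    (B : ι → Set Plane) (z : ι → Bool → Plane) (hz : ∀ i b, z i b ∈ X)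
    (hzz : ∀ i, z i true ≠ z i false) (hB : ∀ i, IsClosed (B i))
    (hBX : ∀ i, ∀ p ∈ X, p ∈ B i → ∃ b, p = z i b)
    (hBB : ∀ i j, i ≠ j → B i ∩ B j ⊆ X)
    (hM : ∀ i, ∀ r > 0, ∃ M ⊆ B i \ X, IsCompact M ∧ IsPreconnected M ∧
      ∀ b, (M ∩ closedBall (z i b) r).Nonempty) :
    ∃ l : ι → List Plane, ∀ i, Simple (l i) ∧ (l i).head? = some (z i true) ∧
      (l i).getLast? = some (z i false) ∧ 3 ≤ (l i).length ∧
      (∀ p ∈ X, p ∈ supp (l i) → ∃ b, p = z i b) ∧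
      ∀ j, i ≠ j → supp (l i) ∩ supp (l j) ⊆ X := by
  classical
  have e1 : ∀ᶠ r in 𝓝[>] (0 : ℝ), ∀ p ∈ X, ∀ q ∈ X, p ≠ q →
      Disjoint (closedBall p r) (closedBall q r) :=
    (Filter.eventually_all_finite hX).2 fun p _ => (Filter.eventually_all_finite hX).2 fun q _ =>
      Filter.eventually_all.2 fun h => eventually_disjoint_closedBalls h
  have e2 : ∀ᶠ r in 𝓝[>] (0 : ℝ), ∀ p ∈ X, ∀ i, (∀ b, p ≠ z i b) →
      Disjoint (closedBall p r) (B i) :=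
    (Filter.eventually_all_finite hX).2 fun p hp => Filter.eventually_all.2 fun i =>
      Filter.eventually_all.2 fun h => eventually_disjoint_closedBall (hB i) fun hpB => by
        obtain ⟨b, hb⟩ := hBX i p hp hpB
        exact h b hb
  obtain ⟨r, ⟨hr1, hr2⟩, hr0⟩ := ((e1.and e2).and
    (self_mem_nhdsWithin : Ioi (0 : ℝ) ∈ 𝓝[>] (0 : ℝ))).exists
  have hr0 : 0 < r := hr0
  choose M hMB hMc hMp hMn using fun i => hM i r hr0
  have e3 : ∀ᶠ ε in 𝓝[>] (0 : ℝ), ∀ i j, i ≠ j →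
      Disjoint (thickening ε (M i)) (thickening ε (M j)) := by
    refine Filter.eventually_all.2 fun i => Filter.eventually_all.2 fun j =>
      Filter.eventually_all.2 fun h => eventually_disjoint_thickening (hMc i) (hMc j).isClosed ?_
    rw [disjoint_left]
    intro p hp hq
    exact (hMB i hp).2 (hBB i j h ⟨(hMB i hp).1, (hMB j hq).1⟩)
  have e4 : ∀ᶠ ε in 𝓝[>] (0 : ℝ), ∀ p ∈ X, ∀ i, (∀ b, p ≠ z i b) →
      Disjoint (thickening ε (M i)) (thickening ε (closedBall p r)) := by
    refine (Filter.eventually_all_finite hX).2 fun p hp => Filter.eventually_all.2 fun i =>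
      Filter.eventually_all.2 fun h => eventually_disjoint_thickening (hMc i) isClosed_closedBall ?_
    exact ((hr2 p hp i h).mono_right ((hMB i).trans sdiff_subset)).symm
  obtain ⟨ε, ⟨hε1, hε2⟩, hε0⟩ := ((e3.and e4).and
    (self_mem_nhdsWithin : Ioi (0 : ℝ) ∈ 𝓝[>] (0 : ℝ))).exists
  have hε0 : 0 < ε := hε0
  have hε2' : ∀ p ∈ X, ∀ i, (∀ b, p ≠ z i b) →
      Disjoint (thickening ε (M i)) (closedBall p r) := fun p hp i h =>
    (hε2 p hp i h).mono_right (self_subset_thickening hε0 _)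
  have hcore : ∀ i, ∃ (l : List Plane) (p : Bool → Plane), Simple l ∧ l.head? = some (p true) ∧
      l.getLast? = some (p false) ∧ supp l ⊆ thickening ε (M i) ∧ (∀ b, dist (p b) (z i b) = r) ∧
      ∀ b, supp l ∩ closedBall (z i b) r ⊆ {p b} := by
    intro i
    obtain ⟨l, p, q, h1, h2, h3, h4, h5, h6, h7, h8⟩ := exists_core (isOpen_thickening (δ := ε))
      (hMp i) (self_subset_thickening hε0 _) (hr1 _ (hz i true) _ (hz i false) (hzz i))
      (hMn i true) (hMn i false)
    exact ⟨l, fun b => bif b then p else q, h1, h2, h3, h4, by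
      rintro (_ | _)
      exacts [h6, h5], by
      rintro (_ | _)
      exacts [h8, h7]⟩
  choose l p hs hh hl hU hd hb using hcore
  have hpl : ∀ i b, p i b ∈ supp (l i) := by
    rintro i (_ | _)
    · exact mem_supp_of_mem (List.mem_of_mem_getLast? (hl i))
    · exact mem_supp_of_mem (List.mem_of_mem_head? (hh i))
  have hsb : ∀ i b, segment ℝ (z i b) (p i b) ⊆ closedBall (z i b) r := fun i b =>
    segment_subset_closedBall hr0 (hd i b)
  have hpij : ∀ i j, i ≠ j → ∀ b b', p i b ≠ p j b' := fun i j h b b' he =>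
    disjoint_left.1 (hε1 i j h) (hU i (hpl i b)) (he ▸ hU j (hpl j b'))
  -- a radial segment meets a core only in its own outer endpoint
  have hsc : ∀ i j b x, x ∈ segment ℝ (z i b) (p i b) → x ∈ supp (l j) → i = j ∧ x = p i b := by
    intro i j b x hx hxj
    by_cases hinc : ∀ b', z i b ≠ z j b'
    · exact absurd (hsb i b hx) (disjoint_left.1 (hε2' _ (hz i b) j hinc) (hU j hxj))
    · push Not at hinc
      obtain ⟨b', hb'⟩ := hinc
      have h1 : x = p j b' := hb j b' ⟨hxj, hb' ▸ hsb i b hx⟩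
      have h2 : x = p i b := segment_inter_sphere hr0 (hd i b) hx (by rw [h1, hb', hd])
      by_cases hij : i = j
      · exact ⟨hij, h2⟩
      · exact absurd (h2.symm.trans h1) (hpij i j hij b b')
  have hss : ∀ i j b b' x, x ∈ segment ℝ (z i b) (p i b) → x ∈ segment ℝ (z j b') (p j b') →
      z i b = z j b' ∧ (i ≠ j → x = z i b) := by
    intro i j b b' x hx hx'
    have : z i b = z j b' := by
      by_contra h
      exact disjoint_left.1 (hr1 _ (hz i b) _ (hz j b') h) (hsb i b hx) (hsb j b' hx')
    refine ⟨this, fun hij => ?_⟩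
    rw [← this] at hx'
    exact segment_inter_segment hr0 (hd i b) (by rw [this, hd]) (hpij i j hij b b') hx hx'
  have hsupp : ∀ i, supp (z i true :: (l i ++ [z i false])) =
      segment ℝ (z i true) (p i true) ∪ (supp (l i) ∪ segment ℝ (z i false) (p i false)) := by
    intro i
    obtain ⟨m, hm⟩ := exists_eq_concat (hl i)
    have h1 : supp (l i ++ [z i false]) = supp (l i) ∪ segment ℝ (z i false) (p i false) := by
      rw [hm, List.append_assoc, List.singleton_append, supp_append, segment_symm]
      congr 1
      simp only [supp, union_singleton]
      exact insert_eq_of_mem (right_mem_segment ℝ _ _)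
    rw [← h1]
    obtain ⟨n, hn⟩ := exists_eq_cons (hh i)
    rw [hn]; rfl
  have hmem : ∀ i x, x ∈ supp (z i true :: (l i ++ [z i false])) ↔
      x ∈ supp (l i) ∨ ∃ b, x ∈ segment ℝ (z i b) (p i b) := by
    intro i x
    rw [hsupp, Bool.exists_bool]
    simp only [mem_union]
    tauto
  refine ⟨fun i => z i true :: (l i ++ [z i false]), fun i => ⟨?_, rfl, ?_, ?_, ?_, ?_⟩⟩
  · obtain ⟨m, hm⟩ := exists_eq_concat (hl i)
    have hs1 : Simple (l i ++ [z i false]) := by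
      rw [hm, List.append_assoc, List.singleton_append, simple_append, ← hm]
      refine ⟨hs i, ⟨?_, ?_, trivial⟩, ?_⟩
      · intro h
        have := hd i false
        rw [h, dist_self] at this
        exact hr0.ne this
      · exact inter_subset_right
      · rintro x ⟨hx, hx'⟩
        have : x ∈ segment ℝ (z i false) (p i false) := by
          rcases hx' with hx' | hx'
          · rwa [segment_symm]
          · rw [mem_singleton_iff.1 hx']; exact left_mem_segment ℝ _ _
        exact (hsc i i false x this hx).2
    have hsupp1 : supp (l i ++ [z i false]) ⊆
        supp (l i) ∪ segment ℝ (z i false) (p i false) := by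
      rw [hm, List.append_assoc, List.singleton_append, supp_append, segment_symm]
      refine union_subset_union_right _ ?_
      simp only [supp, union_singleton]
      rw [insert_eq_of_mem (right_mem_segment ℝ _ _)]
    obtain ⟨n, hn⟩ := exists_eq_cons (hh i)
    have : z i true :: (l i ++ [z i false]) = z i true :: p i true :: (n ++ [z i false]) := by
      rw [hn]; rfl
    show Simple (z i true :: (l i ++ [z i false]))
    rw [this]
    refine ⟨?_, ?_, ?_⟩
    · intro h
      have := hd i true
      rw [← h, dist_self] at this
      exact hr0.ne this
    · rintro x ⟨hx, hx'⟩
      rw [← List.cons_append, ← hn] at hx'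
      rcases hsupp1 hx' with hx' | hx'
      · exact (hsc i i true x hx hx').2
      · exact absurd (hss i i true false x hx hx').1 (hzz i)
    · rw [← List.cons_append, ← hn]; exact hs1
  · show (z i true :: (l i ++ [z i false])).getLast? = _
    rw [← List.cons_append, List.getLast?_append]; rfl
  · have : l i ≠ [] := by intro h; have := hh i; rw [h] at this; simp at this
    have := List.length_pos_iff.2 this
    simp; omega
  · intro x hxX hx
    by_contra hne
    push Not at hne
    rcases (hmem i x).1 hx with hx | ⟨b, hx⟩
    · exact disjoint_left.1 (hε2' x hxX i hne) (hU i hx) (mem_closedBall_self hr0.le)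
    · exact disjoint_left.1 (hr1 _ (hz i b) x hxX (hne b).symm) (hsb i b hx)
        (mem_closedBall_self hr0.le)
  · rintro j hij x ⟨hx, hx'⟩
    rcases (hmem i x).1 hx with hx | ⟨b, hx⟩ <;> rcases (hmem j x).1 hx' with hx' | ⟨b', hx'⟩
    · exact absurd (hU j hx') (disjoint_left.1 (hε1 i j hij) (hU i hx))
    · exact absurd (hsc j i b' x hx' hx).1.symm hij
    · exact absurd (hsc i j b x hx hx').1 hij
    · rw [(hss i j b b' x hx hx').2 hij]; exact hz i b

end Polyline

namespace Polyline
open Filter Topology Metric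

lemma exists_subarc {g : ℝ → Plane} (hg : Continuous g) {s t r : ℝ} (hst : s < t) (hr : 0 < r) :
    ∃ M ⊆ g '' Ioo s t, IsCompact M ∧ IsPreconnected M ∧
      (M ∩ closedBall (g s) r).Nonempty ∧ (M ∩ closedBall (g t) r).Nonempty := by
  have e1 : ∀ᶠ u in 𝓝[>] s, g u ∈ closedBall (g s) r :=
    (hg.continuousAt.eventually (closedBall_mem_nhds _ hr)).filter_mono nhdsWithin_le_nhds
  have e2 : ∀ᶠ u in 𝓝[<] t, g u ∈ closedBall (g t) r :=
    (hg.continuousAt.eventually (closedBall_mem_nhds _ hr)).filter_mono nhdsWithin_le_nhds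
  obtain ⟨s', hs', hs⟩ := (e1.and (Ioo_mem_nhdsGT (show s < (s + t) / 2 by linarith))).exists
  obtain ⟨t', ht', ht⟩ := (e2.and (Ioo_mem_nhdsLT (show (s + t) / 2 < t by linarith))).exists
  have hst' : s' ≤ t' := (hs.2.trans ht.1).le
  refine ⟨g '' Icc s' t', image_mono fun u hu => ⟨hs.1.trans_le hu.1, hu.2.trans_lt ht.2⟩,
    isCompact_Icc.image hg, isPreconnected_Icc.image g hg.continuousOn,
    ⟨g s', mem_image_of_mem g (left_mem_Icc.2 hst'), hs'⟩,
    ⟨g t', mem_image_of_mem g (right_mem_Icc.2 hst'), ht'⟩⟩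

lemma IsArc.exists_param {A : Set Plane} {x y : Plane} (h : IsArc A x y) :
    ∃ g : ℝ → Plane, Continuous g ∧ InjOn g (Icc 0 1) ∧ g '' Icc 0 1 = A ∧ g 0 = x ∧ g 1 = y := by
  obtain ⟨γ, hγ, rfl⟩ := h
  refine ⟨γ.extend, γ.continuous_extend, ?_, ?_, γ.extend_zero, γ.extend_one⟩
  · intro s hs t ht hst
    rw [γ.extend_apply hs, γ.extend_apply ht] at hst
    exact congrArg Subtype.val (hγ hst)
  · ext p
    constructor
    · rintro ⟨t, ht, rfl⟩
      rw [γ.extend_apply ht]; exact mem_range_self _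
    · rintro ⟨t, rfl⟩
      exact ⟨t, t.2, by rw [γ.extend_apply t.2]⟩

/-- Finitely many arcs with finitely many common points can be replaced by polygonal arcs
which have no new common points, and whose common points are corners. -/
theorem exists_polygonal_arcs {κ : Type*} [Finite κ] {X : Set Plane} (hX : X.Finite)
    {x y : κ → Plane} {A : κ → Set Plane} (hA : ∀ k, IsArc (A k) (x k) (y k))
    (hx : ∀ k, x k ∈ X) (hy : ∀ k, y k ∈ X) (hAA : ∀ k k', k ≠ k' → A k ∩ A k' ⊆ X) :
    ∃ L : κ → List Plane, ∀ k, Simple (L k) ∧ (L k).head? = some (x k) ∧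
      (L k).getLast? = some (y k) ∧ 3 ≤ (L k).length ∧
      (∀ p ∈ X, p ∈ supp (L k) → p ∈ L k ∧ p ∈ A k) ∧
      ∀ j, k ≠ j → supp (L k) ∩ supp (L j) ⊆ X := by
  choose g gc gi gA g0 g1 using fun k => (hA k).exists_param
  have hτ : ∀ k, {t | t ∈ Icc (0 : ℝ) 1 ∧ g k t ∈ X}.Finite := fun k =>
    Set.Finite.of_finite_image (f := g k) (hX.subset (by rintro _ ⟨t, ht, rfl⟩; exact ht.2))
      ((gi k).mono fun t ht => ht.1)
  let P : Set (κ × ℝ × ℝ) := {q | q.2.1 < q.2.2 ∧ (q.2.1 ∈ Icc (0 : ℝ) 1 ∧ g q.1 q.2.1 ∈ X) ∧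
    (q.2.2 ∈ Icc (0 : ℝ) 1 ∧ g q.1 q.2.2 ∈ X) ∧ ∀ u ∈ Ioo q.2.1 q.2.2, g q.1 u ∉ X}
  have hP : P.Finite := by
    refine (Set.finite_iUnion fun k => ((Set.finite_singleton k).prod ((hτ k).prod (hτ k)))).subset ?_
    rintro ⟨k, s, t⟩ h
    exact mem_iUnion.2 ⟨k, rfl, h.2.1, h.2.2.1⟩
  have : Finite P := hP
  have hIcc : ∀ q ∈ P, Icc q.2.1 q.2.2 ⊆ Icc (0 : ℝ) 1 := fun q hq =>
    Icc_subset_Icc hq.2.1.1.1 hq.2.2.1.1.2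
  let B : P → Set Plane := fun q => g q.1.1 '' Icc q.1.2.1 q.1.2.2
  let z : P → Bool → Plane := fun q b => bif b then g q.1.1 q.1.2.1 else g q.1.1 q.1.2.2
  have hBX : ∀ i, ∀ p ∈ X, p ∈ B i → ∃ b, p = z i b := by
    rintro ⟨⟨k, s, t⟩, hq⟩ p hp ⟨u, hu, rfl⟩
    rcases eq_or_lt_of_le hu.1 with h | h
    · exact ⟨true, by simp [z, ← h]⟩
    rcases eq_or_lt_of_le hu.2 with h' | h'
    · exact ⟨false, by simp [z, h']⟩
    · exact absurd hp (hq.2.2.2 u ⟨h, h'⟩)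
  have hBA : ∀ i : P, B i ⊆ A i.1.1 := fun i => by
    rw [← gA]; exact image_mono (hIcc i.1 i.2)
  have hBB : ∀ i j, i ≠ j → B i ∩ B j ⊆ X := by
    rintro i j hij p ⟨hp, hp'⟩
    by_cases hk : i.1.1 = j.1.1
    · obtain ⟨⟨k, s, t⟩, hq⟩ := i
      obtain ⟨⟨k', s', t'⟩, hq'⟩ := j
      obtain rfl : k = k' := hk
      obtain ⟨u, hu, rfl⟩ := hp
      obtain ⟨u', hu', he⟩ := hp'
      obtain rfl : u' = u := gi k (hIcc _ hq' hu') (hIcc _ hq hu) he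
      by_contra hX'
      have l1 : s < u' := lt_of_le_of_ne hu.1 fun h => hX' (h ▸ hq.2.1.2)
      have l2 : u' < t := lt_of_le_of_ne hu.2 fun h => hX' (h ▸ hq.2.2.1.2)
      have l1' : s' < u' := lt_of_le_of_ne hu'.1 fun h => hX' (h ▸ hq'.2.1.2)
      have l2' : u' < t' := lt_of_le_of_ne hu'.2 fun h => hX' (h ▸ hq'.2.2.1.2)
      have es : s = s' := by
        rcases lt_trichotomy s s' with h | h | h
        · exact absurd hq'.2.1.2 (hq.2.2.2 s' ⟨h, l1'.trans l2⟩)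
        · exact h
        · exact absurd hq.2.1.2 (hq'.2.2.2 s ⟨h, l1.trans l2'⟩)
      have et : t = t' := by
        rcases lt_trichotomy t t' with h | h | h
        · exact absurd hq.2.2.1.2 (hq'.2.2.2 t ⟨l1'.trans l2, h⟩)
        · exact h
        · exact absurd hq'.2.2.1.2 (hq.2.2.2 t' ⟨l1.trans l2', h⟩)
      exact hij (by subst es et; rfl)
    · exact hAA _ _ hk ⟨hBA i hp, hBA j hp'⟩
  obtain ⟨l, hl⟩ := exists_polygonal_family hX B z
    (by rintro q (_ | _); exacts [q.2.2.2.1.2, q.2.2.1.2])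
    (fun q h => q.2.1.ne (gi _ q.2.2.1.1 q.2.2.2.1.1 h))
    (fun q => (isCompact_Icc.image (gc _)).isClosed) hBX hBB
    (by
      intro q r hr
      obtain ⟨M, h1, h2, h3, h4, h5⟩ := exists_subarc (gc q.1.1) q.2.1 hr
      refine ⟨M, fun p hp => ?_, h2, h3, by rintro (_ | _); exacts [h5, h4]⟩
      obtain ⟨u, hu, rfl⟩ := h1 hp
      exact ⟨⟨u, Ioo_subset_Icc_self hu, rfl⟩, q.2.2.2.2 u hu⟩)
  have hzl : ∀ i b, z i b ∈ l i := by
    rintro i (_ | _)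
    · exact List.mem_of_mem_getLast? (hl i).2.2.1
    · exact List.mem_of_mem_head? (hl i).2.1
  have main : ∀ k, ∀ t ∈ {t | t ∈ Icc (0 : ℝ) 1 ∧ g k t ∈ X}, 0 < t → ∃ L : List Plane,
      Simple L ∧ L.head? = some (g k 0) ∧ L.getLast? = some (g k t) ∧ 3 ≤ L.length ∧
      (∀ p ∈ supp L, ∃ i : P, i.1.1 = k ∧ i.1.2.2 ≤ t ∧ p ∈ supp (l i)) ∧
      ∀ p ∈ X, p ∈ supp L → p ∈ L := by
    intro k t₀ ht₀
    refine ((hτ k).wellFoundedOn (r := (· < ·))).induction (P := fun t => 0 < t →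
      ∃ L : List Plane, Simple L ∧ L.head? = some (g k 0) ∧ L.getLast? = some (g k t) ∧
      3 ≤ L.length ∧ (∀ p ∈ supp L, ∃ i : P, i.1.1 = k ∧ i.1.2.2 ≤ t ∧ p ∈ supp (l i)) ∧
      ∀ p ∈ X, p ∈ supp L → p ∈ L) ht₀ ?_
    intro t ht ih ht0
    obtain ⟨s, ⟨hs, hst⟩, hmax⟩ := Set.exists_max_image
      {s | s ∈ {t | t ∈ Icc (0 : ℝ) 1 ∧ g k t ∈ X} ∧ s < t} id
      ((hτ k).subset fun s hs => hs.1)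
      ⟨0, ⟨⟨le_rfl, zero_le_one⟩, (g0 k) ▸ hx k⟩, ht0⟩
    let q : P := ⟨(k, s, t), hst, hs, ht, fun u hu hX' => absurd hu.1 (not_lt.2 (hmax u
      ⟨⟨⟨hs.1.1.trans hu.1.le, hu.2.le.trans ht.1.2⟩, hX'⟩, hu.2⟩))⟩
    obtain ⟨q1, q2, q3, q4, q5, q6⟩ := hl q
    have q2 : (l q).head? = some (g k s) := q2
    have q3 : (l q).getLast? = some (g k t) := q3
    have qX : ∀ p ∈ X, p ∈ supp (l q) → p ∈ l q := fun p hp hp' => by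
      obtain ⟨b, rfl⟩ := q5 p hp hp'
      exact hzl q b
    rcases eq_or_lt_of_le hs.1.1 with h0 | h0
    · subst h0
      exact ⟨l q, q1, q2, q3, q4, fun p hp => ⟨q, rfl, le_rfl, hp⟩, qX⟩
    · obtain ⟨L, h1, h2, h3, h4, h5, h6⟩ := ih s hs hst h0
      obtain ⟨m, rfl⟩ := exists_eq_concat h3
      obtain ⟨n, hn⟩ := exists_eq_cons q2
      refine ⟨m ++ g k s :: n, ?_, ?_, ?_, ?_, ?_, ?_⟩
      · rw [simple_append, ← hn]
        refine ⟨h1, q1, ?_⟩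
        rintro p ⟨hp, hp'⟩
        obtain ⟨i, hik, his, hpi⟩ := h5 p hp
        have hiq : i ≠ q := by
          rintro rfl
          exact absurd his (not_le.2 hst)
        have hpX : p ∈ X := (hl i).2.2.2.2.2 q hiq ⟨hpi, hp'⟩
        obtain ⟨b, hb⟩ := q5 p hpX hp'
        obtain ⟨b', hb'⟩ := (hl i).2.2.2.2.1 p hpX hpi
        have hv : ∃ v ∈ Icc (0 : ℝ) 1, v ≤ s ∧ p = g k v := by
          rw [hb', ← hik]
          cases b'
          · exact ⟨_, i.2.2.2.1.1, his, rfl⟩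
          · exact ⟨_, i.2.2.1.1, i.2.1.le.trans his, rfl⟩
        obtain ⟨v, hv, hvs, hpv⟩ := hv
        have hw : ∃ w ∈ Icc (0 : ℝ) 1, s ≤ w ∧ p = g k w := by
          rw [hb]
          cases b
          · exact ⟨t, ht.1, hst.le, rfl⟩
          · exact ⟨s, hs.1, le_rfl, rfl⟩
        obtain ⟨w, hw, hws, hpw⟩ := hw
        have := gi k hv hw (hpv.symm.trans hpw)
        rw [mem_singleton_iff, hpv, le_antisymm hvs (this ▸ hws)]
      · rw [← h2]; exact head?_append_cons _ _
      · rw [getLast?_append_cons, ← hn]; exact q3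
      · rw [hn] at q4; simp at q4 h4 ⊢; omega
      · intro p hp
        rw [supp_append, ← hn] at hp
        rcases hp with hp | hp
        · obtain ⟨i, e1, e2, e3⟩ := h5 p hp
          exact ⟨i, e1, e2.trans hst.le, e3⟩
        · exact ⟨q, rfl, le_rfl, hp⟩
      · intro p hpX hp
        rw [supp_append, ← hn] at hp
        rcases hp with hp | hp
        · have := h6 p hpX hp
          simp at this ⊢; tauto
        · have := qX p hpX hp
          rw [hn] at this
          exact List.mem_append_right _ this
  choose L hL using fun k => main k 1 ⟨⟨zero_le_one, le_rfl⟩, (g1 k) ▸ hy k⟩ one_pos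
  refine ⟨L, fun k => ?_⟩
  obtain ⟨h1, h2, h3, h4, h5, h6⟩ := hL k
  refine ⟨h1, by rw [h2, g0], by rw [h3, g1], h4, fun p hp hp' => ⟨h6 p hp hp', ?_⟩, ?_⟩
  · obtain ⟨i, rfl, -, hpi⟩ := h5 p hp'
    obtain ⟨b, rfl⟩ := (hl i).2.2.2.2.1 p hp hpi
    refine hBA i ?_
    cases b
    · exact mem_image_of_mem _ (right_mem_Icc.2 i.2.1.le)
    · exact mem_image_of_mem _ (left_mem_Icc.2 i.2.1.le)
  · rintro j hkj p ⟨hp, hp'⟩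
    obtain ⟨i, rfl, -, hpi⟩ := h5 p hp
    obtain ⟨i', rfl, -, hpi'⟩ := (hL j).2.2.2.2.1 p hp'
    exact (hl i).2.2.2.2.2 i' (fun h => hkj (by rw [h])) ⟨hpi, hpi'⟩

end Polyline

namespace Polyline
open Filter Topology Metric
open scoped Classical

/-- The number of ordered pairs of distinct members of `K`, counted with weight `n`. -/
noncomputable def total {E : Type} (n : E → E → ℕ) (K : Finset E) : ℕ :=
  ∑ e ∈ K, ∑ f ∈ K.erase e, n e f

lemma total_insert {E : Type} {n : E → E → ℕ} (hn : ∀ e f, n e f = n f e) {K : Finset E} {b : E}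
    (hb : b ∉ K) : total n (insert b K) = total n K + 2 * ∑ g ∈ K, n b g := by
  have : ∀ e ∈ K, ∑ f ∈ (insert b K).erase e, n e f = n b e + ∑ f ∈ K.erase e, n e f := by
    intro e he
    have hbe : b ≠ e := fun h => hb (h ▸ he)
    rw [Finset.erase_insert_of_ne hbe, Finset.sum_insert (fun h => hb (Finset.mem_of_mem_erase h)),
      hn]
  rw [total, Finset.sum_insert hb, Finset.erase_insert hb, Finset.sum_congr rfl this,
    Finset.sum_add_distrib, total]
  ring

lemma total_congr {E : Type} {n m : E → E → ℕ} {K : Finset E}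
    (h : ∀ e ∈ K, ∀ f ∈ K, e ≠ f → n e f ≤ m e f) : total n K ≤ total m K :=
  Finset.sum_le_sum fun e he => Finset.sum_le_sum fun f hf =>
    h e he f (Finset.mem_of_mem_erase hf) (Finset.ne_of_mem_erase hf).symm

lemma two_mul_sum_le_total {E : Type} {n : E → E → ℕ} (hn : ∀ e f, n e f = n f e)
    {K Z : Finset E} (hZ : Z ⊆ K) (h1 : ∀ e ∈ Z, ∀ f ∈ Z, e ≠ f → n e f ≤ 1) :
    2 * ∑ f ∈ Z, ∑ g ∈ K.erase f, n f g ≤ total n K + Z.card * (Z.card - 1) := by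
  have e1 : ∀ f ∈ Z, ∑ g ∈ K.erase f, n f g =
      ∑ g ∈ Z.erase f, n f g + ∑ g ∈ K \ Z, n f g := by
    intro f hf
    rw [← Finset.sum_union]
    · congr 1
      ext g
      simp only [Finset.mem_erase, Finset.mem_union, Finset.mem_sdiff]
      by_cases hg : g ∈ Z
      · have := hZ hg; tauto
      · have : g ≠ f := fun h => hg (h ▸ hf)
        tauto
    · rw [Finset.disjoint_left]
      intro g h1 h2
      exact (Finset.mem_sdiff.1 h2).2 (Finset.mem_of_mem_erase h1)
  have e2 : ∑ f ∈ Z, ∑ g ∈ Z.erase f, n f g ≤ Z.card * (Z.card - 1) := by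
    rw [← smul_eq_mul]
    refine Finset.sum_le_card_nsmul _ _ _ fun f hf => ?_
    rw [← Finset.card_erase_of_mem hf]
    refine (Finset.sum_le_card_nsmul _ _ 1 fun g hg => ?_).trans (by simp)
    exact h1 f hf g (Finset.mem_of_mem_erase hg) (Finset.ne_of_mem_erase hg).symm
  have e3 : ∑ f ∈ Z, ∑ g ∈ K.erase f, n f g + ∑ f ∈ Z, ∑ g ∈ K \ Z, n f g ≤ total n K := by
    rw [total, ← Finset.sdiff_union_of_subset hZ, Finset.sum_union Finset.sdiff_disjoint,
      Finset.sdiff_union_of_subset hZ, Finset.sum_comm (s := Z) (t := K \ Z), add_comm]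
    refine Nat.add_le_add_right (Finset.sum_le_sum fun g hg => ?_) _
    rw [Finset.sum_congr rfl fun f _ => hn f g]
    refine Finset.sum_le_sum_of_subset fun f hf => Finset.mem_erase.2 ⟨?_, hZ hf⟩
    rintro rfl
    exact (Finset.mem_sdiff.1 hg).2 hf
  rw [Finset.sum_congr rfl e1, Finset.sum_add_distrib] at e3 ⊢
  omega

/-- The total of the cardinalities of a family of finite sets indexed by pairs. -/
lemma ncard_eq_total {E α : Type} (K : Finset E) (S : E → E → Set α)
    (hS : ∀ e ∈ K, ∀ f ∈ K, e ≠ f → (S e f).Finite) :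
    {q : (E × E) × α | q.1.1 ∈ K ∧ q.1.2 ∈ K ∧ q.1.1 ≠ q.1.2 ∧ q.2 ∈ S q.1.1 q.1.2}.Finite ∧
    {q : (E × E) × α | q.1.1 ∈ K ∧ q.1.2 ∈ K ∧ q.1.1 ≠ q.1.2 ∧ q.2 ∈ S q.1.1 q.1.2}.ncard =
      total (fun e f => (S e f).ncard) K := by
  set C := {q : (E × E) × α | q.1.1 ∈ K ∧ q.1.2 ∈ K ∧ q.1.1 ≠ q.1.2 ∧ q.2 ∈ S q.1.1 q.1.2}
    with hC
  let T : Finset ((_ : E × E) × α) := K.offDiag.sigma fun p =>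
    if h : (S p.1 p.2).Finite then h.toFinset else ∅
  have hT : ∀ q : (_ : E × E) × α, q ∈ T ↔ (q.1, q.2) ∈ C := by
    rintro ⟨⟨e, f⟩, p⟩
    simp only [T, Finset.mem_sigma, Finset.mem_offDiag, hC, mem_ofPred_eq]
    constructor
    · rintro ⟨⟨h1, h2, h3⟩, h4⟩
      rw [dif_pos (hS e h1 f h2 h3)] at h4
      exact ⟨h1, h2, h3, by simpa using h4⟩
    · rintro ⟨h1, h2, h3, h4⟩
      refine ⟨⟨h1, h2, h3⟩, ?_⟩
      rw [dif_pos (hS e h1 f h2 h3)]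
      simpa using h4
  have hinj : Function.Injective fun q : (_ : E × E) × α => (q.1, q.2) := by
    rintro ⟨a, b⟩ ⟨c, d⟩ h
    simp only [Prod.mk.injEq] at h
    obtain ⟨rfl, rfl⟩ := h
    rfl
  have hCT : C = ((T.image fun q => (q.1, q.2) : Finset _) : Set ((E × E) × α)) := by
    ext ⟨a, p⟩
    simp only [Finset.coe_image, mem_image, Finset.mem_coe, hT]
    constructor
    · intro h
      exact ⟨⟨a, p⟩, h, rfl⟩
    · rintro ⟨q, hq, h⟩
      rwa [← h]
  refine ⟨hCT ▸ Finset.finite_toSet _, ?_⟩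
  rw [hCT, Set.ncard_coe_finset, Finset.card_image_of_injective _ hinj, Finset.card_sigma, total,
    Finset.sum_sigma']
  refine Finset.sum_bij' (fun p _ => (⟨p.1, p.2⟩ : (_ : E) × E)) (fun p _ => (p.1, p.2)) ?_ ?_
    ?_ ?_ ?_
  · rintro ⟨e, f⟩ h
    simp only [Finset.mem_offDiag, Finset.mem_sigma, Finset.mem_erase] at h ⊢
    tauto
  · rintro ⟨e, f⟩ h
    simp only [Finset.mem_offDiag, Finset.mem_sigma, Finset.mem_erase] at h ⊢
    tauto
  · simp
  · simp
  · rintro ⟨e, f⟩ h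
    rw [Finset.mem_offDiag] at h
    rw [dif_pos (hS e h.1 f h.2.1 h.2.2), Set.ncard_eq_toFinset_card _ (hS e h.1 f h.2.1 h.2.2)]

variable {V E : Type}

/-- A drawing of the spanning subgraph of `G` with edge set `K`, its edges being given as
point sets. -/
structure SDraw (G : Multigraph V E) (K : Finset E) where
  pos : V → Plane
  arc : E → Set Plane
  inj : Function.Injective pos
  isArc : ∀ e ∈ K, ∃ x y, G.ends e = s(x, y) ∧ IsArc (arc e) (pos x) (pos y)
  avoid : ∀ e ∈ K, ∀ x, pos x ∈ arc e → x ∈ G.ends e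
  fin : ∀ e ∈ K, ∀ f ∈ K, e ≠ f → (arc e ∩ arc f).Finite

variable {G : Multigraph V E} {K : Finset E}

/-- The number of crossings of two edges. -/
noncomputable def SDraw.cr (D : SDraw G K) (e f : E) : ℕ :=
  ((D.arc e ∩ D.arc f) \ range D.pos).ncard

lemma SDraw.cr_comm (D : SDraw G K) (e f : E) : D.cr e f = D.cr f e := by
  rw [SDraw.cr, inter_comm, SDraw.cr]

lemma isArc_of_continuousOn {g : ℝ → Plane} (hg : ContinuousOn g (Icc 0 1))
    (hi : InjOn g (Icc 0 1)) : IsArc (g '' Icc 0 1) (g 0) (g 1) := by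
  refine ⟨⟨⟨fun t => g t, continuousOn_iff_continuous_domRestrict.1 hg⟩, rfl, rfl⟩, ?_, ?_⟩
  · intro s t h
    exact Subtype.ext (hi s.2 t.2 h)
  · ext p
    constructor
    · rintro ⟨t, rfl⟩
      exact ⟨t, t.2, rfl⟩
    · rintro ⟨t, ht, rfl⟩
      exact ⟨⟨t, ht⟩, rfl⟩

/-- Membership of crossings in terms of point sets. -/
lemma mem_arc_diff_iff {V E : Type} {G : Multigraph V E} (D : G.Drawing) {e : E} {p : Plane} :
    (p ∈ D.arc e '' Icc 0 1 ∧ p ∉ range D.vpos) ↔ ∃ t ∈ Ioo (0 : ℝ) 1, D.arc e t = p := by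
  constructor
  · rintro ⟨⟨t, ht, rfl⟩, h⟩
    obtain ⟨x, y, -, hx, hy⟩ := D.arc_ends e
    refine ⟨t, ⟨lt_of_le_of_ne ht.1 ?_, lt_of_le_of_ne ht.2 ?_⟩, rfl⟩
    · rintro rfl
      exact h ⟨x, hx.symm⟩
    · rintro rfl
      exact h ⟨y, hy.symm⟩
  · rintro ⟨t, ht, rfl⟩
    refine ⟨mem_image_of_mem _ (Ioo_subset_Icc_self ht), ?_⟩
    rintro ⟨x, hx⟩
    exact D.arc_avoid e t ht x hx.symm

lemma crossSet_image {V E : Type} {G : Multigraph V E} (D : G.Drawing) :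
    (fun q : (E × E) × ℝ × ℝ => (q.1, D.arc q.1.1 q.2.1)) '' D.CrossSet =
      {q : (E × E) × Plane | q.1.1 ≠ q.1.2 ∧ q.2 ∈
        (D.arc q.1.1 '' Icc 0 1 ∩ D.arc q.1.2 '' Icc 0 1) \ range D.vpos} := by
  ext ⟨⟨e, f⟩, p⟩
  constructor
  · rintro ⟨⟨⟨e', f'⟩, s, t⟩, ⟨h1, h2, h3, h4⟩, h⟩
    simp only [Prod.mk.injEq] at h h4
    obtain ⟨⟨rfl, rfl⟩, rfl⟩ := h
    have a1 := (mem_arc_diff_iff D (e := e')).2 ⟨s, h2, rfl⟩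
    have a2 := (mem_arc_diff_iff D (e := f')).2 ⟨t, h3, rfl⟩
    exact ⟨h1, ⟨a1.1, by simp only; rw [h4]; exact a2.1⟩, a1.2⟩
  · rintro ⟨h1, ⟨h2, h3⟩, h4⟩
    obtain ⟨s, hs, e1⟩ := (mem_arc_diff_iff D).1 ⟨h2, h4⟩
    obtain ⟨t, ht, e2⟩ := (mem_arc_diff_iff D).1 ⟨h3, h4⟩
    exact ⟨((e, f), s, t), ⟨h1, hs, ht, e1.trans e2.symm⟩, by simpa using e1⟩

lemma crossSet_injOn {V E : Type} {G : Multigraph V E} (D : G.Drawing) :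
    InjOn (fun q : (E × E) × ℝ × ℝ => (q.1, D.arc q.1.1 q.2.1)) D.CrossSet := by
  rintro ⟨⟨e, f⟩, s, t⟩ ⟨h1, h2, h3, h4⟩ ⟨⟨e', f'⟩, s', t'⟩ ⟨h1', h2', h3', h4'⟩ h
  simp only [Prod.mk.injEq] at h h4 h4' h2 h2' h3 h3'
  obtain ⟨⟨rfl, rfl⟩, h⟩ := h
  have es := D.arc_inj e (Ioo_subset_Icc_self h2) (Ioo_subset_Icc_self h2') h
  have et := D.arc_inj f (Ioo_subset_Icc_self h3) (Ioo_subset_Icc_self h3') (by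
    rw [← h4, ← h4', h])
  rw [es, et]

lemma exists_sDraw_delete [Fintype E] {e₀ : E} (D : (G.delete {e₀}).GoodDrawing) :
    ∃ D' : SDraw G (Finset.univ.erase e₀), total D'.cr (Finset.univ.erase e₀) ≤
      D.CrossSet.ncard := by
  let A : E → Set Plane := fun e => if h : e ∉ ({e₀} : Set E) then D.arc ⟨e, h⟩ '' Icc 0 1 else ∅
  have hA : ∀ e (h : e ∉ ({e₀} : Set E)), A e = D.arc ⟨e, h⟩ '' Icc 0 1 := fun e h => dif_pos h
  have hK : ∀ e ∈ Finset.univ.erase e₀, e ∉ ({e₀} : Set E) := by simp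
  set C := {q : (E × E) × Plane | q.1.1 ∈ Finset.univ.erase e₀ ∧ q.1.2 ∈ Finset.univ.erase e₀ ∧
    q.1.1 ≠ q.1.2 ∧ q.2 ∈ (A q.1.1 ∩ A q.1.2) \ range D.vpos} with hC
  have hCC : C ⊆ (fun q : ({e : E // e ∉ ({e₀} : Set E)} × {e : E // e ∉ ({e₀} : Set E)}) × Plane =>
      ((q.1.1.1, q.1.2.1), q.2)) ''
      ((fun q => (q.1, D.arc q.1.1 q.2.1)) '' D.CrossSet) := by
    rw [crossSet_image]
    rintro ⟨⟨e, f⟩, p⟩ ⟨h1, h2, h3, h4⟩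
    simp only at h1 h2 h3 h4
    rw [hA e (hK e h1), hA f (hK f h2)] at h4
    exact ⟨((⟨e, hK e h1⟩, ⟨f, hK f h2⟩), p), ⟨by simpa using h3, h4⟩, rfl⟩
  have hfin : C.Finite := ((D.finCross.image _).image _).subset hCC
  have fin0 : ∀ e ∈ Finset.univ.erase e₀, ∀ f ∈ Finset.univ.erase e₀, e ≠ f →
      ((A e ∩ A f) \ range D.vpos).Finite := by
    intro e he f hf hef
    refine (hfin.image Prod.snd).subset fun p hp => ⟨((e, f), p), ⟨he, hf, hef, hp⟩, rfl⟩
  have avoid : ∀ e ∈ Finset.univ.erase e₀, ∀ x, D.vpos x ∈ A e → x ∈ G.ends e := by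
    intro e he x hx
    rw [hA e (hK e he)] at hx
    obtain ⟨t, ht, htx⟩ := hx
    obtain ⟨y, z, hyz, hy, hz⟩ := D.arc_ends ⟨e, hK e he⟩
    have hyz : G.ends e = s(y, z) := hyz
    rw [hyz, Sym2.mem_iff]
    rcases eq_or_lt_of_le ht.1 with h | h
    · subst h
      exact Or.inl (D.vpos_inj (htx.symm.trans hy))
    rcases eq_or_lt_of_le ht.2 with h' | h'
    · subst h'
      exact Or.inr (D.vpos_inj (htx.symm.trans hz))
    · exact absurd htx (D.arc_avoid _ t ⟨h, h'⟩ x)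
  let D' : SDraw G (Finset.univ.erase e₀) :=
    { pos := D.vpos
      arc := A
      inj := D.vpos_inj
      isArc := by
        intro e he
        rw [hA e (hK e he)]
        obtain ⟨x, y, h, h0, h1⟩ := D.arc_ends ⟨e, hK e he⟩
        refine ⟨x, y, h, ?_⟩
        rw [← h0, ← h1]
        exact isArc_of_continuousOn (D.arc_cont _) (D.arc_inj _)
      avoid := avoid
      fin := by
        intro e he f hf hef
        have : (D.vpos '' {x | x ∈ G.ends e}).Finite := by
          refine Set.Finite.image _ ?_
          obtain ⟨y, z, hyz⟩ : ∃ y z, G.ends e = s(y, z) := by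
            induction h : G.ends e with | _ y z => exact ⟨y, z, rfl⟩
          rw [hyz]
          refine (Set.toFinite {y, z}).subset fun x hx => by simpa using hx
        refine ((fin0 e he f hf hef).union this).subset fun p hp => ?_
        by_cases h : p ∈ range D.vpos
        · obtain ⟨x, rfl⟩ := h
          exact Or.inr ⟨x, avoid e he x hp.1, rfl⟩
        · exact Or.inl ⟨hp, h⟩ }
  refine ⟨D', ?_⟩
  have := (ncard_eq_total (Finset.univ.erase e₀) (fun e f => (A e ∩ A f) \ range D.vpos) fin0).2
  change total (fun e f => ((A e ∩ A f) \ range D.vpos).ncard) _ ≤ _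
  rw [← this]
  refine (Set.ncard_le_ncard hCC ((D.finCross.image _).image _)).trans ?_
  exact (Set.ncard_image_le (D.finCross.image _)).trans (Set.ncard_image_le D.finCross)

lemma crNum_le [Fintype E] (D : SDraw G Finset.univ) :
    G.crNum ≤ total D.cr Finset.univ / 2 := by
  choose x y hxy hA using fun e => D.isArc e (Finset.mem_univ e)
  choose g gc gi gA g0 g1 using fun e => (hA e).exists_param
  have e2 := ncard_eq_total Finset.univ (fun e f => (D.arc e ∩ D.arc f) \ range D.pos)
    (fun e he f hf hef => (D.fin e he f hf hef).subset sdiff_subset)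
  let D₁ : G.Drawing :=
    { vpos := D.pos
      arc := g
      vpos_inj := D.inj
      arc_cont := fun e => (gc e).continuousOn
      arc_inj := gi
      arc_ends := fun e => ⟨x e, y e, hxy e, g0 e, g1 e⟩
      arc_avoid := by
        intro e t ht z hz
        have := D.avoid e (Finset.mem_univ e) z (by
          rw [← gA, ← hz]; exact mem_image_of_mem _ (Ioo_subset_Icc_self ht))
        rw [hxy, Sym2.mem_iff] at this
        rcases this with rfl | rfl
        · exact ht.1.ne' (gi e (Ioo_subset_Icc_self ht) (by simp) (hz.trans (g0 e).symm))
        · exact ht.2.ne (gi e (Ioo_subset_Icc_self ht) (by simp) (hz.trans (g1 e).symm)) }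
  have e1 := crossSet_image D₁
  have e3 : {q : (E × E) × Plane | q.1.1 ≠ q.1.2 ∧ q.2 ∈
        (D₁.arc q.1.1 '' Icc 0 1 ∩ D₁.arc q.1.2 '' Icc 0 1) \ range D₁.vpos} =
      {q : (E × E) × Plane | q.1.1 ∈ Finset.univ ∧ q.1.2 ∈ Finset.univ ∧ q.1.1 ≠ q.1.2 ∧
        q.2 ∈ (D.arc q.1.1 ∩ D.arc q.1.2) \ range D.pos} := by
    ext q
    simp only [Finset.mem_univ, true_and, mem_ofPred_eq]
    change _ ∧ q.2 ∈ (g q.1.1 '' Icc 0 1 ∩ g q.1.2 '' Icc 0 1) \ range D.pos ↔ _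
    rw [gA, gA]
  rw [e3] at e1
  have hfin : D₁.CrossSet.Finite :=
    Set.Finite.of_finite_image (e1 ▸ e2.1) (crossSet_injOn D₁)
  have h0 : G.crNum ≤ (⟨D₁, hfin⟩ : G.GoodDrawing).crossings := Nat.sInf_le ⟨_, rfl⟩
  refine h0.trans ?_
  change D₁.CrossSet.ncard / 2 ≤ _
  rw [← (crossSet_injOn D₁).ncard_image, e1, e2.2]
  exact le_rfl

end Polyline

namespace Polyline
open Filter Topology Metric
open scoped Classical

variable {V E : Type}

/-- A polygonal drawing of the spanning subgraph of `G` with edge set `K`, in which all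
common points of edges are corners. -/
structure PLDraw (G : Multigraph V E) (K : Finset E) where
  pos : V → Plane
  poly : E → List Plane
  inj : Function.Injective pos
  simple : ∀ e ∈ K, Simple (poly e)
  len : ∀ e ∈ K, 3 ≤ (poly e).length
  ends : ∀ e ∈ K, ∃ x y, G.ends e = s(x, y) ∧ (poly e).head? = some (pos x) ∧
    (poly e).getLast? = some (pos y)
  avoid : ∀ e ∈ K, ∀ x, pos x ∈ supp (poly e) → x ∈ G.ends e
  meet : ∀ e ∈ K, ∀ f ∈ K, e ≠ f → ∀ p ∈ supp (poly e), p ∈ supp (poly f) → p ∈ poly e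

variable {G : Multigraph V E} {K : Finset E}

lemma Simple.ends_ne {l : List Plane} {x y : Plane} (h : Simple l) (hl : 2 ≤ l.length)
    (hx : l.head? = some x) (hy : l.getLast? = some y) : x ≠ y := by
  rintro rfl
  obtain ⟨m, rfl⟩ := exists_eq_cons hx
  obtain ⟨m', hm⟩ := exists_eq_concat hy
  cases m' with
  | nil => simp_all
  | cons a m' =>
    obtain ⟨rfl, rfl⟩ : x = a ∧ m = m' ++ [x] := by simpa using hm
    have := h.nodup
    simp at this

/-- A polygonal drawing as a drawing. -/
def PLDraw.toSDraw (D : PLDraw G K) : SDraw G K where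
  pos := D.pos
  arc e := supp (D.poly e)
  inj := D.inj
  isArc e he := by
    obtain ⟨x, y, h, hx, hy⟩ := D.ends e he
    exact ⟨x, y, h, (D.simple e he).isArc hx hy
      ((D.simple e he).ends_ne (by have := D.len e he; omega) hx hy)⟩
  avoid := D.avoid
  fin e he f hf hef := (D.poly e).finite_toSet.subset fun p hp => D.meet e he f hf hef p hp.1 hp.2

/-- The number of crossings of two edges. -/
noncomputable def PLDraw.cr (D : PLDraw G K) (e f : E) : ℕ := D.toSDraw.cr e f

lemma PLDraw.cr_comm (D : PLDraw G K) (e f : E) : D.cr e f = D.cr f e := D.toSDraw.cr_comm e f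

/-- Every drawing can be replaced by a polygonal one without more crossings. -/
theorem SDraw.exists_pLDraw [Finite V] (D : SDraw G K) :
    ∃ D' : PLDraw G K, total D'.cr K ≤ total D.cr K := by
  choose x y hxy hA using D.isArc
  let X : Set Plane := range D.pos ∪ ⋃ p ∈ K.offDiag, D.arc p.1 ∩ D.arc p.2
  have hX : X.Finite := by
    refine (finite_range _).union (Set.Finite.biUnion (Finset.finite_toSet _) ?_)
    intro p hp
    have hp : p ∈ K.offDiag := hp
    rw [Finset.mem_offDiag] at hp
    exact D.fin _ hp.1 _ hp.2.1 hp.2.2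
  have hXX : ∀ e ∈ K, ∀ f ∈ K, e ≠ f → D.arc e ∩ D.arc f ⊆ X := by
    intro e he f hf hef p hp
    exact Or.inr (mem_iUnion₂.2 ⟨(e, f), Finset.mem_offDiag.2 ⟨he, hf, hef⟩, hp⟩)
  obtain ⟨L, hL⟩ := exists_polygonal_arcs (κ := K) hX (x := fun k => D.pos (x k k.2))
    (y := fun k => D.pos (y k k.2)) (A := fun k => D.arc k) (fun k => hA k k.2)
    (fun k => Or.inl ⟨_, rfl⟩) (fun k => Or.inl ⟨_, rfl⟩)
    (fun k k' h => hXX k k.2 k' k'.2 fun h' => h (Subtype.ext h'))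
  let M : E → List Plane := fun e => if h : e ∈ K then L ⟨e, h⟩ else []
  have hM : ∀ e (h : e ∈ K), M e = L ⟨e, h⟩ := fun e h => dif_pos h
  have hpt : ∀ e ∈ K, ∀ p ∈ X, p ∈ supp (M e) → p ∈ M e ∧ p ∈ D.arc e := by
    intro e he p hp hp'
    rw [hM e he] at hp' ⊢
    exact (hL ⟨e, he⟩).2.2.2.2.1 p hp hp'
  have hmm : ∀ e ∈ K, ∀ f ∈ K, e ≠ f → ∀ p ∈ supp (M e), p ∈ supp (M f) → p ∈ X := by
    intro e he f hf hef p hp hp'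
    rw [hM e he] at hp
    rw [hM f hf] at hp'
    exact (hL ⟨e, he⟩).2.2.2.2.2 ⟨f, hf⟩ (fun h => hef (congrArg Subtype.val h)) ⟨hp, hp'⟩
  refine ⟨{ pos := D.pos, poly := M, inj := D.inj
            simple := fun e he => by rw [hM e he]; exact (hL ⟨e, he⟩).1
            len := fun e he => by rw [hM e he]; exact (hL ⟨e, he⟩).2.2.2.1
            ends := fun e he => ⟨x e he, y e he, hxy e he, by rw [hM e he]; exact (hL ⟨e, he⟩).2.1,
              by rw [hM e he]; exact (hL ⟨e, he⟩).2.2.1⟩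
            avoid := fun e he z hz => D.avoid e he z (hpt e he _ (Or.inl ⟨z, rfl⟩) hz).2
            meet := fun e he f hf hef p hp hp' =>
              (hpt e he p (hmm e he f hf hef p hp hp') hp).1 }, ?_⟩
  refine total_congr fun e he f hf hef => ?_
  refine Set.ncard_le_ncard ?_ ((D.fin e he f hf hef).subset sdiff_subset)
  rintro p ⟨⟨hp, hp'⟩, hr⟩
  have hpX := hmm e he f hf hef p hp hp'
  exact ⟨⟨(hpt e he p hpX hp).2, (hpt f hf p hpX hp').2⟩, hr⟩

/-- The segments of the edges in a set. -/
noncomputable def PLDraw.segments (D : PLDraw G K) (K' : Finset E) : Finset (Sym2 Plane) :=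
  K'.biUnion fun e => (segs (D.poly e)).toFinset

lemma PLDraw.mem_segments (D : PLDraw G K) {K' : Finset E} {s : Sym2 Plane} :
    s ∈ D.segments K' ↔ ∃ e ∈ K', s ∈ segs (D.poly e) := by
  simp [segments]

lemma PLDraw.segments_disjoint (D : PLDraw G K) {e f : E} (he : e ∈ K) (hf : f ∈ K) (hef : e ≠ f)
    {s : Sym2 Plane} (hs : s ∈ segs (D.poly e)) (hs' : s ∈ segs (D.poly f)) : False := by
  induction s with | _ a b =>
  have hne := (D.simple e he).ne_of_mem_segs hs
  have hm : midpoint ℝ a b ∈ segSet s(a, b) := by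
    rw [segSet_mk]; exact midpoint_mem_segment a b
  have h1 := D.meet e he f hf hef _ (segSet_subset_supp hs hm) (segSet_subset_supp hs' hm)
  have h2 := (D.simple e he).mem_seg h1 hs hm
  rw [Sym2.mem_iff, midpoint_eq_left_iff, midpoint_eq_right_iff] at h2
  tauto

lemma PLDraw.segments_plane (D : PLDraw G K) {s t : Sym2 Plane} (hs : s ∈ D.segments K)
    (ht : t ∈ D.segments K) (hst : s ≠ t) {x : Plane} (hx : x ∈ segSet s) (hx' : x ∈ segSet t) :
    x ∈ s ∧ x ∈ t := by
  obtain ⟨e, he, hs⟩ := D.mem_segments.1 hs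
  obtain ⟨f, hf, ht⟩ := D.mem_segments.1 ht
  have hse := D.simple e he
  have hsf := D.simple f hf
  by_cases hef : e = f
  · subst hef
    have := hse.seg_inter hs ht hst hx hx'
    exact ⟨hse.mem_seg this hs hx, hse.mem_seg this ht hx'⟩
  · have h1 := segSet_subset_supp hs hx
    have h2 := segSet_subset_supp ht hx'
    exact ⟨hse.mem_seg (D.meet e he f hf hef x h1 h2) hs hx,
      hsf.mem_seg (D.meet f hf e he (Ne.symm hef) x h2 h1) ht hx'⟩

lemma ncard_biUnion_le {ι α : Type*} (s : Finset ι) (A : ι → Set α) :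
    (⋃ i ∈ s, A i).ncard ≤ ∑ i ∈ s, (A i).ncard := by
  induction s using Finset.induction_on with
  | empty => simp
  | insert a s ha ih =>
    rw [Finset.set_biUnion_insert, Finset.sum_insert ha]
    exact (Set.ncard_union_le _ _).trans (Nat.add_le_add_left ih _)

/-- An edge can be drawn close to a given walk in a polygonal drawing. -/
theorem PLDraw.exists_insert [Finite V] (D : PLDraw G K) {K' : Finset E} (hK : K' ⊆ K) {β : E}
    (hβ : β ∉ K') {x y : V} (hxy : G.ends β = s(x, y)) (hne : x ≠ y) {W : List Plane}
    (hW : 3 ≤ W.length) (hx : W.head? = some (D.pos x)) (hy : W.getLast? = some (D.pos y))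
    (hS : ∀ s ∈ segs W, s ∈ D.segments K) (hc : (segs W).Nodup) :
    ∃ D' : SDraw G (insert β K'),
      total D'.cr (insert β K') ≤ total D.cr K' + cost (D.segments K') W := by
  have hsub : D.segments K' ⊆ D.segments K := Finset.biUnion_subset_biUnion_of_subset_left _ hK
  obtain ⟨l, l1, l2, l3, l4, l5⟩ := exists_route hW hx hy hsub (finite_range D.pos).toFinset
    (fun a b hab => by
      obtain ⟨e, he, h⟩ := D.mem_segments.1 hab
      exact (D.simple e he).ne_of_mem_segs h)
    (fun s hs t ht hst z hz hz' => D.segments_plane hs ht hst hz hz') hS hc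
  obtain ⟨m, m1, m2, m3, m4⟩ := exists_simple l1 l2
  have hcov : ∀ g ∈ K', (supp m ∩ supp (D.poly g)) \ {D.pos x, D.pos y} ⊆
      ⋃ s ∈ (segs (D.poly g)).toFinset, (supp l \ {D.pos x, D.pos y}) ∩ segSet s := by
    rintro g hg p ⟨⟨hp, hp'⟩, hpn⟩
    obtain ⟨s, hs, hps⟩ := exists_segs_of_mem_supp (by have := D.len g (hK hg); omega) hp'
    exact mem_iUnion₂.2 ⟨s, List.mem_toFinset.2 hs, ⟨m4 hp, hpn⟩, hps⟩
  have hfin : ∀ g ∈ K', (⋃ s ∈ (segs (D.poly g)).toFinset,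
      (supp l \ {D.pos x, D.pos y}) ∩ segSet s).Finite := by
    intro g hg
    refine Set.Finite.biUnion (Finset.finite_toSet _) fun s hs => l4 s ?_
    exact D.mem_segments.2 ⟨g, hK hg, List.mem_toFinset.1 hs⟩
  have hfinβ : ∀ g ∈ K', (supp m ∩ supp (D.poly g)).Finite := by
    intro g hg
    refine (((hfin g hg).subset (hcov g hg)).union (Set.toFinite {D.pos x, D.pos y})).subset ?_
    intro p hp
    by_cases h : p ∈ ({D.pos x, D.pos y} : Set Plane)
    · exact Or.inr h
    · exact Or.inl ⟨hp, h⟩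
  let A : E → Set Plane := fun e => if e = β then supp m else supp (D.poly e)
  have hAβ : A β = supp m := if_pos rfl
  have hA : ∀ e ∈ K', A e = supp (D.poly e) := fun e he =>
    if_neg fun h : e = β => hβ (h ▸ he)
  let D' : SDraw G (insert β K') :=
    { pos := D.pos
      arc := A
      inj := D.inj
      isArc := by
        intro e he
        rcases Finset.mem_insert.1 he with rfl | he
        · rw [hAβ]
          exact ⟨x, y, hxy, m1.isArc m2 m3 fun h => hne (D.inj h)⟩
        · rw [hA e he]
          exact D.toSDraw.isArc e (hK he)
      avoid := by
        intro e he z hz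
        rcases Finset.mem_insert.1 he with rfl | he
        · rw [hAβ] at hz
          rw [hxy, Sym2.mem_iff]
          exact (l3 _ (by simp) (m4 hz)).imp (fun h => D.inj h) (fun h => D.inj h)
        · rw [hA e he] at hz
          exact D.avoid e (hK he) z hz
      fin := by
        intro e he f hf hef
        rcases Finset.mem_insert.1 he with h | h <;> rcases Finset.mem_insert.1 hf with h' | h'
        · exact absurd (h.trans h'.symm) hef
        · rw [h, hAβ, hA f h']; exact hfinβ f h'
        · rw [h', hAβ, hA e h, inter_comm]; exact hfinβ e h
        · rw [hA e h, hA f h']; exact D.toSDraw.fin e (hK h) f (hK h') hef }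
  refine ⟨D', ?_⟩
  rw [total_insert D'.cr_comm hβ]
  refine Nat.add_le_add (total_congr fun e he f hf _ => ?_) ?_
  · change ((A e ∩ A f) \ range D.pos).ncard ≤ _
    rw [hA e he, hA f hf]
    exact le_rfl
  · refine le_trans (Nat.mul_le_mul_left 2 ?_) l5
    rw [PLDraw.segments, Finset.sum_biUnion]
    · refine Finset.sum_le_sum fun g hg => ?_
      refine le_trans (Set.ncard_le_ncard ?_ (hfin g hg)) (ncard_biUnion_le _ _)
      refine Subset.trans ?_ (hcov g hg)
      change (A β ∩ A g) \ range D.pos ⊆ _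
      rw [hAβ, hA g hg]
      refine sdiff_subset_sdiff_right ?_
      rintro p (rfl | rfl) <;> exact mem_range_self _
    · intro e he f hf hef
      rw [Function.onFun, Finset.disjoint_left]
      intro s hs hs'
      exact D.segments_disjoint (hK he) (hK hf) hef (List.mem_toFinset.1 hs)
        (List.mem_toFinset.1 hs')

end Polyline

namespace Polyline
open scoped Classical

variable {V E : Type} {G : Multigraph V E} {K K' : Finset E}

lemma cost_le {F : Finset (Sym2 Plane)} {μ : Plane → ℕ} {y : Plane} : ∀ {M : List Plane} {x : Plane},
    (∀ l₁ b a c l₂, x :: (M ++ [y]) = l₁ ++ b :: a :: c :: l₂ → wt F b a c ≤ μ a) →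
    cost F (x :: (M ++ [y])) ≤ (M.map μ).sum
  | [], x, _ => by simp [cost]
  | [a], x, h => by
    have := h [] x a y [] rfl
    simpa [cost] using this
  | a :: c :: M, x, h => by
    have h1 := h [] x a c (M ++ [y]) rfl
    have h2 := cost_le (F := F) (μ := μ) (y := y) (M := c :: M) (x := a) fun l₁ b a' c' l₂ hl =>
      h (x :: l₁) b a' c' l₂ (congrArg (x :: ·) hl)
    have h3 : cost F (x :: (a :: c :: M ++ [y])) = wt F x a c + cost F (a :: (c :: M ++ [y])) := rfl
    rw [h3, List.map_cons, List.sum_cons]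
    exact Nat.add_le_add h1 h2

lemma cost_split (F : Finset (Sym2 Plane)) (p : Plane) {l₁ l₂ : List Plane} (h₁ : l₁ ≠ [])
    (h₂ : l₂ ≠ []) : ∃ l₁' b c l₂', l₁ = l₁' ++ [b] ∧ l₂ = c :: l₂' ∧
      cost F (l₁ ++ p :: l₂) = cost F (l₁ ++ [p]) + wt F b p c + cost F (p :: l₂) := by
  obtain ⟨c, l₂', rfl⟩ := List.exists_cons_of_ne_nil h₂
  obtain ⟨l₁', b, rfl⟩ := (List.eq_nil_or_concat l₁).resolve_left h₁
  refine ⟨l₁', b, c, l₂', by simp, rfl, ?_⟩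
  have := cost_append F b p c l₂' l₁'
  simpa using this

/-- The number of edges in a set passing through a given corner. -/
noncomputable def PLDraw.deg (D : PLDraw G K) (K' : Finset E) (a : Plane) : ℕ :=
  (K'.filter fun h => a ∈ D.poly h).card

lemma PLDraw.deg_mono (D : PLDraw G K) {K₁ K₂ : Finset E} (h : K₁ ⊆ K₂) (a : Plane) :
    D.deg K₁ a ≤ D.deg K₂ a :=
  Finset.card_le_card (Finset.filter_subset_filter _ h)

/-- Either orientation of an edge. -/
def PLDraw.Orient (D : PLDraw G K) (e : E) (l : List Plane) : Prop :=
  l = D.poly e ∨ l = (D.poly e).reverse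

section Orient
variable {D : PLDraw G K} {e : E} {l : List Plane}

lemma PLDraw.Orient.simple (h : D.Orient e l) (he : e ∈ K) : Simple l := by
  rcases h with rfl | rfl
  exacts [D.simple e he, (D.simple e he).reverse]

lemma PLDraw.Orient.reverse (h : D.Orient e l) : D.Orient e l.reverse := by
  rcases h with rfl | rfl
  · exact Or.inr rfl
  · exact Or.inl (List.reverse_reverse _)

lemma PLDraw.Orient.mem_segs (h : D.Orient e l) {s : Sym2 Plane} :
    s ∈ segs l ↔ s ∈ segs (D.poly e) := by
  rcases h with rfl | rfl
  · rfl
  · simp [segs_reverse]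

lemma PLDraw.Orient.mem (h : D.Orient e l) {p : Plane} : p ∈ l ↔ p ∈ D.poly e := by
  rcases h with rfl | rfl
  · rfl
  · simp

lemma PLDraw.Orient.ends (h : D.Orient e l) (he : e ∈ K) : ∃ x y, G.ends e = s(x, y) ∧
    l.head? = some (D.pos x) ∧ l.getLast? = some (D.pos y) := by
  obtain ⟨x, y, hxy, hx, hy⟩ := D.ends e he
  rcases h with rfl | rfl
  · exact ⟨x, y, hxy, hx, hy⟩
  · exact ⟨y, x, by rw [hxy, Sym2.eq_swap], by simpa using hy, by simpa using hx⟩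

lemma PLDraw.Orient.length (h : D.Orient e l) (he : e ∈ K) : 3 ≤ l.length := by
  rcases h with rfl | rfl
  · exact D.len e he
  · simpa using D.len e he

end Orient

lemma PLDraw.card_spokes_biUnion_le (D : PLDraw G K) (hK : K' ⊆ K) (a : Plane) :
    ((K'.filter fun h => a ∈ D.poly h).biUnion fun h => spokes (D.poly h) a).card ≤
      2 * D.deg K' a := by
  refine Finset.card_biUnion_le.trans ?_
  rw [mul_comm, PLDraw.deg, ← smul_eq_mul]
  exact Finset.sum_le_card_nsmul _ _ 2 fun h hh =>
    card_spokes_le (D.simple h (hK (Finset.mem_filter.1 hh).1)) a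

lemma PLDraw.filter_segments_subset (D : PLDraw G K) (a : Plane) :
    ((D.segments K').filter fun s => a ∈ s) ⊆
      (K'.filter fun h => a ∈ D.poly h).biUnion fun h => spokes (D.poly h) a := by
  intro s hs
  obtain ⟨hs, ha⟩ := Finset.mem_filter.1 hs
  obtain ⟨e, he, hs⟩ := D.mem_segments.1 hs
  exact Finset.mem_biUnion.2 ⟨e, Finset.mem_filter.2 ⟨he, mem_of_mem_segs hs ha⟩,
    mem_spokes.2 ⟨hs, ha⟩⟩

lemma PLDraw.wt_le (D : PLDraw G K) (hK : K' ⊆ K) {e : E} (he : e ∈ K) {l : List Plane}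
    (hl : D.Orient e l) {l₁ l₂ : List Plane} {b a c : Plane} (h : l = l₁ ++ b :: a :: c :: l₂) :
    wt (D.segments K') b a c ≤ 2 * D.deg (K'.erase e) a := by
  refine le_trans (Finset.card_le_card ?_)
    (D.card_spokes_biUnion_le ((Finset.erase_subset e K').trans hK) a)
  intro s hs
  obtain ⟨hs, ha, h1, h2⟩ := Finset.mem_filter.1 hs
  obtain ⟨f, hf, hs⟩ := D.mem_segments.1 hs
  have hfe : f ≠ e := by
    rintro rfl
    have hsim := hl.simple he
    rw [← hl.mem_segs, h] at hs
    rw [h] at hsim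
    exact (eq_or_eq_of_mem_spokes hsim hs ha).elim h1 h2
  exact Finset.mem_biUnion.2 ⟨f, Finset.mem_filter.2 ⟨Finset.mem_erase.2 ⟨hfe, hf⟩,
    mem_of_mem_segs hs ha⟩, mem_spokes.2 ⟨hs, ha⟩⟩

lemma PLDraw.cost_infix_le (D : PLDraw G K) (hK : K' ⊆ K) {e : E} (he : e ∈ K) {l : List Plane}
    (hl : D.Orient e l) {l₁ M l₂ : List Plane} {x y : Plane}
    (h : l = l₁ ++ (x :: (M ++ [y])) ++ l₂) :
    cost (D.segments K') (x :: (M ++ [y])) ≤ (M.map fun a => 2 * D.deg (K'.erase e) a).sum := by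
  refine cost_le fun m₁ b a c m₂ hm => ?_
  refine D.wt_le hK he hl (l₁ := l₁ ++ m₁) (l₂ := m₂ ++ l₂) ?_
  rw [h, hm]
  simp

lemma PLDraw.wt_turn_lt (D : PLDraw G K) (hK : K' ⊆ K) {e : E} (he : e ∈ K') {p b c : Plane}
    (hc : s(p, c) ∈ segs (D.poly e)) :
    wt (D.segments K') b p c + 1 ≤ 2 * D.deg K' p := by
  have hmem : s(p, c) ∉ (D.segments K').filter fun s => p ∈ s ∧ s ≠ s(b, p) ∧ s ≠ s(p, c) := by
    simp
  rw [wt, ← Finset.card_insert_of_notMem hmem]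
  refine le_trans (Finset.card_le_card ?_) (D.card_spokes_biUnion_le hK p)
  refine Subset.trans (Finset.insert_subset ?_ ?_) (D.filter_segments_subset p)
  · exact Finset.mem_filter.2 ⟨D.mem_segments.2 ⟨e, he, hc⟩, by simp⟩
  · intro s hs
    obtain ⟨hs, ha, -⟩ := Finset.mem_filter.1 hs
    exact Finset.mem_filter.2 ⟨hs, ha⟩

lemma sum_card_filter_eq {ι α : Type*} (s : Finset ι) (R : α → ι → Prop) (l : List α) :
    ∑ i ∈ s, (l.filter fun a => R a i).length = (l.map fun a => (s.filter (R a)).card).sum := by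
  induction l with
  | nil => simp
  | cons a l ih =>
    rw [List.map_cons, List.sum_cons, ← ih, Finset.card_filter, ← Finset.sum_add_distrib]
    refine Finset.sum_congr rfl fun i _ => ?_
    rw [List.filter_cons]
    by_cases h : R a i <;> simp [h, add_comm]

/-- The number of crossings of an edge with other edges, counted along that edge. -/
lemma PLDraw.sum_cr (D : PLDraw G K) (hK : K' ⊆ K) {e : E} (he : e ∈ K) (heK : e ∉ K')
    {l : List Plane} (hl : D.Orient e l) {M : List Plane} {x y : Plane} (h : l = x :: (M ++ [y])) :
    ∑ f ∈ K', D.cr e f = (M.map fun a => D.deg K' a).sum := by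
  unfold PLDraw.deg
  refine Eq.trans ?_ ((sum_card_filter_eq K' (fun a f => a ∈ D.poly f) M).trans (by congr!))
  refine Finset.sum_congr rfl fun f hf => ?_
  obtain ⟨u, v, huv, hu, hv⟩ := hl.ends he
  rw [h] at hu hv
  have hu : x = D.pos u := by simpa using hu
  have hv : y = D.pos v := by
    rw [← List.cons_append, List.getLast?_append] at hv
    simpa using hv
  have hnd := (hl.simple he).nodup
  rw [h, List.nodup_cons, List.nodup_append] at hnd
  obtain ⟨n1, n2, -, n3⟩ := hnd
  have hef : e ≠ f := fun h => heK (h ▸ hf)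
  have : (D.toSDraw.arc e ∩ D.toSDraw.arc f) \ range D.toSDraw.pos =
      ((M.filter fun a => a ∈ D.poly f).toFinset : Set Plane) := by
    ext p
    simp only [List.coe_toFinset, List.mem_filter, decide_eq_true_eq, mem_ofPred_eq]
    constructor
    · rintro ⟨⟨h1, h2⟩, h3⟩
      have h4 := D.meet e he f (hK hf) hef p h1 h2
      have h5 := D.meet f (hK hf) e he hef.symm p h2 h1
      rw [← hl.mem, h] at h4
      simp only [List.mem_cons, List.mem_append, List.not_mem_nil, or_false] at h4
      rcases h4 with rfl | h4 | rfl
      · exact absurd ⟨u, hu.symm⟩ h3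
      · exact ⟨h4, h5⟩
      · exact absurd ⟨v, hv.symm⟩ h3
    · rintro ⟨h1, h2⟩
      have h3 : p ∈ D.poly e := by rw [← hl.mem, h]; simp [h1]
      refine ⟨⟨mem_supp_of_mem h3, mem_supp_of_mem h2⟩, ?_⟩
      rintro ⟨z, rfl⟩
      have := D.avoid e he z (mem_supp_of_mem h3)
      rw [huv, Sym2.mem_iff] at this
      rcases this with rfl | rfl
      · exact n1 (by rw [hu]; exact List.mem_append_left _ h1)
      · exact n3 _ h1 y (by simp) hv.symm
  rw [PLDraw.cr, SDraw.cr, this, Set.ncard_coe_finset, List.toFinset_card_of_nodup (n2.filter _)]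
  congr!

lemma segs_split (l₁ l₂ l₃ : List Plane) (p q : Plane) : segs (l₁ ++ p :: (l₂ ++ q :: l₃)) =
    segs (l₁ ++ [p]) ++ (segs (p :: (l₂ ++ [q])) ++ segs (q :: l₃)) := by
  rw [segs_append]
  congr 1
  exact segs_append (p :: l₂) l₃ q

lemma getLast?_split {α : Type*} (l₁ l₂ l₃ : List α) (p q : α) :
    (l₁ ++ p :: (l₂ ++ q :: l₃)).getLast? = (q :: l₃).getLast? := by
  rw [getLast?_append_cons]
  exact getLast?_append_cons (p :: l₂) l₃ q

/-- Exchange of two edges between two crossings. -/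
lemma PLDraw.exists_swap [Finite V] (D : PLDraw G K) {α β : E} (hα : α ∈ K) (hβ : β ∈ K)
    (hαβ : α ≠ β) {A B A₁ A₂ A₃ B₁ B₂ B₃ : List Plane} {p q : Plane} (hA : D.Orient α A)
    (hB : D.Orient β B) (hA' : A = A₁ ++ p :: (A₂ ++ q :: A₃))
    (hB' : B = B₁ ++ p :: (B₂ ++ q :: B₃)) (h1 : B₁ ≠ []) (h3 : B₃ ≠ [])
    (hsum : (A₂.map fun a => D.deg ((K.erase β).erase α) a).sum ≤
      (B₂.map fun a => D.deg ((K.erase β).erase α) a).sum) :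
    ∃ D' : SDraw G K, total D'.cr K < total D.cr K := by
  obtain ⟨x, y, hxy, hx, hy⟩ := hB.ends hβ
  have hK : K.erase β ⊆ K := Finset.erase_subset _ _
  have hαK : α ∈ K.erase β := Finset.mem_erase.2 ⟨hαβ, hα⟩
  have hne : x ≠ y := fun h => (hB.simple hβ).ends_ne (by have := hB.length hβ; omega) hx hy (h ▸ rfl)
  have sB : segs B = segs (B₁ ++ [p]) ++ (segs (p :: (B₂ ++ [q])) ++ segs (q :: B₃)) := by
    rw [hB', segs_split]
  have sA : segs A = segs (A₁ ++ [p]) ++ (segs (p :: (A₂ ++ [q])) ++ segs (q :: A₃)) := by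
    rw [hA', segs_split]
  have sW : segs (B₁ ++ p :: (A₂ ++ q :: B₃)) =
      segs (B₁ ++ [p]) ++ (segs (p :: (A₂ ++ [q])) ++ segs (q :: B₃)) := segs_split _ _ _ _ _
  have mA : ∀ s ∈ segs (p :: (A₂ ++ [q])), s ∈ segs (D.poly α) := fun s hs => by
    rw [← hA.mem_segs, sA]; simp [hs]
  have mB : ∀ s, s ∈ segs (B₁ ++ [p]) ∨ s ∈ segs (q :: B₃) → s ∈ segs (D.poly β) := fun s hs => by
    rw [← hB.mem_segs, sB, List.mem_append, List.mem_append]; tauto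
  have nA := (hA.simple hα).nodup_segs
  have nB := (hB.simple hβ).nodup_segs
  rw [sA, List.nodup_append, List.nodup_append] at nA
  rw [sB, List.nodup_append, List.nodup_append] at nB
  have hins := D.exists_insert hK (β := β) (by simp) hxy hne
    (W := B₁ ++ p :: (A₂ ++ q :: B₃))
    (by
      have := List.length_pos_of_ne_nil h1
      simp; omega)
    (by rw [← hx, hB']; exact head?_append_cons _ _)
    (by
      rw [← hy, hB', getLast?_split, getLast?_split])
    (by
      intro s hs
      rw [sW, List.mem_append, List.mem_append] at hs
      rcases hs with hs | hs | hs
      · exact D.mem_segments.2 ⟨β, hβ, mB s (Or.inl hs)⟩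
      · exact D.mem_segments.2 ⟨α, hα, mA s hs⟩
      · exact D.mem_segments.2 ⟨β, hβ, mB s (Or.inr hs)⟩)
    (by
      rw [sW, List.nodup_append, List.nodup_append]
      refine ⟨nB.1, ⟨nA.2.1.1, nB.2.1.2.1, ?_⟩, ?_⟩
      · rintro s hs _ ht rfl
        exact D.segments_disjoint hα hβ hαβ (mA s hs) (mB s (Or.inr ht))
      · rintro s hs _ ht rfl
        rcases List.mem_append.1 ht with ht | ht
        · exact D.segments_disjoint hα hβ hαβ (mA s ht) (mB s (Or.inl hs))
        · exact nB.2.2 s hs s (List.mem_append_right _ ht) rfl)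
  rw [Finset.insert_erase hβ] at hins
  obtain ⟨D', hD'⟩ := hins
  refine ⟨D', hD'.trans_lt ?_⟩
  have htot := total_insert D.cr_comm (Finset.notMem_erase β K)
  rw [Finset.insert_erase hβ] at htot
  obtain ⟨x', B₁', rfl⟩ := List.exists_cons_of_ne_nil h1
  obtain ⟨B₃', y', rfl⟩ := (List.eq_nil_or_concat B₃).resolve_left h3
  simp only [List.concat_eq_append] at *
  rw [htot, D.sum_cr hK hβ (Finset.notMem_erase β K) hB (M := B₁' ++ p :: (B₂ ++ q :: B₃'))
    (x := x') (y := y') (by rw [hB']; simp)]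
  obtain ⟨l₁, b, c, l₂, e1, e2, e3⟩ := cost_split (D.segments (K.erase β)) p h1
    (l₂ := A₂ ++ q :: (B₃' ++ [y'])) (by simp)
  obtain ⟨m₁, b', c', m₂, f1, f2, f3⟩ := cost_split (D.segments (K.erase β)) q (l₁ := p :: A₂)
    (by simp) h3
  have g1 := D.cost_infix_le hK hβ hB (l₁ := []) (M := B₁') (x := x') (y := p)
    (l₂ := B₂ ++ q :: (B₃' ++ [y'])) (by rw [hB']; simp)
  have g2 := D.cost_infix_le hK hα hA (l₁ := A₁) (M := A₂) (x := p) (y := q)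
    (l₂ := A₃) (by rw [hA']; simp)
  have g3 := D.cost_infix_le hK hβ hB (l₁ := x' :: B₁' ++ p :: B₂) (M := B₃') (x := q) (y := y')
    (l₂ := []) (by rw [hB']; simp)
  rw [Finset.erase_idem] at g1 g3
  have w1 : wt (D.segments (K.erase β)) b p c + 1 ≤ 2 * D.deg (K.erase β) p := by
    refine D.wt_turn_lt hK hαK (mA _ ?_)
    cases A₂ with
    | nil => simp at e2; simp [segs, e2.1]
    | cons a A₂ => simp at e2; simp [segs, e2.1]
  have w2 : wt (D.segments (K.erase β)) b' q c' + 1 ≤ 2 * D.deg (K.erase β) q := by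
    rw [wt_symm]
    refine D.wt_turn_lt hK hαK (mA _ ?_)
    rw [← List.cons_append, f1, List.append_assoc, List.singleton_append, segs_append]
    simp [segs, Sym2.eq_swap]
  have g4 : (B₂.map fun a => D.deg ((K.erase β).erase α) a).sum ≤
      (B₂.map fun a => D.deg (K.erase β) a).sum :=
    List.sum_le_sum fun a _ => D.deg_mono (Finset.erase_subset _ _) a
  rw [List.sum_map_mul_left] at g1 g2 g3
  simp only [List.map_append, List.map_cons, List.sum_append, List.sum_cons]
  simp only [List.cons_append] at *
  eta_reduce at *
  omega

lemma exists_split_or {α : Type*} {p q : α} (hpq : p ≠ q) {l : List α} (hp : p ∈ l) (hq : q ∈ l) :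
    (∃ a b c, l = a ++ p :: (b ++ q :: c)) ∨ ∃ a b c, l = a ++ q :: (b ++ p :: c) := by
  obtain ⟨s, t, rfl⟩ := List.append_of_mem hp
  rcases List.mem_append.1 hq with h | h
  · obtain ⟨a, b, rfl⟩ := List.append_of_mem h
    exact Or.inr ⟨a, b, t, by simp⟩
  · obtain ⟨a, b, rfl⟩ := List.append_of_mem ((List.mem_cons.1 h).resolve_left hpq.symm)
    exact Or.inl ⟨s, a, b, rfl⟩

lemma PLDraw.exists_orient (D : PLDraw G K) {e : E} (he : e ∈ K) {p q : Plane} (hpq : p ≠ q)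
    (hp : p ∈ D.poly e) (hq : q ∈ D.poly e) (hpr : p ∉ range D.pos) (hqr : q ∉ range D.pos) :
    ∃ l a b c, D.Orient e l ∧ l = a ++ p :: (b ++ q :: c) ∧ a ≠ [] ∧ c ≠ [] := by
  have : ∃ l a b c, D.Orient e l ∧ l = a ++ p :: (b ++ q :: c) := by
    rcases exists_split_or hpq hp hq with ⟨a, b, c, h⟩ | ⟨a, b, c, h⟩
    · exact ⟨_, a, b, c, Or.inl rfl, h⟩
    · exact ⟨_, c.reverse, b.reverse, a.reverse, Or.inr rfl, by rw [h]; simp⟩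
  obtain ⟨l, a, b, c, hl, h⟩ := this
  obtain ⟨x, y, -, hx, hy⟩ := hl.ends he
  refine ⟨l, a, b, c, hl, h, ?_, ?_⟩
  · rintro rfl
    rw [h] at hx
    exact hpr ⟨x, by simpa using hx.symm⟩
  · rintro rfl
    rw [h, getLast?_split] at hy
    exact hqr ⟨y, by simpa using hy.symm⟩

/-- If two edges cross twice, the number of crossings is not minimal. -/
theorem PLDraw.exists_lt_of_two_le [Finite V] (D : PLDraw G K) {α β : E} (hα : α ∈ K) (hβ : β ∈ K)
    (hαβ : α ≠ β) (h : 2 ≤ D.cr α β) : ∃ D' : SDraw G K, total D'.cr K < total D.cr K := by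
  obtain ⟨p, hp, q, hq, hpq⟩ := (Set.one_lt_ncard
    ((D.toSDraw.fin α hα β hβ hαβ).subset sdiff_subset)).1 h
  have pα := D.meet α hα β hβ hαβ p hp.1.1 hp.1.2
  have pβ := D.meet β hβ α hα hαβ.symm p hp.1.2 hp.1.1
  have qα := D.meet α hα β hβ hαβ q hq.1.1 hq.1.2
  have qβ := D.meet β hβ α hα hαβ.symm q hq.1.2 hq.1.1
  obtain ⟨A, A₁, A₂, A₃, hA, eA, a1, a3⟩ := D.exists_orient hα hpq pα qα hp.2 hq.2
  obtain ⟨B, B₁, B₂, B₃, hB, eB, b1, b3⟩ := D.exists_orient hβ hpq pβ qβ hp.2 hq.2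
  rcases le_total (A₂.map fun a => D.deg ((K.erase β).erase α) a).sum
    (B₂.map fun a => D.deg ((K.erase β).erase α) a).sum with hs | hs
  · exact D.exists_swap hα hβ hαβ hA hB eA eB b1 b3 hs
  · rw [Finset.erase_right_comm] at hs
    exact D.exists_swap hβ hα hαβ.symm hB hA eB eA a1 a3 hs

end Polyline

namespace Polyline
open Filter Topology Metric
open scoped Classical

lemma IsArc.image {A : Set Plane} {x y : Plane} (h : IsArc A x y) {φ : Plane → Plane}
    (hc : ContinuousOn φ A) (hi : InjOn φ A) : IsArc (φ '' A) (φ x) (φ y) := by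
  obtain ⟨γ, hγ, rfl⟩ := h
  have hm : ∀ t, γ t ∈ range γ := mem_range_self
  refine ⟨⟨⟨fun t => φ (γ t), hc.comp_continuous γ.continuous hm⟩, by simp, by simp⟩, ?_, ?_⟩
  · intro s t hst
    exact hγ (hi (hm s) (hm t) hst)
  · exact range_comp φ γ

/-- An inversion opens up a ray at a point of a set from which a short segment leaves the set. -/
lemma exists_free_ray {Z : Set Plane} {a w : Plane} (hw : w ≠ 0) {δ : ℝ} (hδ : 0 < δ)
    (h : ∀ s ∈ Ioc 0 δ, a + s • w ∉ Z) : ∃ φ : Plane → Plane, ContinuousOn φ Z ∧ InjOn φ Z ∧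
      ∀ t : ℝ, 0 < t → φ a - t • w ∉ φ '' Z := by
  let q : Plane → ℝ := fun v => v.1 ^ 2 + v.2 ^ 2
  have hq : ∀ v : Plane, v ≠ 0 → 0 < q v := by
    rintro ⟨x, y⟩ hv
    by_cases hx : x = 0
    · have hy : y ≠ 0 := by
        rintro rfl
        exact hv (by simp [hx])
      have := sq_nonneg x
      have : 0 < y ^ 2 := by positivity
      simp only [q]; linarith
    · have := sq_nonneg y
      have : 0 < x ^ 2 := by positivity
      simp only [q]; linarith
  have hqs : ∀ (r : ℝ) (v : Plane), q (r • v) = r ^ 2 * q v := by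
    intro r v
    simp only [q, Prod.smul_fst, Prod.smul_snd, smul_eq_mul]
    ring
  let j : Plane → Plane := fun v => (q v)⁻¹ • v
  have hj : ∀ v, j (j v) = v := by
    intro v
    by_cases hv : v = 0
    · simp [j, hv]
    · have := (hq v hv).ne'
      simp only [j, hqs, smul_smul]
      rw [show ((q v)⁻¹ ^ 2 * q v)⁻¹ * (q v)⁻¹ = 1 by field_simp, one_smul]
  have hz : ∀ x ∈ Z, x - (a + δ • w) ≠ 0 := by
    intro x hx h0
    exact h δ ⟨hδ, le_rfl⟩ (sub_eq_zero.1 h0 ▸ hx)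
  have hqw := hq w hw
  have hφa : j (a - (a + δ • w)) = -((δ * q w)⁻¹ • w) := by
    have : a - (a + δ • w) = (-δ) • w := by simp
    rw [this]
    simp only [j, hqs, smul_smul]
    rw [← neg_smul]
    congr 1
    field_simp
  refine ⟨fun x => j (x - (a + δ • w)), ?_, ?_, ?_⟩
  · have hcq : Continuous q := by fun_prop
    refine ContinuousOn.smul (ContinuousOn.inv₀ (hcq.comp (by fun_prop)).continuousOn ?_)
      (by fun_prop)
    intro x hx
    exact (hq _ (hz x hx)).ne'
  · intro x hx y hy hxy
    have := congrArg j hxy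
    simp only [hj] at this
    exact sub_left_injective this
  · rintro t ht ⟨x, hx, hxt⟩
    simp only [hφa] at hxt
    have h1 := congrArg j hxt
    rw [hj] at h1
    have hc : 0 < (δ * q w)⁻¹ + t := by positivity
    rw [show -((δ * q w)⁻¹ • w) - t • w = (-((δ * q w)⁻¹ + t)) • w by module] at h1
    simp only [j, hqs, smul_smul] at h1
    set c := (δ * q w)⁻¹ + t with hcd
    have h2 : ((-c) ^ 2 * q w)⁻¹ * -c = -(c * q w)⁻¹ := by field_simp
    rw [h2] at h1
    have h3 : (c * q w)⁻¹ < δ := by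
      rw [inv_lt_comm₀ (by positivity) hδ]
      have : c * q w = δ⁻¹ + t * q w := by rw [hcd]; field_simp
      rw [this]
      have : 0 < t * q w := by positivity
      linarith
    have h4 : x = a + (δ - (c * q w)⁻¹) • w := by
      rw [sub_eq_iff_eq_add] at h1
      rw [h1]; module
    refine h _ ⟨by linarith, ?_⟩ (h4 ▸ hx)
    have : 0 < (c * q w)⁻¹ := by positivity
    linarith

/-- Two copies of a compact set can be placed in the plane so that given points of them are joined
by a segment otherwise disjoint from both. -/
lemma exists_bridge_maps {Z : Set Plane} (hZ : IsCompact Z) {a b w : Plane} (ha : a ∈ Z)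
    (hb : b ∈ Z) (hw : w ≠ 0) {δ : ℝ} (hδ : 0 < δ) (h₁ : ∀ s ∈ Ioc 0 δ, a + s • w ∉ Z)
    (h₂ : ∀ s ∈ Ioc 0 δ, b + s • (-w) ∉ Z) :
    ∃ φ ψ : Plane → Plane, ContinuousOn φ Z ∧ ContinuousOn ψ Z ∧ InjOn φ Z ∧ InjOn ψ Z ∧
      (∀ x ∈ Z, ∀ y ∈ Z, φ x ≠ ψ y) ∧ (∀ x ∈ Z, φ x ∈ segment ℝ (φ a) (ψ b) → x = a) ∧
      (∀ x ∈ Z, ψ x ∈ segment ℝ (φ a) (ψ b) → x = b) := by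
  obtain ⟨φ, c1, i1, r1⟩ := exists_free_ray hw hδ h₁
  obtain ⟨ψ, c2, i2, r2⟩ := exists_free_ray (neg_ne_zero.2 hw) hδ h₂
  obtain ⟨R, hR⟩ := (hZ.image_of_continuousOn c1).isBounded.exists_norm_le
  obtain ⟨R', hR'⟩ := (hZ.image_of_continuousOn c2).isBounded.exists_norm_le
  have hR0 := (norm_nonneg _).trans (hR _ (mem_image_of_mem φ ha))
  have hR0' := (norm_nonneg _).trans (hR' _ (mem_image_of_mem ψ hb))
  have hw' : 0 < ‖w‖ := norm_pos_iff.2 hw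
  obtain ⟨T, hT0, hT⟩ : ∃ T : ℝ, 0 < T ∧ 2 * R + 2 * R' < T * ‖w‖ := by
    refine ⟨(2 * R + 2 * R' + 1) / ‖w‖, by positivity, ?_⟩
    rw [div_mul_cancel₀ _ hw'.ne']
    linarith
  have hd : ∀ x ∈ Z, ∀ y ∈ Z, φ x ≠ ψ y + (φ a - T • w - ψ b) := by
    intro x hx y hy hxy
    have h3 : T • w = ψ y - φ x + (φ a - ψ b) := by rw [hxy]; abel
    have h4 : ‖T • w‖ ≤ R' + R + (R + R') := by
      rw [h3]
      refine (norm_add_le _ _).trans (add_le_add ((norm_sub_le _ _).trans (add_le_add ?_ ?_))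
        ((norm_sub_le _ _).trans (add_le_add ?_ ?_)))
      exacts [hR' _ (mem_image_of_mem _ hy), hR _ (mem_image_of_mem _ hx),
        hR _ (mem_image_of_mem _ ha), hR' _ (mem_image_of_mem _ hb)]
    rw [norm_smul, Real.norm_of_nonneg hT0.le] at h4
    linarith
  have hψb : ψ b + (φ a - T • w - ψ b) = φ a - T • w := by abel
  refine ⟨φ, fun x => ψ x + (φ a - T • w - ψ b), c1, c2.add continuousOn_const, i1, ?_, hd, ?_, ?_⟩
  · intro x hx y hy hxy
    exact i2 hx hy (add_right_cancel hxy)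
  · intro x hx hs
    simp only [hψb] at hs
    rw [segment_eq_image'] at hs
    obtain ⟨t, ht, hs⟩ := hs
    rcases ht.1.eq_or_lt with rfl | h0
    · exact i1 hx ha (by simpa using hs.symm)
    · refine absurd ⟨x, hx, ?_⟩ (r1 (t * T) (by positivity))
      rw [← hs]; module
  · intro x hx hs
    simp only [hψb] at hs
    rw [segment_eq_image'] at hs
    obtain ⟨t, ht, hs⟩ := hs
    rcases ht.2.eq_or_lt with rfl | h0
    · refine i2 hx hb (add_right_cancel (b := φ a - T • w - ψ b) ?_)
      rw [← hs, hψb]; module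
    · refine absurd ⟨x, hx, ?_⟩ (r2 ((1 - t) * T) (mul_pos (by linarith) hT0))
      have h5 : ψ x = φ a + t • (φ a - T • w - φ a) - (φ a - T • w - ψ b) :=
        eq_sub_iff_add_eq.2 hs.symm
      rw [h5]; module

lemma eventually_notMem_segment {a p q w : Plane} (h : det2 w (q - p) ≠ 0) :
    ∀ᶠ s in 𝓝[>] (0 : ℝ), a + s • w ∉ segment ℝ p q := by
  by_cases ha : a ∈ segment ℝ p q
  · filter_upwards [self_mem_nhdsWithin] with s hs hm
    rw [segment_eq_image'] at ha hm
    obtain ⟨t, -, ht⟩ := ha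
    obtain ⟨t', -, ht'⟩ := hm
    have hs : 0 < s := hs
    have h1 : s • w = (t' - t) • (q - p) := by
      simp only at ht ht'
      rw [← ht] at ht'
      rw [sub_smul, eq_sub_iff_add_eq, ← add_right_inj p, ht']; module
    have h2 : det2 (s • w) (q - p) = 0 := by
      rw [h1, det2_smul_left]
      simp [det2]; right; ring
    rw [det2_smul_left] at h2
    exact (mul_ne_zero hs.ne' h) h2
  · have hc : Tendsto (fun s : ℝ => a + s • w) (𝓝[>] 0) (𝓝 a) := by
      have : Continuous fun s : ℝ => a + s • w := by fun_prop
      have := this.tendsto 0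
      simp only [zero_smul, add_zero] at this
      exact this.mono_left nhdsWithin_le_nhds
    exact hc.eventually ((isCompact_segment p q).isClosed.isOpen_compl.mem_nhds ha)

variable {V E : Type} {G : Multigraph V E} {K K' : Finset E}

/-- The point set of a drawing. -/
def PLDraw.image (D : PLDraw G K) : Set Plane := range D.pos ∪ ⋃ e ∈ K, supp (D.poly e)

lemma PLDraw.pos_mem_image (D : PLDraw G K) (x : V) : D.pos x ∈ D.image := Or.inl ⟨x, rfl⟩

lemma PLDraw.supp_subset_image (D : PLDraw G K) {e : E} (he : e ∈ K) :
    supp (D.poly e) ⊆ D.image := fun _ hp => Or.inr (mem_iUnion₂.2 ⟨e, he, hp⟩)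

lemma PLDraw.isCompact_image [Finite V] (D : PLDraw G K) : IsCompact D.image :=
  (finite_range _).isCompact.union
    (K.isCompact_biUnion fun _ _ => isCompact_supp _)

lemma PLDraw.eventually_notMem_image [Finite V] (D : PLDraw G K) {w : Plane} (hw0 : w ≠ 0)
    (hw : ∀ p q, s(p, q) ∈ D.segments K → det2 w (q - p) ≠ 0) (x : V) :
    ∀ᶠ s in 𝓝[>] (0 : ℝ), D.pos x + s • w ∉ D.image := by
  have h1 : ∀ᶠ s in 𝓝[>] (0 : ℝ), ∀ t ∈ D.segments K, D.pos x + s • w ∉ segSet t := by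
    rw [Filter.eventually_all_finset]
    intro t ht
    induction t with | _ p q
    exact eventually_notMem_segment (hw p q ht)
  have h2 : ∀ᶠ s in 𝓝[>] (0 : ℝ), ∀ y : V, D.pos x + s • w ≠ D.pos y := by
    rw [Filter.eventually_all]
    intro y
    have hc : Continuous fun s : ℝ => D.pos x + s • w := by fun_prop
    by_cases hxy : x = y
    · subst hxy
      filter_upwards [self_mem_nhdsWithin] with s hs h
      have hs : 0 < s := hs
      exact (smul_ne_zero hs.ne' hw0) (by simpa using h)
    · have := hc.tendsto 0
      simp only [zero_smul, add_zero] at this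
      exact (this.mono_left nhdsWithin_le_nhds).eventually_ne (D.inj.ne hxy)
  filter_upwards [h1, h2] with s h1 h2
  rintro (⟨y, hy⟩ | h)
  · exact h2 y hy.symm
  · obtain ⟨e, he, h⟩ := mem_iUnion₂.1 h
    obtain ⟨t, ht, h⟩ := exists_segs_of_mem_supp (by have := D.len e he; omega) h
    exact h1 t (D.mem_segments.2 ⟨e, he, ht⟩) h

lemma PLDraw.exists_bridge_maps [Finite V] (D : PLDraw G K) (a b : V) :
    ∃ φ ψ : Plane → Plane, ContinuousOn φ D.image ∧ ContinuousOn ψ D.image ∧ InjOn φ D.image ∧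
      InjOn ψ D.image ∧ (∀ x ∈ D.image, ∀ y ∈ D.image, φ x ≠ ψ y) ∧
      (∀ x ∈ D.image, φ x ∈ segment ℝ (φ (D.pos a)) (ψ (D.pos b)) → x = D.pos a) ∧
      (∀ x ∈ D.image, ψ x ∈ segment ℝ (φ (D.pos a)) (ψ (D.pos b)) → x = D.pos b) := by
  obtain ⟨B, hB⟩ : ∃ B : Finset Plane, ∀ d, d ∈ B ↔ ∃ p q, s(p, q) ∈ D.segments K ∧ q - p = d := by
    have : {d : Plane | ∃ p q, s(p, q) ∈ D.segments K ∧ q - p = d}.Finite := by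
      refine ((D.segments K).finite_toSet.biUnion (t := fun s =>
        {d | ∃ p q, s(p, q) = s ∧ q - p = d}) ?_).subset ?_
      · intro s _
        induction s with | _ p q
        refine ((Set.finite_singleton (p - q)).insert (q - p)).subset ?_
        rintro _ ⟨p', q', h, rfl⟩
        rcases Sym2.eq_iff.1 h with ⟨rfl, rfl⟩ | ⟨rfl, rfl⟩ <;> simp
      · rintro d ⟨p, q, h, rfl⟩
        exact mem_iUnion₂.2 ⟨_, h, p, q, rfl, rfl⟩
    exact ⟨this.toFinset, fun d => by simp⟩
  obtain ⟨w, hw1, -, hw⟩ := exists_separating (d₁ := ((1, 0) : Plane)) (d₂ := ((0, 1) : Plane))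
    (by simp) (by simp) (by rintro ⟨k, -, h⟩; simpa using congrArg Prod.snd h) B (by
      intro d hd
      obtain ⟨p, q, h, rfl⟩ := (hB d).1 hd
      obtain ⟨e, he, h⟩ := D.mem_segments.1 h
      exact sub_ne_zero.2 ((D.simple e he).ne_of_mem_segs h).symm)
  have hw0 : w ≠ 0 := by
    rintro rfl
    simp at hw1
  have hd : ∀ p q, s(p, q) ∈ D.segments K → det2 w (q - p) ≠ 0 := fun p q h =>
    hw _ ((hB _).2 ⟨p, q, h, rfl⟩)
  have e1 := D.eventually_notMem_image hw0 hd a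
  have e2 := D.eventually_notMem_image (neg_ne_zero.2 hw0)
    (fun p q h => by rw [det2_neg_left]; exact neg_ne_zero.2 (hd p q h)) b
  obtain ⟨δ, hδ, h⟩ := (nhdsGT_basis (0 : ℝ)).mem_iff.1 (e1.and e2)
  have hδ' : ∀ s ∈ Ioc 0 (δ / 2), s ∈ Ioo 0 δ := fun s hs => ⟨hs.1, by linarith [hs.1, hs.2]⟩
  exact Polyline.exists_bridge_maps D.isCompact_image (D.pos_mem_image a) (D.pos_mem_image b) hw0
    (half_pos hδ) (fun s hs => (h (hδ' s hs)).1) (fun s hs => (h (hδ' s hs)).2)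

end Polyline

namespace Polyline
open scoped Classical

variable {V E : Type} {G : Multigraph V E} {K : Finset E}

/-- A bridge can be drawn without crossings. -/
theorem PLDraw.exists_bridge [Finite V] (D : PLDraw G K) {f : E} (hf : f ∈ K) {a b : V}
    (hab : G.ends f = s(a, b)) {S : Set V} (ha : a ∈ S) (hb : b ∉ S)
    (hS : ∀ g ∈ K, g ≠ f → (∀ x ∈ G.ends g, x ∈ S) ∨ ∀ x ∈ G.ends g, x ∉ S) :
    ∃ D' : SDraw G K, total D'.cr K ≤ total D.cr (K.erase f) := by
  obtain ⟨φ, ψ, c1, c2, i1, i2, hd, s1, s2⟩ := D.exists_bridge_maps a b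
  have hp := D.pos_mem_image
  let pos : V → Plane := fun x => if x ∈ S then φ (D.pos x) else ψ (D.pos x)
  have pos1 : ∀ x, x ∈ S → pos x = φ (D.pos x) := fun x hx => if_pos hx
  have pos2 : ∀ x, x ∉ S → pos x = ψ (D.pos x) := fun x hx => if_neg hx
  let arc : E → Set Plane := fun g => if g = f then segment ℝ (φ (D.pos a)) (ψ (D.pos b)) else
    if ∀ x ∈ G.ends g, x ∈ S then φ '' supp (D.poly g) else ψ '' supp (D.poly g)
  have arcf : arc f = segment ℝ (φ (D.pos a)) (ψ (D.pos b)) := if_pos rfl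
  have hT : ∀ g ∈ K, g ≠ f → ((∀ x ∈ G.ends g, x ∈ S) ∧ arc g = φ '' supp (D.poly g)) ∨
      ((∀ x ∈ G.ends g, x ∉ S) ∧ arc g = ψ '' supp (D.poly g)) := by
    intro g hg hgf
    by_cases h : ∀ x ∈ G.ends g, x ∈ S
    · exact Or.inl ⟨h, by simp only [arc, if_neg hgf, if_pos h]⟩
    · exact Or.inr ⟨(hS g hg hgf).resolve_left h, by simp only [arc, if_neg hgf, if_neg h]⟩
  have hfg : ∀ g ∈ K, g ≠ f → arc f ∩ arc g ⊆ {pos a, pos b} := by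
    rintro g hg hgf p ⟨h1, h2⟩
    rw [arcf] at h1
    rw [mem_insert_iff, mem_singleton_iff, pos1 a ha, pos2 b hb]
    rcases hT g hg hgf with ⟨-, h⟩ | ⟨-, h⟩ <;> rw [h] at h2 <;> obtain ⟨z, hz, rfl⟩ := h2
    · exact Or.inl (congrArg φ (s1 z (D.supp_subset_image hg hz) h1))
    · exact Or.inr (congrArg ψ (s2 z (D.supp_subset_image hg hz) h1))
  have hgh : ∀ g ∈ K, ∀ h ∈ K, g ≠ f → h ≠ f → ∃ θ : Plane → Plane,
      arc g ∩ arc h ⊆ θ '' (supp (D.poly g) ∩ supp (D.poly h)) ∧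
      ∀ x, D.pos x ∈ supp (D.poly g) → θ (D.pos x) = pos x := by
    intro g hg h hh hgf hhf
    have j1 := D.supp_subset_image hg
    have j2 := D.supp_subset_image hh
    rcases hT g hg hgf with ⟨e1, h1⟩ | ⟨e1, h1⟩ <;> rcases hT h hh hhf with ⟨e2, h2⟩ | ⟨e2, h2⟩ <;>
      rw [h1, h2]
    · exact ⟨φ, (i1.image_inter j1 j2).ge, fun x hx => (pos1 x (e1 x (D.avoid g hg x hx))).symm⟩
    · refine ⟨φ, ?_, fun x hx => (pos1 x (e1 x (D.avoid g hg x hx))).symm⟩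
      rintro _ ⟨⟨z, hz, rfl⟩, z', hz', h⟩
      exact absurd h.symm (hd z (j1 hz) z' (j2 hz'))
    · refine ⟨ψ, ?_, fun x hx => (pos2 x (e1 x (D.avoid g hg x hx))).symm⟩
      rintro _ ⟨⟨z, hz, rfl⟩, z', hz', h⟩
      exact absurd h (hd z' (j2 hz') z (j1 hz))
    · exact ⟨ψ, (i2.image_inter j1 j2).ge, fun x hx => (pos2 x (e1 x (D.avoid g hg x hx))).symm⟩
  have hfin : ∀ g ∈ K, ∀ h ∈ K, g ≠ h → (supp (D.poly g) ∩ supp (D.poly h)).Finite :=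
    D.toSDraw.fin
  let D' : SDraw G K :=
    { pos := pos
      arc := arc
      inj := by
        intro x y hxy
        by_cases hx : x ∈ S <;> by_cases hy : y ∈ S
        · rw [pos1 x hx, pos1 y hy] at hxy
          exact D.inj (i1 (hp x) (hp y) hxy)
        · rw [pos1 x hx, pos2 y hy] at hxy
          exact absurd hxy (hd _ (hp x) _ (hp y))
        · rw [pos2 x hx, pos1 y hy] at hxy
          exact absurd hxy.symm (hd _ (hp y) _ (hp x))
        · rw [pos2 x hx, pos2 y hy] at hxy
          exact D.inj (i2 (hp x) (hp y) hxy)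
      isArc := by
        intro g hg
        by_cases hgf : g = f
        · subst hgf
          refine ⟨a, b, hab, ?_⟩
          rw [arcf, pos1 a ha, pos2 b hb]
          exact isArc_segment (hd _ (hp a) _ (hp b))
        · obtain ⟨x, y, hxy, hA⟩ := D.toSDraw.isArc g hg
          have hx : x ∈ G.ends g := hxy ▸ Sym2.mem_mk_left x y
          have hy : y ∈ G.ends g := hxy ▸ Sym2.mem_mk_right x y
          refine ⟨x, y, hxy, ?_⟩
          rcases hT g hg hgf with ⟨e, h⟩ | ⟨e, h⟩ <;> rw [h]
          · rw [pos1 x (e x hx), pos1 y (e y hy)]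
            exact hA.image (c1.mono (D.supp_subset_image hg)) (i1.mono (D.supp_subset_image hg))
          · rw [pos2 x (e x hx), pos2 y (e y hy)]
            exact hA.image (c2.mono (D.supp_subset_image hg)) (i2.mono (D.supp_subset_image hg))
      avoid := by
        intro g hg x hx
        by_cases hgf : g = f
        · subst hgf
          rw [arcf] at hx
          rw [hab, Sym2.mem_iff]
          by_cases hxS : x ∈ S
          · rw [pos1 x hxS] at hx
            exact Or.inl (D.inj (s1 _ (hp x) hx))
          · rw [pos2 x hxS] at hx
            exact Or.inr (D.inj (s2 _ (hp x) hx))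
        · rcases hT g hg hgf with ⟨e, h⟩ | ⟨e, h⟩ <;> rw [h] at hx <;> obtain ⟨z, hz, hx⟩ := hx <;>
            by_cases hxS : x ∈ S
          · rw [pos1 x hxS] at hx
            exact D.avoid g hg x (i1 (D.supp_subset_image hg hz) (hp x) hx ▸ hz)
          · rw [pos2 x hxS] at hx
            exact absurd hx (hd _ (D.supp_subset_image hg hz) _ (hp x))
          · rw [pos1 x hxS] at hx
            exact absurd hx.symm (hd _ (hp x) _ (D.supp_subset_image hg hz))
          · rw [pos2 x hxS] at hx
            exact D.avoid g hg x (i2 (D.supp_subset_image hg hz) (hp x) hx ▸ hz)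
      fin := by
        intro g hg h hh hne
        by_cases hgf : g = f
        · subst hgf
          exact (Set.toFinite _).subset (hfg h hh hne.symm)
        · by_cases hhf : h = f
          · subst hhf
            rw [inter_comm]
            exact (Set.toFinite _).subset (hfg g hg hne)
          · obtain ⟨θ, h1, -⟩ := hgh g hg h hh hgf hhf
            exact ((hfin g hg h hh hne).image θ).subset h1 }
  refine ⟨D', ?_⟩
  have hins := total_insert D'.cr_comm (Finset.notMem_erase f K)
  have h0 : ∑ g ∈ K.erase f, D'.cr f g = 0 := by
    refine Finset.sum_eq_zero fun g hg => ?_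
    rw [Finset.mem_erase] at hg
    have : (D'.arc f ∩ D'.arc g) \ range D'.pos = ∅ := by
      rw [sdiff_eq_empty]
      refine (hfg g hg.2 hg.1).trans ?_
      rintro p (rfl | rfl)
      exacts [mem_range_self a, mem_range_self b]
    rw [SDraw.cr, this, ncard_empty]
  rw [Finset.insert_erase hf, h0, mul_zero, add_zero] at hins
  rw [hins]
  refine total_congr fun g hg h hh hne => ?_
  rw [Finset.mem_erase] at hg hh
  obtain ⟨θ, h1, h2⟩ := hgh g hg.2 h hh.2 hg.1 hh.1
  have hF := hfin g hg.2 h hh.2 hne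
  refine (ncard_le_ncard (t := θ '' ((supp (D.poly g) ∩ supp (D.poly h)) \ range D.pos)) ?_
    ((hF.subset sdiff_subset).image θ)).trans (ncard_image_le (hF.subset sdiff_subset))
  rintro p ⟨hp1, hp2⟩
  obtain ⟨z, hz, rfl⟩ := h1 hp1
  refine ⟨z, ⟨hz, ?_⟩, rfl⟩
  rintro ⟨x, rfl⟩
  exact hp2 ⟨x, (h2 x hz.1).symm⟩

end Polyline

namespace Polyline
open scoped Classical

variable {V E : Type} {G : Multigraph V E} {K : Finset E}

/-- A nontrivial walk from `x` to `y` with given edges and internal vertices. -/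
inductive IsRoute (G : Multigraph V E) : V → V → List E → List V → Prop
  | single {x y e} (h : G.ends e = s(x, y)) : IsRoute G x y [e] []
  | cons {x y z e es vs} (h : G.ends e = s(x, y)) (hr : IsRoute G y z es vs) :
    IsRoute G x z (e :: es) (y :: vs)

lemma IsRoute.length {x y : V} {es : List E} {vs : List V} (h : IsRoute G x y es vs) :
    es.length = vs.length + 1 := by
  induction h with
  | single => rfl
  | cons _ _ ih => simp [ih]

lemma IsRoute.rel {x y : V} {es : List E} {vs : List V} (h : IsRoute G x y es vs)
    {r : V → V → Prop} (ht : ∀ a b c, r a b → r b c → r a c)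
    (hr : ∀ e ∈ es, ∀ a b, G.ends e = s(a, b) → r a b) : r x y := by
  induction h with
  | single h => exact hr _ (by simp) _ _ h
  | cons h _ ih =>
    exact ht _ _ _ (hr _ (by simp) _ _ h) (ih fun e he => hr e (List.mem_cons_of_mem _ he))

lemma isRoute_of_get : ∀ (es : List E) (vs : List V) (x y : V), es ≠ [] →
    vs.head? = some x → vs.getLast? = some y → ∀ hl : vs.length = es.length + 1,
    (∀ i : ℕ, ∀ hi : i < es.length, G.ends (es.get ⟨i, hi⟩) =
      s(vs.get ⟨i, by omega⟩, vs.get ⟨i + 1, by omega⟩)) →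
    IsRoute G x y es (vs.drop 1).dropLast
  | [], _, _, _, h, _, _, _, _ => absurd rfl h
  | [e], [a, b], x, y, _, hx, hy, _, he => by
    obtain rfl : a = x := by simpa using hx
    obtain rfl : b = y := by simpa using hy
    exact .single (he 0 (by simp))
  | e :: e' :: es, a :: b :: vs, x, y, _, hx, hy, hl, he => by
    obtain rfl : a = x := by simpa using hx
    obtain ⟨c, vs, rfl⟩ : ∃ c vs', vs = c :: vs' := by
      cases vs with
      | nil => simp at hl
      | cons c vs' => exact ⟨c, vs', rfl⟩
    have ih := isRoute_of_get (e' :: es) (b :: c :: vs) b y (by simp) rfl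
      (by simpa using hy) (by simpa using hl) (fun i hi => he (i + 1) (by simpa using hi))
    exact .cons (he 0 (by simp)) ih

lemma _root_.Multigraph.MPath.isRoute {u v : V} (p : G.MPath u v) (h : u ≠ v) :
    IsRoute G u v p.edges p.internal := by
  refine isRoute_of_get _ _ _ _ ?_ p.head_eq p.last_eq p.len_eq p.ends_eq
  intro h0
  have hl := p.len_eq
  have h1 := p.head_eq
  have h2 := p.last_eq
  rw [h0] at hl
  obtain ⟨a, ha⟩ := List.length_eq_one_iff.1 hl
  rw [ha] at h1 h2
  exact h (by simp_all)

lemma exists_side {u v : V} {e f : E} (he : G.ends e = s(u, v)) {es : List E} {vs : List V}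
    (hr : IsRoute G u v es vs) (hes : e ∉ es) (h : G.IsTwoEdgeCut e f) :
    ∃ (a b : V) (S : Set V), G.ends f = s(a, b) ∧ a ∈ S ∧ b ∉ S ∧
      ∀ g, g ≠ e → g ≠ f → (∀ x ∈ G.ends g, x ∈ S) ∨ ∀ x ∈ G.ends g, x ∉ S := by
  obtain ⟨hef, p, q, hpq, hnot⟩ := h
  let R := G.Reach ∅ {e, f}
  have step : ∀ g, g ≠ e → g ≠ f → ∀ x y, G.ends g = s(x, y) → R x y := fun g h1 h2 x y hg =>
    .single ⟨by simp, by simp, g, by simp [h1, h2], hg⟩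
  have symm : ∀ x y, R x y → R y x := by
    intro x y h
    induction h with
    | refl => exact .refl
    | tail _ hs ih =>
      obtain ⟨h1, h2, g, hg, hxy⟩ := hs
      exact .head ⟨h2, h1, g, hg, hxy.trans Sym2.eq_swap⟩ ih
  obtain ⟨a, b, hab⟩ : ∃ a b, G.ends f = s(a, b) := by
    induction h : G.ends f with | _ a b
    exact ⟨a, b, rfl⟩
  refine ⟨a, b, {x | R a x}, hab, .refl, ?_, ?_⟩
  · intro hb
    have hb : R a b := hb
    have hf : ∀ x y, G.ends f = s(x, y) → R x y := by
      intro x y hxy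
      rcases Sym2.eq_iff.1 (hab.symm.trans hxy) with ⟨rfl, rfl⟩ | ⟨rfl, rfl⟩
      exacts [hb, symm _ _ hb]
    have hne : ∀ g, g ≠ e → ∀ x y, G.ends g = s(x, y) → R x y := by
      intro g hg x y hxy
      by_cases hgf : g = f
      · exact hf x y (hgf ▸ hxy)
      · exact step g hg hgf x y hxy
    have huv : R u v := hr.rel (fun _ _ _ => .trans)
      fun g hg => hne g fun h => hes (h ▸ hg)
    refine hnot ?_
    clear hnot
    induction hpq with
    | refl => exact .refl
    | tail _ hs ih =>
      refine Relation.ReflTransGen.trans ih ?_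
      obtain ⟨-, -, g, -, hg⟩ := hs
      by_cases hge : g = e
      · rcases Sym2.eq_iff.1 (he.symm.trans (hge ▸ hg)) with ⟨rfl, rfl⟩ | ⟨rfl, rfl⟩
        exacts [huv, symm _ _ huv]
      · exact hne g hge _ _ hg
  · intro g h1 h2
    induction h : G.ends g with | _ x y
    have hxy : R x y := step g h1 h2 x y h
    simp only [Sym2.mem_iff, forall_eq_or_imp, forall_eq]
    by_cases hx : R a x
    · exact Or.inl ⟨hx, hx.trans hxy⟩
    · exact Or.inr ⟨hx, fun hy => hx (hy.trans (symm _ _ hxy))⟩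

end Polyline

namespace Polyline
open scoped Classical

variable {V E : Type} {G : Multigraph V E} {K : Finset E}

/-- The number of crossings on an edge. -/
noncomputable def PLDraw.crossings (D : PLDraw G K) (e : E) : ℕ := ∑ f ∈ K.erase e, D.cr e f

lemma PLDraw.exists_orient_of_ends (D : PLDraw G K) {e : E} (he : e ∈ K) {x y : V}
    (hxy : G.ends e = s(x, y)) :
    ∃ l, D.Orient e l ∧ l.head? = some (D.pos x) ∧ l.getLast? = some (D.pos y) := by
  obtain ⟨x', y', h, hx, hy⟩ := D.ends e he
  rcases Sym2.eq_iff.1 (h.symm.trans hxy) with ⟨rfl, rfl⟩ | ⟨rfl, rfl⟩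
  · exact ⟨_, Or.inl rfl, hx, hy⟩
  · exact ⟨_, Or.inr rfl, by simpa using hy, by simpa using hx⟩

lemma PLDraw.card_spokes_pos_le (D : PLDraw G K) {e : E} (he : e ∈ K) (x : V) :
    (spokes (D.poly e) (D.pos x)).card ≤ 1 := by
  by_cases hx : D.pos x ∈ D.poly e
  · have hxe := D.avoid e he x (mem_supp_of_mem hx)
    obtain ⟨y, hy⟩ := Sym2.mem_iff_exists.1 hxe
    obtain ⟨l, hl, hx, -⟩ := D.exists_orient_of_ends he hy
    obtain ⟨m, rfl⟩ := exists_eq_cons hx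
    have := card_spokes_head (hl.simple he)
    rcases hl with hl | hl
    · rwa [← hl]
    · rwa [hl, spokes_reverse] at this
  · simp [spokes_eq_empty hx]

lemma PLDraw.wt_pos_le [Finite E] (D : PLDraw G K) (b c : Plane) (x : V) :
    wt (D.segments K) b (D.pos x) c ≤ G.degree x := by
  have h1 : (K.filter fun e => x ∈ G.ends e).card ≤ G.degree x := by
    rw [← Set.ncard_coe_finset]
    exact ncard_le_ncard (fun e he => (Finset.mem_filter.1 he).2) (Set.toFinite _)
  refine le_trans ?_ h1
  calc wt (D.segments K) b (D.pos x) c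
      ≤ ((K.filter fun e => x ∈ G.ends e).biUnion fun e => spokes (D.poly e) (D.pos x)).card := by
        refine Finset.card_le_card fun s hs => ?_
        obtain ⟨hs, hx, -⟩ := Finset.mem_filter.1 hs
        obtain ⟨e, he, hs⟩ := D.mem_segments.1 hs
        exact Finset.mem_biUnion.2 ⟨e, Finset.mem_filter.2
          ⟨he, D.avoid e he x (mem_supp_of_mem (mem_of_mem_segs hs hx))⟩, mem_spokes.2 ⟨hs, hx⟩⟩
    _ ≤ _ := by
        refine Finset.card_biUnion_le.trans ?_
        rw [Finset.card_eq_sum_ones]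
        exact Finset.sum_le_sum fun e he =>
          D.card_spokes_pos_le (Finset.mem_filter.1 he).1 x

lemma PLDraw.cost_edge_le (D : PLDraw G K) {e : E} (he : e ∈ K) {l : List Plane}
    (hl : D.Orient e l) : cost (D.segments K) l ≤ 2 * D.crossings e := by
  obtain ⟨x, y, -, hx, hy⟩ := hl.ends he
  have h3 := hl.length he
  obtain ⟨m, rfl⟩ := exists_eq_cons hx
  have hm : m ≠ [] := by rintro rfl; simp at h3
  obtain ⟨M, z, rfl⟩ := (List.eq_nil_or_concat m).resolve_left hm
  rw [List.concat_eq_append] at *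
  have h1 := D.cost_infix_le subset_rfl he hl (l₁ := []) (M := M) (x := D.pos x) (y := z)
    (l₂ := []) (by simp)
  rw [List.sum_map_mul_left] at h1
  have h2 := D.sum_cr (Finset.erase_subset e K) he (Finset.notMem_erase e K) hl rfl
  rw [PLDraw.crossings, h2]
  exact h1

lemma IsRoute.exists_polyline [Finite E] (D : PLDraw G K) {x y : V} {es : List E} {vs : List V}
    (h : IsRoute G x y es vs) : (∀ e ∈ es, e ∈ K) → es.Nodup →
    ∃ W : List Plane, 3 ≤ W.length ∧ W.head? = some (D.pos x) ∧ W.getLast? = some (D.pos y) ∧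
      (∀ s ∈ segs W, ∃ e ∈ es, s ∈ segs (D.poly e)) ∧ (segs W).Nodup ∧
      cost (D.segments K) W ≤ 2 * (es.map D.crossings).sum + (vs.map G.degree).sum := by
  induction h with
  | @single x y e h =>
    intro hK _
    have he := hK e (by simp)
    obtain ⟨l, hl, hx, hy⟩ := D.exists_orient_of_ends he h
    refine ⟨l, hl.length he, hx, hy, fun s hs => ⟨e, by simp, hl.mem_segs.1 hs⟩,
      (hl.simple he).nodup_segs, ?_⟩
    simpa using D.cost_edge_le he hl
  | @cons x y z e es vs h _ ih =>
    intro hK hnd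
    obtain ⟨hee, hnd⟩ := List.nodup_cons.1 hnd
    have he := hK e (by simp)
    have hK' : ∀ e ∈ es, e ∈ K := fun e he => hK e (List.mem_cons_of_mem _ he)
    obtain ⟨W, w1, w2, w3, w4, w5, w6⟩ := ih hK' hnd
    obtain ⟨l, hl, hx, hy⟩ := D.exists_orient_of_ends he h
    have hl3 := hl.length he
    obtain ⟨m, rfl⟩ := exists_eq_concat hy
    obtain ⟨W', rfl⟩ := exists_eq_cons w2
    have hm : m ≠ [] := by rintro rfl; simp at hl3
    have hW' : W' ≠ [] := by rintro rfl; simp at w1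
    obtain ⟨m', b, c, W'', -, -, hc⟩ := cost_split (D.segments K) (D.pos y) hm hW'
    refine ⟨m ++ D.pos y :: W', ?_, ?_, ?_, ?_, ?_, ?_⟩
    · simp at w1 ⊢; omega
    · rw [← hx]; exact head?_append_cons _ _
    · rw [getLast?_append_cons]; exact w3
    · intro s hs
      rw [segs_append, List.mem_append] at hs
      rcases hs with hs | hs
      · exact ⟨e, by simp, hl.mem_segs.1 hs⟩
      · obtain ⟨f, hf, hs⟩ := w4 s hs
        exact ⟨f, List.mem_cons_of_mem _ hf, hs⟩
    · rw [segs_append, List.nodup_append]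
      refine ⟨(hl.simple he).nodup_segs, w5, ?_⟩
      rintro s hs _ ht rfl
      obtain ⟨f, hf, ht⟩ := w4 s ht
      exact D.segments_disjoint he (hK' f hf) (fun h => hee (h ▸ hf)) (hl.mem_segs.1 hs) ht
    · rw [hc]
      have h1 := D.cost_edge_le he hl
      have h2 := D.wt_pos_le b c y
      simp only [List.map_cons, List.sum_cons]
      omega

/-- Inserting an edge along a route in a drawing of the other edges. -/
lemma PLDraw.crNum_le_of_isRoute [Finite V] [Fintype E] {e₀ : E}
    (D : PLDraw G (Finset.univ.erase e₀)) {u v : V} (huv : u ≠ v) (he₀ : G.ends e₀ = s(u, v))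
    {es : List E} {vs : List V} (h : IsRoute G u v es vs) (hes : e₀ ∉ es) (hnd : es.Nodup)
    {Δ : ℕ} (hΔ : ∀ w ∈ vs, G.degree w < Δ) :
    2 * G.crNum ≤ total D.cr (Finset.univ.erase e₀) + 2 * (es.map D.crossings).sum +
      (es.length - 1) * (Δ - 1) := by
  have hK : ∀ e ∈ es, e ∈ Finset.univ.erase e₀ := fun e he =>
    Finset.mem_erase.2 ⟨fun h => hes (h ▸ he), Finset.mem_univ e⟩
  obtain ⟨W, w1, w2, w3, w4, w5, w6⟩ := h.exists_polyline D hK hnd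
  have := D.exists_insert subset_rfl (Finset.notMem_erase e₀ _) he₀ huv w1 w2 w3
    (fun s hs => D.mem_segments.2 (by
      obtain ⟨e, he, hs⟩ := w4 s hs
      exact ⟨e, hK e he, hs⟩)) w5
  rw [Finset.insert_erase (Finset.mem_univ e₀)] at this
  obtain ⟨D', hD'⟩ := this
  have h1 := crNum_le D'
  have h2 : (vs.map G.degree).sum ≤ (es.length - 1) * (Δ - 1) := by
    rw [h.length, Nat.add_sub_cancel]
    have := List.sum_le_card_nsmul (vs.map G.degree) (Δ - 1) (by
      intro n hn
      obtain ⟨w, hw, rfl⟩ := List.mem_map.1 hn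
      have := hΔ w hw
      omega)
    simpa using this
  omega

/-- There is a crossing-minimal drawing which is polygonal. -/
lemma SDraw.exists_minimal_pLDraw [Finite V] (D : SDraw G K) : ∃ D₁ : PLDraw G K,
    total D₁.cr K ≤ total D.cr K ∧ ∀ D' : SDraw G K, total D₁.cr K ≤ total D'.cr K := by
  obtain ⟨D₀, h₀⟩ : ∃ D₀ : SDraw G K, ∀ D' : SDraw G K, total D₀.cr K ≤ total D'.cr K := by
    have hne : (range fun D : SDraw G K => total D.cr K).Nonempty := ⟨_, D, rfl⟩
    obtain ⟨D₀, h⟩ := Nat.sInf_mem hne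
    exact ⟨D₀, fun D' => h.le.trans (Nat.sInf_le ⟨D', rfl⟩)⟩
  obtain ⟨D₁, h₁⟩ := D₀.exists_pLDraw
  exact ⟨D₁, h₁.trans (h₀ D), fun D' => h₁.trans (h₀ D')⟩

/-- A good drawing restricts to a subgraph. -/
def restrict (D : G.GoodDrawing) (S : Set E) : (G.delete S).GoodDrawing where
  vpos := D.vpos
  arc e := D.arc e
  vpos_inj := D.vpos_inj
  arc_cont e := D.arc_cont e
  arc_inj e := D.arc_inj e
  arc_ends e := D.arc_ends e
  arc_avoid e := D.arc_avoid e
  finCross := by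
    refine (D.finCross.preimage (f := fun q : ({e : E // e ∉ S} × {e : E // e ∉ S}) × ℝ × ℝ =>
      (((q.1.1 : E), (q.1.2 : E)), q.2)) ?_).subset ?_
    · rintro ⟨⟨a, b⟩, p⟩ - ⟨⟨a', b'⟩, p'⟩ - h
      simpa [Subtype.ext_iff] using h
    · rintro ⟨⟨a, b⟩, p⟩ ⟨h1, h2⟩
      exact ⟨fun h => h1 (Subtype.ext h), h2⟩

lemma exists_goodDrawing_delete {S : Set E} (h : 0 < G.crNum) :
    ∃ D : (G.delete S).GoodDrawing, D.crossings = (G.delete S).crNum := by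
  obtain ⟨_, D, -⟩ := Nat.nonempty_of_pos_sInf h
  exact Nat.sInf_mem (s := {n | ∃ D : (G.delete S).GoodDrawing, D.crossings = n})
    ⟨_, restrict D S, rfl⟩

end Polyline

namespace Polyline
open scoped Classical

/-- The integral form of the bound, with the base edge removed. -/
theorem crNum_le_of_earring {V E : Type} [Fintype V] [Fintype E] {G : Multigraph V E} {ℓ Δ : ℕ}
    (X : G.Earring ℓ Δ) (hG : 0 < G.crNum) :
    4 * G.crNum ≤ 3 * (2 * (G.delete {X.base}).crNum + 1) + 2 * ℓ * (2 * ℓ - 1) +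
      2 * ((ℓ - 1) * (Δ - 1)) := by
  obtain ⟨D₀, hD₀⟩ := exists_goodDrawing_delete (S := {X.base}) hG
  obtain ⟨D₁, hD₁⟩ := exists_sDraw_delete D₀
  obtain ⟨D, hDD₁, hmin⟩ := D₁.exists_minimal_pLDraw
  have hT : total D.cr (Finset.univ.erase X.base) ≤ 2 * (G.delete {X.base}).crNum + 1 := by
    rw [← hD₀, Multigraph.GoodDrawing.crossings]
    omega
  have h1 : ∀ e ∈ Finset.univ.erase X.base, ∀ f ∈ Finset.univ.erase X.base, e ≠ f → D.cr e f ≤ 1 := by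
    intro e he f hf hef
    by_contra! h
    obtain ⟨D', hD'⟩ := D.exists_lt_of_two_le he hf hef h
    exact (hmin D').not_gt hD'
  have rP := X.P.isRoute X.une
  have rQ := X.Q.isRoute X.une
  have hPK : X.P.edges.toFinset ⊆ Finset.univ.erase X.base := fun e he =>
    Finset.mem_erase.2 ⟨fun h => X.base_not_P (h ▸ List.mem_toFinset.1 he), Finset.mem_univ e⟩
  have hQK : X.Q.edges.toFinset ⊆ Finset.univ.erase X.base := fun e he =>
    Finset.mem_erase.2 ⟨fun h => X.base_not_Q (h ▸ List.mem_toFinset.1 he), Finset.mem_univ e⟩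
  have hcommon : ∑ f ∈ X.P.edges.toFinset ∩ X.Q.edges.toFinset, D.crossings f = 0 := by
    refine Finset.sum_eq_zero fun f hf => ?_
    rw [Finset.mem_inter] at hf
    have hfK := hPK hf.1
    obtain ⟨a, b, S, hab, ha, hb, hS⟩ := exists_side X.ends_base rP X.base_not_P
      (X.common_cut f (List.mem_toFinset.1 hf.1) (List.mem_toFinset.1 hf.2))
    obtain ⟨D', hD'⟩ := D.exists_bridge hfK hab ha hb fun g hg =>
      hS g (Finset.ne_of_mem_erase hg)
    have h2 := total_insert D.cr_comm (Finset.notMem_erase f (Finset.univ.erase X.base))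
    rw [Finset.insert_erase hfK] at h2
    have h3 := hmin D'
    rw [PLDraw.crossings]
    omega
  have hsum := Finset.sum_union_inter (s₁ := X.P.edges.toFinset) (s₂ := X.Q.edges.toFinset)
    (f := D.crossings)
  rw [hcommon, add_zero, List.sum_toFinset _ X.P.enodup, List.sum_toFinset _ X.Q.enodup] at hsum
  have hZ := two_mul_sum_le_total D.cr_comm (Finset.union_subset hPK hQK)
    fun e he f hf => h1 e (Finset.union_subset hPK hQK he) f (Finset.union_subset hPK hQK hf)
  have hcard : (X.P.edges.toFinset ∪ X.Q.edges.toFinset).card ≤ 2 * ℓ := by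
    refine (Finset.card_union_le _ _).trans ?_
    have := X.P.edges.toFinset_card_le
    have := X.Q.edges.toFinset_card_le
    have := X.lenP
    have := X.lenQ
    omega
  have hcard' := Nat.mul_le_mul hcard (Nat.sub_le_sub_right hcard 1)
  have hP := D.crNum_le_of_isRoute X.une X.ends_base rP X.base_not_P X.P.enodup X.degP
  have hQ := D.crNum_le_of_isRoute X.une X.ends_base rQ X.base_not_Q X.Q.enodup X.degQ
  have hPl := Nat.mul_le_mul_right (Δ - 1) (Nat.sub_le_sub_right X.lenP 1)
  have hQl := Nat.mul_le_mul_right (Δ - 1) (Nat.sub_le_sub_right X.lenQ 1)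
  change 2 * ∑ f ∈ _, D.crossings f ≤ _ at hZ
  rw [hsum] at hZ
  eta_reduce at hZ
  omega

end Polyline

/-- If `G` possesses an `(ℓ, Δ)`-earring, then some edge `e`
satisfies `cr(G − e) > (2/3)·cr(G) − (2/3)(Δℓ + ℓ²)`. -/
theorem statement6 {V E : Type} [Fintype V] [Fintype E] (G : Multigraph V E)
    (hloop : G.Loopless) (ℓ Δ : ℕ) (hℓ : 1 ≤ ℓ) (hΔ : 1 ≤ Δ)
    (X : G.Earring ℓ Δ) :
    ∃ e : E, (2 / 3 : ℝ) * (G.crNum : ℝ) - 2 / 3 * ((Δ : ℝ) * ℓ + (ℓ : ℝ) ^ 2) <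
      ((G.delete {e}).crNum : ℝ) := by
  refine ⟨X.base, ?_⟩
  have hℓ' : (1 : ℝ) ≤ ℓ := by exact_mod_cast hℓ
  have hΔ' : (1 : ℝ) ≤ Δ := by exact_mod_cast hΔ
  have hc : (0 : ℝ) ≤ ((G.delete {X.base}).crNum : ℝ) := Nat.cast_nonneg _
  rcases Nat.eq_zero_or_pos G.crNum with h0 | h0
  · rw [h0, Nat.cast_zero]
    nlinarith
  · have h := Polyline.crNum_le_of_earring X h0
    have h' : (4 : ℝ) * G.crNum ≤ 3 * (2 * (G.delete {X.base}).crNum + 1) +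
        2 * ℓ * (2 * ℓ - 1) + 2 * ((ℓ - 1) * (Δ - 1)) := by
      have e1 : ((2 * ℓ - 1 : ℕ) : ℝ) = 2 * (ℓ : ℝ) - 1 := by
        rw [Nat.cast_sub (by omega)]; push_cast; ring
      have e2 : ((ℓ - 1 : ℕ) : ℝ) = (ℓ : ℝ) - 1 := by
        rw [Nat.cast_sub hℓ, Nat.cast_one]
      have e3 : ((Δ - 1 : ℕ) : ℝ) = (Δ : ℝ) - 1 := by
        rw [Nat.cast_sub hΔ, Nat.cast_one]
      rw [← e1, ← e2, ← e3]
      exact_mod_cast h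
    nlinarith
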